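/- Let J be a Jordan algebra of compact operators on a complex Banach space X (a linear subspace of B(X), closed under the Jordan product {A,B} = AB + BA, all of whose elements are compact). If J has sublinear spectrum, i.e. σ(A + λB) ⊆ {α + λβ : α ∈ σ(A), β ∈ σ(B)} for all A, B ∈ J and all λ ∈ ℂ, then J is triangularizable: there exists a set 𝒞 of closed subspaces of X, each invariant under every element of J, such that 𝒞 is a maximal chain in the set of all closed subspaces of X ordered by inclusion. -/

import Mathlib

section NilpotentJordan

variable {k A : Type*} [Field k] [Ring A] [Algebra k A]

/-- The span of all Jordan products `n * t + t * n` with `n ∈ N` and `t ∈ T`. -/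
def jordanSpan (N T : Submodule k A) : Submodule k A :=
  Submodule.span k {a | ∃ n ∈ N, ∃ t ∈ T, a = n * t + t * n}

lemma jordanSpan_le_sup (N T : Submodule k A) : jordanSpan N T ≤ N * T ⊔ T * N := by
  refine Submodule.span_le.2 ?_
  rintro _ ⟨n, hn, t, ht, rfl⟩
  exact add_mem (Submodule.mem_sup_left (Submodule.mul_mem_mul hn ht))
    (Submodule.mem_sup_right (Submodule.mul_mem_mul ht hn))

lemma iterate_jordanSpan_le (N T : Submodule k A) (j : ℕ) :
    (jordanSpan N)^[j] T ≤ ⨆ p : ℕ, ⨆ q : ℕ, ⨆ _ : j ≤ p + q, N ^ p * T * N ^ q := by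
  induction j with
  | zero =>
    refine le_trans ?_ (le_iSup_of_le 0 (le_iSup_of_le 0 (le_iSup_of_le (by simp) le_rfl)))
    simp
  | succ j ih =>
    rw [Function.iterate_succ_apply']
    refine (jordanSpan_le_sup _ _).trans (sup_le ?_ ?_)
    · refine (mul_le_mul_right ih _).trans ?_
      simp only [Submodule.mul_iSup]
      refine iSup_le fun p => iSup_le fun q => iSup_le fun h => ?_
      refine le_iSup_of_le (p + 1) (le_iSup_of_le q (le_iSup_of_le (by omega) ?_))
      rw [pow_succ', mul_assoc, mul_assoc, mul_assoc]
    · refine (mul_le_mul_left ih _).trans ?_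
      simp only [Submodule.iSup_mul]
      refine iSup_le fun p => iSup_le fun q => iSup_le fun h => ?_
      refine le_iSup_of_le p (le_iSup_of_le (q + 1) (le_iSup_of_le (by omega) ?_))
      rw [pow_succ, mul_assoc]

lemma Submodule.pow_eq_bot_of_le {N : Submodule k A} {m p : ℕ} (h : N ^ m = ⊥) (hp : m ≤ p) :
    N ^ p = ⊥ := by
  rw [← Nat.sub_add_cancel hp, pow_add, h, Submodule.mul_bot]

lemma sup_span_singleton_pow_eq_bot {N : Submodule k A} {m : ℕ} (hN : N ^ m = ⊥) {b : A}
    (hb : IsNilpotent b) (hbN : ∀ n ∈ N, n * b + b * n ∈ N) :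
    ∃ p, (N ⊔ Submodule.span k {b}) ^ p = ⊥ := by
  obtain ⟨q, hq⟩ := hb
  set N' := N ⊔ Submodule.span k {b} with hN'
  let U : Submodule k A := Subalgebra.toSubmodule (Algebra.adjoin k (N' : Set A))
  have hN'U : N' ≤ U := fun x hx => Algebra.subset_adjoin hx
  have hNU : N ≤ U := le_sup_left.trans hN'U
  have hbN' : b ∈ N' := Submodule.mem_sup_right (Submodule.mem_span_singleton_self b)
  have hbU : b ∈ U := hN'U hbN'
  have hone : (1 : Submodule k A) ≤ U := Submodule.one_le.2 (one_mem (Algebra.adjoin k _))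
  have hUU : U * U ≤ U := Submodule.mul_le.2 fun x hx y hy =>
    mul_mem (S := Subalgebra k A) hx hy
  have hcomm : U * N ≤ N * U := by
    refine Submodule.mul_le.2 fun u hu n hn => ?_
    suffices ∀ n ∈ N, u * n ∈ N * U from this n hn
    have hu' : u ∈ Algebra.adjoin k (N' : Set A) := hu
    clear hu
    induction hu' using Algebra.adjoin_induction with
    | mem x hx =>
      intro n hn
      obtain ⟨y, hy, z, hz, rfl⟩ := Submodule.mem_sup.1 hx
      obtain ⟨c, rfl⟩ := Submodule.mem_span_singleton.1 hz
      rw [add_mul]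
      refine add_mem (Submodule.mul_mem_mul hy (hNU hn)) ?_
      rw [smul_mul_assoc]
      refine Submodule.smul_mem _ _ ?_
      have : b * n = (n * b + b * n) * 1 - n * b := by simp
      rw [this]
      exact sub_mem (Submodule.mul_mem_mul (hbN n hn) (hone (Submodule.one_le.1 le_rfl)))
        (Submodule.mul_mem_mul hn hbU)
    | algebraMap r =>
      intro n hn
      rw [Algebra.commutes]
      exact Submodule.mul_mem_mul hn (Subalgebra.algebraMap_mem _ r)
    | add x y _ _ hx hy =>
      intro n hn
      rw [add_mul]; exact add_mem (hx n hn) (hy n hn)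
    | mul x y _ hxm hx hy =>
      rename_i hxU hyU
      intro n hn
      have h1 : x * (y * n) ∈ Submodule.span k {x} * (N * U) :=
        Submodule.mul_mem_mul (Submodule.mem_span_singleton_self x) (hy n hn)
      rw [mul_assoc]
      refine (?_ : Submodule.span k {x} * (N * U) ≤ N * U) h1
      rw [← mul_assoc]
      have h2 : Submodule.span k {x} * N ≤ N * U := by
        refine Submodule.mul_le.2 fun a ha n' hn' => ?_
        obtain ⟨c, rfl⟩ := Submodule.mem_span_singleton.1 ha
        rw [smul_mul_assoc]
        exact Submodule.smul_mem _ _ (hx n' hn')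
      calc _ ≤ N * U * U := mul_le_mul_left h2 _
        _ ≤ N * U := by rw [mul_assoc]; exact mul_le_mul_right hUU _
  have hpow : ∀ i, (N * U) ^ i ≤ N ^ i * U := by
    intro i
    induction i with
    | zero => simpa using hone
    | succ i ih =>
      calc (N * U) ^ (i + 1) ≤ N ^ i * U * (N * U) := by
            rw [pow_succ]; exact mul_le_mul_left ih _
        _ = N ^ i * (U * N) * U := by simp only [mul_assoc]
        _ ≤ N ^ i * (N * U) * U := mul_le_mul_left (mul_le_mul_right hcomm _) _
        _ = N ^ (i + 1) * (U * U) := by rw [pow_succ]; simp only [mul_assoc]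
        _ ≤ N ^ (i + 1) * U := mul_le_mul_right hUU _
  have hle : ∀ i, N' ^ (i + 1) ≤ N * U ⊔ Submodule.span k {b ^ (i + 1)} := by
    intro i
    induction i with
    | zero =>
      simp only [zero_add, pow_one]
      refine sup_le_sup_right ?_ _
      exact fun x hx => by simpa using Submodule.mul_mem_mul hx (hone (Submodule.one_le.1 le_rfl))
    | succ i ih =>
      rw [pow_succ']
      refine (mul_le_mul_right ih _).trans ?_
      rw [Submodule.mul_sup]
      refine sup_le (le_sup_of_le_left ?_) ?_
      · calc N' * (N * U) ≤ U * (N * U) := mul_le_mul_left hN'U _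
          _ ≤ N * U * U := by rw [← mul_assoc]; exact mul_le_mul_left hcomm _
          _ ≤ N * U := by rw [mul_assoc]; exact mul_le_mul_right hUU _
      · rw [hN', Submodule.sup_mul]
        refine sup_le_sup (mul_le_mul_right ?_ _) ?_
        · rw [Submodule.span_singleton_le_iff_mem]
          exact pow_mem (show b ∈ Algebra.adjoin k (N' : Set A) from hbU) _
        · rw [Submodule.span_mul_span]
          simp [pow_succ']
  refine ⟨(q + 1) * m, ?_⟩
  rw [pow_mul, ← le_bot_iff]
  have h1 : N' ^ (q + 1) ≤ N * U := by
    refine (hle q).trans ?_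
    rw [pow_succ, hq]; simp
  calc (N' ^ (q + 1)) ^ m ≤ (N * U) ^ m := pow_le_pow_left' h1 m
    _ ≤ N ^ m * U := hpow m
    _ = ⊥ := by rw [hN, Submodule.bot_mul]

/-- A finite-dimensional space of nilpotent elements closed under the Jordan product generates a
nilpotent associative algebra. -/
theorem Submodule.exists_pow_eq_bot_of_jordan (S : Submodule k A) [FiniteDimensional k S]
    (hJ : ∀ a ∈ S, ∀ b ∈ S, a * b + b * a ∈ S) (hnil : ∀ a ∈ S, IsNilpotent a) :
    ∃ m, S ^ m = ⊥ := by
  let P : Submodule k S → Prop := fun N => ∃ m, (N.map S.subtype) ^ m = ⊥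
  obtain ⟨N₀, ⟨m, hm⟩, hmax⟩ : ∃ N₀, P N₀ ∧ ∀ N, P N → ¬ N₀ < N := by
    obtain ⟨N₀, h1, h2⟩ := WellFounded.has_min (wellFounded_gt (α := Submodule k S)) {N | P N}
      ⟨⊥, 1, by simp⟩
    exact ⟨N₀, h1, fun N hN => h2 N hN⟩
  set N := N₀.map S.subtype with hN
  have hNS : N ≤ S := Submodule.map_subtype_le _ _
  by_cases hSN : S ≤ N
  · exact ⟨m, le_bot_iff.1 (hm ▸ pow_le_pow_left' hSN m)⟩
  exfalso
  obtain ⟨b₀, hb₀S, hb₀N⟩ := SetLike.not_le_iff_exists.1 hSN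
  let T : ℕ → Submodule k A := fun j => (jordanSpan N)^[j] (Submodule.span k {b₀})
  have hTS : ∀ j, T j ≤ S := by
    intro j
    induction j with
    | zero => simpa [T] using hb₀S
    | succ j ih =>
      simp only [T, Function.iterate_succ_apply']
      refine Submodule.span_le.2 ?_
      rintro _ ⟨n, hn, t, ht, rfl⟩
      exact hJ _ (hNS hn) _ (ih ht)
  have hex : ∃ j, T j ≤ N := by
    refine ⟨m + m, (iterate_jordanSpan_le _ _ _).trans ?_⟩
    refine iSup_le fun p => iSup_le fun q => iSup_le fun h => ?_
    rcases (by omega : m ≤ p ∨ m ≤ q) with h | h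
    · simp [Submodule.pow_eq_bot_of_le hm h]
    · simp [Submodule.pow_eq_bot_of_le hm h]
  classical
  obtain ⟨j, hj, hmin⟩ : ∃ j, T (j + 1) ≤ N ∧ ¬ T j ≤ N := by
    have h0 : Nat.find hex ≠ 0 := fun h => by
      have := Nat.find_spec hex
      rw [h] at this
      exact hb₀N (this (Submodule.mem_span_singleton_self b₀))
    obtain ⟨j, hj⟩ := Nat.exists_eq_succ_of_ne_zero h0
    exact ⟨j, by simpa [hj] using Nat.find_spec hex, Nat.find_min hex (by omega)⟩
  obtain ⟨b, hbT, hbN⟩ := SetLike.not_le_iff_exists.1 hmin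
  have hbS := hTS j hbT
  obtain ⟨p, hp⟩ := sup_span_singleton_pow_eq_bot hm (hnil b hbS) (fun n hn => hj (by
    simp only [T, Function.iterate_succ_apply']
    exact Submodule.subset_span ⟨n, hn, b, hbT, rfl⟩))
  have hmap : (N₀ ⊔ Submodule.span k {⟨b, hbS⟩}).map S.subtype = N ⊔ Submodule.span k {b} := by
    rw [Submodule.map_sup, Submodule.map_span]; simp [hN]
  refine hmax (N₀ ⊔ Submodule.span k {⟨b, hbS⟩}) ⟨p, by rw [hmap]; exact hp⟩ ?_
  refine lt_of_le_of_ne le_sup_left fun h => hbN ?_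
  have : (⟨b, hbS⟩ : S) ∈ N₀ := by
    rw [h]; exact Submodule.mem_sup_right (Submodule.mem_span_singleton_self _)
  exact ⟨_, this, rfl⟩

end NilpotentJordan

section FiniteRank

open Submodule

variable {Y : Type*} [NormedAddCommGroup Y] [NormedSpace ℂ Y]

/-- A set of operators is reducible if it has a nontrivial closed invariant subspace. -/
def IsReducible (F : Set (Y →L[ℂ] Y)) : Prop :=
  ∃ M : Submodule ℂ Y, IsClosed (M : Set Y) ∧ M ≠ ⊥ ∧ M ≠ ⊤ ∧ ∀ a ∈ F, ∀ x ∈ M, a x ∈ M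

lemma isReducible_of_span {F : Set (Y →L[ℂ] Y)} {S : Set Y} {T : Y →L[ℂ] Y}
    (hF : ∀ a ∈ F, ∀ s ∈ S, a s ∈ (span ℂ S).topologicalClosure) (hS : ∃ s ∈ S, s ≠ 0)
    (hT : T ≠ 0) (hTS : ∀ s ∈ S, T s = 0) : IsReducible F := by
  refine ⟨(span ℂ S).topologicalClosure, isClosed_topologicalClosure _, ?_, ?_, ?_⟩
  · obtain ⟨s, hs, h0⟩ := hS
    intro h
    have : s ∈ (span ℂ S).topologicalClosure := le_topologicalClosure _ (subset_span hs)
    rw [h] at this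
    exact h0 (by simpa using this)
  · intro h
    have h1 : (span ℂ S).topologicalClosure ≤ LinearMap.ker (T : Y →ₗ[ℂ] Y) :=
      topologicalClosure_minimal _ (span_le.2 fun s hs => by simpa using hTS s hs)
        T.isClosed_ker
    refine hT (ContinuousLinearMap.ext fun y => ?_)
    have : y ∈ (span ℂ S).topologicalClosure := h ▸ mem_top
    simpa using h1 this
  · intro a ha
    have h1 : span ℂ S ≤ ((span ℂ S).topologicalClosure).comap (a : Y →ₗ[ℂ] Y) :=
      span_le.2 fun s hs => hF a ha s hs
    exact topologicalClosure_minimal _ h1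
      ((isClosed_topologicalClosure _).preimage a.continuous)

lemma exists_pow_apply_eq_zero (S : Submodule ℂ (Y →L[ℂ] Y))
    (hJ : ∀ a ∈ S, ∀ b ∈ S, a * b + b * a ∈ S) (W : Submodule ℂ Y) [FiniteDimensional ℂ W]
    (hW : ∀ a ∈ S, ∀ w ∈ W, a w ∈ W) (hnil : ∀ a ∈ S, ∃ n : ℕ, ∀ w ∈ W, (a ^ n) w = 0) :
    ∃ m : ℕ, ∀ t ∈ S ^ m, ∀ w ∈ W, t w = 0 := by
  let S' : Submodule ℂ (Module.End ℂ W) :=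
    { carrier := {f | ∃ a ∈ S, ∀ w : W, (f w : Y) = a w}
      zero_mem' := ⟨0, zero_mem _, fun w => by simp⟩
      add_mem' := by
        rintro f g ⟨a, ha, hfa⟩ ⟨b, hb, hgb⟩
        exact ⟨a + b, add_mem ha hb, fun w => by simp [hfa, hgb]⟩
      smul_mem' := by
        rintro c f ⟨a, ha, hfa⟩
        exact ⟨c • a, smul_mem _ _ ha, fun w => by simp [hfa]⟩ }
  have hpow : ∀ (f : Module.End ℂ W) (a : Y →L[ℂ] Y), (∀ w : W, (f w : Y) = a w) →
      ∀ (n : ℕ) (w : W), ((f ^ n) w : Y) = (a ^ n) w := by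
    intro f a h n
    induction n with
    | zero => simp
    | succ n ih =>
      intro w
      rw [pow_succ, pow_succ]
      simp only [Module.End.mul_apply, mul_apply_eq_comp]
      rw [ih, h]
  obtain ⟨m, hm⟩ := Submodule.exists_pow_eq_bot_of_jordan S' (by
      rintro f ⟨a, ha, hfa⟩ g ⟨b, hb, hgb⟩
      exact ⟨_, hJ a ha b hb, fun w => by simp [hfa, hgb]⟩) (by
      rintro f ⟨a, ha, hfa⟩
      obtain ⟨n, hn⟩ := hnil a ha
      refine ⟨n, LinearMap.ext fun w => Subtype.ext ?_⟩
      rw [hpow f a hfa]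
      simpa using hn w w.2)
  refine ⟨m, fun t ht => ?_⟩
  obtain ⟨f, hf, hft⟩ : ∃ f ∈ S' ^ m, ∀ w : W, (f w : Y) = t w := by
    clear hm
    induction ht using Submodule.pow_induction_on_left' with
    | algebraMap r =>
      exact ⟨algebraMap ℂ _ r, by simp, fun w => by simp [Algebra.algebraMap_eq_smul_one]⟩
    | add x y i hx hy h1 h2 =>
      obtain ⟨f, hf, hfx⟩ := h1
      obtain ⟨g, hg, hgy⟩ := h2
      exact ⟨f + g, add_mem hf hg, fun w => by simp [hfx, hgy]⟩
    | mem_mul a ha i x hx h =>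
      obtain ⟨f, hf, hfx⟩ := h
      let g : Module.End ℂ W := (a : Y →ₗ[ℂ] Y).restrict (hW a ha)
      refine ⟨g * f, ?_, fun w => by simp [g, hfx]⟩
      rw [pow_succ']
      exact mul_mem_mul ⟨a, ha, fun w => rfl⟩ hf
  intro w hw
  rw [hm, mem_bot] at hf
  rw [← hft ⟨w, hw⟩, hf]
  simp

lemma exists_common_kernel_vector (S : Submodule ℂ (Y →L[ℂ] Y))
    (hJ : ∀ a ∈ S, ∀ b ∈ S, a * b + b * a ∈ S) (W : Submodule ℂ Y) [FiniteDimensional ℂ W]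
    (hW : ∀ a ∈ S, ∀ w ∈ W, a w ∈ W) (hnil : ∀ a ∈ S, ∃ n : ℕ, ∀ w ∈ W, (a ^ n) w = 0)
    (hW0 : W ≠ ⊥) : ∃ w, w ≠ 0 ∧ ∀ a ∈ S, a w = 0 := by
  have hex := exists_pow_apply_eq_zero S hJ W hW hnil
  classical
  obtain ⟨m, hm⟩ : ∃ m, Nat.find hex = m + 1 := by
    refine Nat.exists_eq_succ_of_ne_zero fun h => ?_
    have h1 := Nat.find_spec hex
    rw [h] at h1
    refine hW0 ((Submodule.eq_bot_iff _).2 fun w hw => ?_)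
    have e : S ^ 0 = 1 := pow_zero S
    rw [e] at h1
    simpa using h1 1 (Submodule.one_le.1 le_rfl) w hw
  have h1 := Nat.find_spec hex
  have h2 := Nat.find_min hex (m := m) (by omega)
  push Not at h2
  obtain ⟨t, ht, w, hw, h0⟩ := h2
  refine ⟨t w, h0, fun a ha => ?_⟩
  have e : S ^ (m + 1) = S * S ^ m := pow_succ' S m
  rw [hm, e] at h1
  exact h1 (a * t) (mul_mem_mul ha ht) w hw

end FiniteRank

section FiniteRankIdeal

open Submodule

lemma mem_iSup_pow_of_mem_adjoin {A : Type*} [Ring A] [Algebra ℂ A] (S : Submodule ℂ A) {n : A}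
    (hn : n ∈ NonUnitalAlgebra.adjoin ℂ (S : Set A)) (k : ℕ) :
    n ^ (k + 1) ∈ ⨆ i : ℕ, S ^ (i + (k + 1)) := by
  have hmul : ∀ a b : ℕ, (⨆ i : ℕ, S ^ (i + a)) * (⨆ i : ℕ, S ^ (i + b)) ≤
      ⨆ i : ℕ, S ^ (i + (a + b)) := by
    intro a b
    simp only [Submodule.iSup_mul, Submodule.mul_iSup]
    refine iSup_le fun i => iSup_le fun j => le_iSup_of_le (i + j) (le_of_eq ?_)
    rw [← pow_add]; congr 1; omega
  have h1 : n ∈ ⨆ i : ℕ, S ^ (i + 1) := by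
    induction hn using NonUnitalAlgebra.adjoin_induction with
    | mem x hx => exact (le_iSup (fun i : ℕ => S ^ (i + 1)) 0) (by simpa using hx)
    | add x y _ _ hx hy => exact add_mem hx hy
    | zero => exact zero_mem _
    | smul c x _ hx => exact smul_mem _ _ hx
    | mul x y _ _ hx hy =>
      refine (?_ : _ ≤ ⨆ i : ℕ, S ^ (i + 1)) (hmul 1 1 (mul_mem_mul hx hy))
      exact iSup_le fun i => le_iSup_of_le (i + 1) (le_of_eq (by congr 1))
  induction k with
  | zero => simpa using h1
  | succ k ih =>
    rw [pow_succ]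
    exact hmul _ _ (mul_mem_mul ih h1)

lemma Submodule.pow_eq_mul_pow {A : Type*} [Ring A] [Algebra ℂ A] (S : Submodule ℂ A)
    {a b c : ℕ} (h : c = a + b) : S ^ c = S ^ a * S ^ b := by
  rw [h, pow_add]

variable {Y : Type*} [NormedAddCommGroup Y] [NormedSpace ℂ Y]

lemma isNilpotent_of_mem_adjoin {R : Submodule ℂ (Y →L[ℂ] Y)}
    (hJ : ∀ a ∈ R, ∀ b ∈ R, a * b + b * a ∈ R)
    (hfin : ∀ a ∈ R, FiniteDimensional ℂ (LinearMap.range (a : Y →ₗ[ℂ] Y)))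
    (hnil : ∀ a ∈ R, IsNilpotent a) {n : Y →L[ℂ] Y}
    (hn : n ∈ NonUnitalAlgebra.adjoin ℂ (R : Set (Y →L[ℂ] Y))) :
    FiniteDimensional ℂ (LinearMap.range (n : Y →ₗ[ℂ] Y)) ∧ IsNilpotent n := by
  let RV : Submodule ℂ Y → Submodule ℂ (Y →L[ℂ] Y) := fun V =>
    { carrier := {x | x ∈ R ∧ ∀ y, x y ∈ V}
      zero_mem' := ⟨zero_mem _, by simp⟩
      add_mem' := fun h1 h2 => ⟨add_mem h1.1 h2.1, fun y => add_mem (h1.2 y) (h2.2 y)⟩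
      smul_mem' := fun c _ h => ⟨smul_mem _ _ h.1, fun y => smul_mem _ _ (h.2 y)⟩ }
  have hmono : ∀ V V', V ≤ V' → RV V ≤ RV V' := fun V V' h x hx => ⟨hx.1, fun y => h (hx.2 y)⟩
  obtain ⟨V, hVf, hV, hnV⟩ : ∃ V : Submodule ℂ Y, FiniteDimensional ℂ V ∧ (∀ y, n y ∈ V) ∧
      n ∈ NonUnitalAlgebra.adjoin ℂ (RV V : Set (Y →L[ℂ] Y)) := by
    have key : ∀ V V' : Submodule ℂ Y, V ≤ V' →
        NonUnitalAlgebra.adjoin ℂ (RV V : Set (Y →L[ℂ] Y)) ≤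
        NonUnitalAlgebra.adjoin ℂ (RV V' : Set (Y →L[ℂ] Y)) := fun V V' h =>
      NonUnitalAlgebra.adjoin_mono (hmono V V' h)
    induction hn using NonUnitalAlgebra.adjoin_induction with
    | mem x hx =>
      have h : ∀ y, x y ∈ LinearMap.range (x : Y →ₗ[ℂ] Y) := fun y => ⟨y, rfl⟩
      exact ⟨_, hfin x hx, h, NonUnitalAlgebra.subset_adjoin ℂ ⟨hx, h⟩⟩
    | add x y _ _ hx hy =>
      obtain ⟨V, h1, h2, h3⟩ := hx
      obtain ⟨V', h1', h2', h3'⟩ := hy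
      refine ⟨V ⊔ V', inferInstance, fun z => add_mem (mem_sup_left (h2 z)) (mem_sup_right (h2' z)),
        add_mem (key _ _ le_sup_left h3) (key _ _ le_sup_right h3')⟩
    | zero => exact ⟨⊥, inferInstance, by simp, zero_mem _⟩
    | smul c x _ hx =>
      obtain ⟨V, h1, h2, h3⟩ := hx
      exact ⟨V, h1, fun z => smul_mem _ _ (h2 z), SMulMemClass.smul_mem _ h3⟩
    | mul x y _ _ hx hy =>
      obtain ⟨V, h1, h2, h3⟩ := hx
      obtain ⟨V', h1', h2', h3'⟩ := hy
      exact ⟨V ⊔ V', inferInstance, fun z => mem_sup_left (h2 _),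
        mul_mem (key _ _ le_sup_left h3) (key _ _ le_sup_right h3')⟩
  refine ⟨Submodule.finiteDimensional_of_le (S₂ := V) ?_, ?_⟩
  · rintro _ ⟨y, rfl⟩
    exact hV y
  obtain ⟨m, hm⟩ := exists_pow_apply_eq_zero (RV V)
    (fun a ha b hb => ⟨hJ a ha.1 b hb.1, fun y => add_mem (ha.2 _) (hb.2 _)⟩) V
    (fun a ha w _ => ha.2 w) (fun a ha => by
      obtain ⟨p, hp⟩ := hnil a ha.1
      exact ⟨p, fun w _ => by simp [hp]⟩)
  refine ⟨m + 1 + 1, ContinuousLinearMap.ext fun y => ?_⟩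
  rw [pow_succ, mul_apply_eq_comp]
  have hz : ∀ t ∈ ⨆ i : ℕ, RV V ^ (i + (m + 1)), ∀ w ∈ V, t w = 0 := by
    intro t ht
    induction ht using Submodule.iSup_induction' with
    | mem i x hx =>
      intro w hw
      rw [Submodule.pow_eq_mul_pow _ (by omega : i + (m + 1) = m + (i + 1))] at hx
      induction hx using Submodule.mul_induction_on' with
      | mem_mul_mem a ha b hb =>
        refine hm a ha _ ?_
        rw [Submodule.pow_eq_mul_pow _ (add_comm i 1), Submodule.pow_one] at hb
        induction hb using Submodule.mul_induction_on' with
        | mem_mul_mem c hc d hd => exact hc.2 _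
        | add x _ y _ hx hy => exact add_mem hx hy
      | add x _ y _ hx hy => simp [hx, hy]
    | zero => simp
    | add x y _ _ hx hy => intro w hw; simp [hx w hw, hy w hw]
  simpa using hz _ (mem_iSup_pow_of_mem_adjoin _ hnV m) _ (hV y)

lemma foldl_commutator_apply {A : Type*} [Ring A] {n : A} {J : Set A} {k : ℕ}
    (hk : ∀ l : List A, (∀ b ∈ l, b ∈ J) → l.length < k → n * l.prod * n = 0)
    (l : List A) (hl : ∀ b ∈ l, b ∈ J) (u : List A) (hu : ∀ b ∈ u, b ∈ J)
    (hlen : l.length + u.length ≤ k) :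
    l.foldl (fun y b => b * y - y * b) n * u.prod * n =
      (-1) ^ l.length * (n * l.prod * u.prod * n) := by
  induction l using List.reverseRecOn generalizing u with
  | nil => simp
  | append_singleton l b ih =>
    have hb : b ∈ J := hl b (by simp)
    have hl' : ∀ c ∈ l, c ∈ J := fun c hc => hl c (by simp [hc])
    simp only [List.length_append, List.length_singleton] at hlen
    have h1 := ih hl' u hu (by omega)
    have h2 := ih hl' (b :: u) (by simpa [hb] using hu) (by simp; omega)
    have h3 := hk (l ++ u) (by
      intro c hc
      rcases List.mem_append.1 hc with h | h
      exacts [hl' c h, hu c h]) (by simp; omega)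
    rw [List.prod_append, ← mul_assoc] at h3
    rw [h3, mul_zero] at h1
    rw [List.foldl_append]
    simp only [List.foldl_cons, List.foldl_nil, List.prod_append, List.length_append,
      List.length_singleton, List.prod_cons, List.prod_nil, mul_one] at h2 ⊢
    rw [sub_mul, sub_mul, mul_assoc b, mul_assoc b, h1, mul_zero, zero_sub]
    rw [← mul_assoc] at h2
    rw [h2, pow_succ]
    noncomm_ring

lemma finrank_range_mul_lt {t n : Y →L[ℂ] Y}
    [FiniteDimensional ℂ (LinearMap.range (n : Y →ₗ[ℂ] Y))] (ht : IsNilpotent t) (hn : n ≠ 0)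
    (htn : ∀ y, ∃ z, t (n y) = n z) :
    Module.finrank ℂ (LinearMap.range ((t * n : Y →L[ℂ] Y) : Y →ₗ[ℂ] Y)) <
      Module.finrank ℂ (LinearMap.range (n : Y →ₗ[ℂ] Y)) := by
  refine Submodule.finrank_lt_finrank_of_lt (lt_of_le_of_ne ?_ fun h => ?_)
  · rintro _ ⟨y, rfl⟩
    obtain ⟨z, hz⟩ := htn y
    exact ⟨z, hz.symm⟩
  · have hk : ∀ k : ℕ, ∀ y, ∃ z, n y = (t ^ k) (n z) := by
      intro k
      induction k with
      | zero => exact fun y => ⟨y, by simp⟩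
      | succ k ih =>
        intro y
        obtain ⟨z, hz⟩ := ih y
        have : n z ∈ LinearMap.range ((t * n : Y →L[ℂ] Y) : Y →ₗ[ℂ] Y) := h ▸ ⟨z, rfl⟩
        obtain ⟨z', hz'⟩ := this
        refine ⟨z', ?_⟩
        rw [hz, pow_succ, mul_apply_eq_comp, ← hz']
        rfl
    obtain ⟨k, hk0⟩ := ht
    refine hn (ContinuousLinearMap.ext fun y => ?_)
    obtain ⟨z, hz⟩ := hk k y
    rw [hz, hk0]; simp

theorem isReducible_of_finiteRank_ideal (J R : Submodule ℂ (Y →L[ℂ] Y)) (hRJ : R ≤ J)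
    (hideal : ∀ b ∈ J, ∀ x ∈ R, b * x + x * b ∈ R)
    (hfin : ∀ a ∈ R, FiniteDimensional ℂ (LinearMap.range (a : Y →ₗ[ℂ] Y)))
    (hnil : ∀ a ∈ R, IsNilpotent a) (hR : R ≠ ⊥) :
    IsReducible (J : Set (Y →L[ℂ] Y)) := by
  have hJR : ∀ a ∈ R, ∀ b ∈ R, a * b + b * a ∈ R := fun a ha b hb => hideal a (hRJ ha) b hb
  let N := NonUnitalAlgebra.adjoin ℂ {z : Y →L[ℂ] Y | ∃ x ∈ R, ∃ y ∈ R, z = x * y}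
  have hNR : ∀ n ∈ N, n ∈ NonUnitalAlgebra.adjoin ℂ (R : Set (Y →L[ℂ] Y)) := by
    refine fun n hn => (NonUnitalAlgebra.adjoin_le ?_ : N ≤ _) hn
    rintro _ ⟨x, hx, y, hy, rfl⟩
    exact mul_mem (NonUnitalAlgebra.subset_adjoin ℂ hx) (NonUnitalAlgebra.subset_adjoin ℂ hy)
  have hNfin : ∀ n ∈ N, FiniteDimensional ℂ (LinearMap.range (n : Y →ₗ[ℂ] Y)) := fun n hn =>
    (isNilpotent_of_mem_adjoin hJR hfin hnil (hNR n hn)).1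
  have hNnil : ∀ n ∈ N, IsNilpotent n := fun n hn =>
    (isNilpotent_of_mem_adjoin hJR hfin hnil (hNR n hn)).2
  have hcomm : ∀ b ∈ J, ∀ n ∈ N, b * n - n * b ∈ N := by
    intro b hb n hn
    induction hn using NonUnitalAlgebra.adjoin_induction with
    | mem z hz =>
      obtain ⟨x, hx, y, hy, rfl⟩ := hz
      have : b * (x * y) - x * y * b = (b * x + x * b) * y - x * (b * y + y * b) := by
        noncomm_ring
      rw [this]
      exact sub_mem (NonUnitalAlgebra.subset_adjoin ℂ ⟨_, hideal b hb x hx, y, hy, rfl⟩)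
        (NonUnitalAlgebra.subset_adjoin ℂ ⟨x, hx, _, hideal b hb y hy, rfl⟩)
    | add x y _ _ hx hy =>
      rw [mul_add, add_mul, add_sub_add_comm]; exact add_mem hx hy
    | zero => simp
    | smul c x _ hx =>
      rw [mul_smul_comm, smul_mul_assoc, ← smul_sub]; exact SMulMemClass.smul_mem _ hx
    | mul x y hx' hy' hx hy =>
      have : b * (x * y) - x * y * b = (b * x - x * b) * y + x * (b * y - y * b) := by
        noncomm_ring
      rw [this]
      exact add_mem (mul_mem hx hy') (mul_mem hx' hy)
  by_cases hN : ∃ n ∈ N, n ≠ 0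
  · obtain ⟨n, ⟨hnN, hn0⟩, hmin⟩ : ∃ n, (n ∈ N ∧ n ≠ 0) ∧ ∀ n', (n' ∈ N ∧ n' ≠ 0) →
        Module.finrank ℂ (LinearMap.range (n : Y →ₗ[ℂ] Y)) ≤
        Module.finrank ℂ (LinearMap.range (n' : Y →ₗ[ℂ] Y)) :=
      exists_minimalFor_of_wellFoundedLT (fun n => n ∈ N ∧ n ≠ 0)
        (fun n : Y →L[ℂ] Y => Module.finrank ℂ (LinearMap.range (n : Y →ₗ[ℂ] Y))) hN |>.imp
        fun n hn => ⟨hn.1, fun n' hn' => (le_total _ _).elim id fun h => hn.2 hn' h⟩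
    by_cases hex : ∃ k, ∃ l : List (Y →L[ℂ] Y), (∀ b ∈ l, b ∈ J) ∧ l.length = k ∧
        n * l.prod * n ≠ 0
    · exfalso
      classical
      obtain ⟨l, hl, hlk, hne⟩ := Nat.find_spec hex
      have hk : ∀ l : List (Y →L[ℂ] Y), (∀ b ∈ l, b ∈ (J : Set (Y →L[ℂ] Y))) →
          l.length < Nat.find hex → n * l.prod * n = 0 := by
        intro l hl hlt
        by_contra h
        exact Nat.find_min hex hlt ⟨l, hl, rfl, h⟩
      have h1 := foldl_commutator_apply hk l hl [] (by simp) (by simp [hlk])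
      simp only [List.prod_nil, mul_one] at h1
      set t := l.foldl (fun y b => b * y - y * b) n with ht
      have htN : t ∈ N := by
        clear_value t
        subst ht
        clear h1 hlk hne
        induction l using List.reverseRecOn with
        | nil => simpa using hnN
        | append_singleton l b ih =>
          rw [List.foldl_append]
          exact hcomm b (hl b (by simp)) _ (ih fun c hc => hl c (by simp [hc]))
      have htn : t * n ≠ 0 := by
        rw [h1]
        rcases neg_one_pow_eq_or (Y →L[ℂ] Y) l.length with h | h <;> simpa [h] using hne
      have := hNfin n hnN
      have hlt := finrank_range_mul_lt (hNnil t htN) hn0 (fun y => by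
        refine ⟨((-1) ^ l.length * (l.prod * n)) y, ?_⟩
        have h2 : t * n = n * ((-1) ^ l.length * (l.prod * n)) := by
          rw [h1]
          rcases neg_one_pow_eq_or (Y →L[ℂ] Y) l.length with h | h <;> rw [h] <;> noncomm_ring
        exact congrArg (fun T : Y →L[ℂ] Y => T y) h2)
      exact absurd (hmin (t * n) ⟨mul_mem htN hnN, htn⟩) (not_le.2 hlt)
    · push Not at hex
      obtain ⟨y, hy⟩ : ∃ y, n y ≠ 0 := by
        by_contra! h
        exact hn0 (ContinuousLinearMap.ext h)
      refine isReducible_of_span (T := n)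
        (S := {s | ∃ l : List (Y →L[ℂ] Y), (∀ b ∈ l, b ∈ J) ∧ ∃ y, s = l.prod (n y)})
        ?_ ⟨n y, ⟨[], by simp, y, by simp⟩, hy⟩ hn0 ?_
      · rintro a ha _ ⟨l, hl, y, rfl⟩
        refine le_topologicalClosure _ (subset_span ⟨a :: l, ?_, y, by simp⟩)
        simpa using ⟨ha, hl⟩
      · rintro _ ⟨l, hl, y, rfl⟩
        exact congrArg (fun T : Y →L[ℂ] Y => T y) (hex _ l hl rfl)
  · push Not at hN
    obtain ⟨r, hr, hr0⟩ := Submodule.exists_mem_ne_zero_of_ne_bot hR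
    have hz : ∀ x ∈ R, ∀ y ∈ R, x * y = 0 := fun x hx y hy =>
      hN _ (NonUnitalAlgebra.subset_adjoin ℂ ⟨x, hx, y, hy, rfl⟩)
    obtain ⟨y, hy⟩ : ∃ y, r y ≠ 0 := by
      by_contra! h
      exact hr0 (ContinuousLinearMap.ext h)
    refine isReducible_of_span (T := r) (S := {s | ∃ x ∈ R, ∃ y, s = x y})
      ?_ ⟨r y, ⟨r, hr, y, rfl⟩, hy⟩ hr0 ?_
    · rintro b hb _ ⟨x, hx, y, rfl⟩
      refine le_topologicalClosure _ ?_
      have : b (x y) = (b * x + x * b) y - x (b y) := by simp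
      rw [this]
      exact sub_mem (subset_span ⟨_, hideal b hb x hx, y, rfl⟩) (subset_span ⟨x, hx, b y, rfl⟩)
    · rintro _ ⟨x, hx, y, rfl⟩
      exact congrArg (fun T : Y →L[ℂ] Y => T y) (hz r hr x hx)

end FiniteRankIdeal

section CompactSpectrum

open Filter Topology

variable {X : Type*} [NormedAddCommGroup X] [NormedSpace ℂ X]

lemma IsCompactOperator.mul_left {K : X →L[ℂ] X} (hK : IsCompactOperator K) (A : X →L[ℂ] X) :
    IsCompactOperator (A * K) := hK.clm_comp A

lemma IsCompactOperator.mul_right {K : X →L[ℂ] X} (hK : IsCompactOperator K) (A : X →L[ℂ] X) :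
    IsCompactOperator (K * A) := hK.comp_clm A

lemma IsCompactOperator.false_of_strictMono {K : X →L[ℂ] X} (hK : IsCompactOperator K)
    {F : ℕ → Submodule ℂ X} (hclosed : ∀ n, IsClosed (F n : Set X)) (hF : StrictMono F)
    {ε : ℝ} (hε : 0 < ε) {c : ℕ → ℂ} (hc : ∀ n, ε ≤ ‖c n‖)
    (hKF : ∀ n, ∀ x ∈ F (n + 1), K x - c n • x ∈ F n) : False := by
  have hx : ∀ n, ∃ x ∈ F (n + 1), ‖x‖ ≤ 3 ∧ ∀ y ∈ F n, 1 ≤ ‖x - y‖ := by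
    intro n
    obtain ⟨z, hz, hzn⟩ := SetLike.not_le_iff_exists.1 (hF (Nat.lt_succ_self n)).not_ge
    obtain ⟨x₀, h1, h2⟩ := riesz_lemma_of_norm_lt (𝕜 := ℂ) (E := F (n + 1)) (c := 2) (R := 3)
      (by norm_num) (by norm_num) (F := (F n).comap (F (n + 1)).subtype)
      ((hclosed n).preimage continuous_subtype_val) ⟨⟨z, hz⟩, hzn⟩
    exact ⟨x₀, x₀.2, h1, fun y hy => h2 ⟨y, hF.monotone n.le_succ hy⟩ hy⟩
  choose x hxF hx3 hx1 using hx
  have hsep : ∀ m n, m < n → ε ≤ ‖K (x n) - K (x m)‖ := by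
    intro m n hmn
    have hcn : c n ≠ 0 := fun h => by have := hc n; simp [h] at this; linarith
    have h1 : K (x m) ∈ F n := by
      have h := add_mem (hF.monotone m.le_succ (hKF m _ (hxF m)))
        ((F (m + 1)).smul_mem (c m) (hxF m))
      rw [sub_add_cancel] at h
      exact hF.monotone hmn h
    have h2 := hx1 n ((c n)⁻¹ • (K (x m) - (K (x n) - c n • x n)))
      ((F n).smul_mem _ (sub_mem h1 (hKF n _ (hxF n))))
    have h3 : K (x n) - K (x m) =
        c n • (x n - (c n)⁻¹ • (K (x m) - (K (x n) - c n • x n))) := by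
      rw [smul_sub, smul_smul, mul_inv_cancel₀ hcn, one_smul]; abel
    rw [h3, norm_smul]
    nlinarith [hc n, norm_nonneg (c n)]
  obtain ⟨C, hC, hCK⟩ := hK.image_closedBall_subset_compact (3 : ℝ)
  obtain ⟨a, -, φ, hφ, hlim⟩ := hC.tendsto_subseq (x := fun n => K (x n))
    (fun n => hCK ⟨x n, by simpa using hx3 n, rfl⟩)
  obtain ⟨N, hN⟩ := Metric.cauchySeq_iff.1 hlim.cauchySeq ε hε
  have := hN (N + 1) (by omega) N le_rfl
  rw [dist_eq_norm] at this
  exact absurd (hsep _ _ (hφ (Nat.lt_succ_self N))) (not_le.2 this)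

lemma IsCompactOperator.exists_pow_ker_stable {K : X →L[ℂ] X} (hK : IsCompactOperator K) {l : ℂ}
    (hl : l ≠ 0) : ∃ m, ∀ k x, ((K - algebraMap ℂ _ l) ^ (m + k) : X →L[ℂ] X) x = 0 →
      ((K - algebraMap ℂ _ l) ^ m : X →L[ℂ] X) x = 0 := by
  set T := K - algebraMap ℂ (X →L[ℂ] X) l with hT
  obtain ⟨m, hm⟩ : ∃ m, ∀ x, (T ^ (m + 1)) x = 0 → (T ^ m) x = 0 := by
    by_contra! h
    refine hK.false_of_strictMono (F := fun n => LinearMap.ker ((T ^ n : X →L[ℂ] X) : X →ₗ[ℂ] X))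
      (fun n => (T ^ n).isClosed_ker) (strictMono_nat_of_lt_succ fun n => ?_)
      (norm_pos_iff.2 hl) (c := fun _ => l) (fun _ => le_rfl) (fun n x hx => ?_)
    · obtain ⟨x, hx, hx'⟩ := h n
      refine lt_of_le_of_ne (fun y hy => ?_) fun heq => hx' ?_
      · simp only [LinearMap.mem_ker, ContinuousLinearMap.coe_coe] at hy ⊢
        rw [pow_succ', mul_apply_eq_comp, hy, map_zero]
      · have : x ∈ LinearMap.ker ((T ^ (n + 1) : X →L[ℂ] X) : X →ₗ[ℂ] X) := hx
        rw [← heq] at this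
        exact this
    · have h1 : K x - l • x = T x := by simp [hT, Algebra.algebraMap_eq_smul_one]
      simp only [LinearMap.mem_ker, ContinuousLinearMap.coe_coe] at hx ⊢
      rw [h1, ← mul_apply_eq_comp, ← pow_succ, hx]
  refine ⟨m, fun k => ?_⟩
  induction k with
  | zero => simp
  | succ k ih =>
    intro x hx
    refine ih x ?_
    have h1 : (T ^ (m + 1)) ((T ^ k) x) = 0 := by
      rw [← mul_apply_eq_comp, ← pow_add, ← hx]; congr 2; omega
    rw [pow_add]
    exact hm _ h1

lemma exists_isCompactOperator_pow {K : X →L[ℂ] X} (hK : IsCompactOperator K) (l : ℂ) (m : ℕ) :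
    ∃ C : X →L[ℂ] X, IsCompactOperator C ∧ (K - algebraMap ℂ _ l) ^ m =
      algebraMap ℂ _ ((-l) ^ m) + C := by
  induction m with
  | zero => exact ⟨0, isCompactOperator_zero, by simp⟩
  | succ m ih =>
    obtain ⟨C, hC, h⟩ := ih
    refine ⟨algebraMap ℂ _ ((-l) ^ m) * K + C * (K - algebraMap ℂ _ l),
      (hK.mul_left _).add (hC.mul_right _), ?_⟩
    rw [pow_succ, h, pow_succ, map_mul, map_neg]
    noncomm_ring

variable [CompleteSpace X]

lemma IsCompactOperator.isUnit_of_injective {C : X →L[ℂ] X} (hC : IsCompactOperator C) {l : ℂ}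
    (hl : l ≠ 0) (h : ∀ x, l • x + C x = 0 → x = 0) : IsUnit (algebraMap ℂ (X →L[ℂ] X) l + C) := by
  have hC' : IsCompactOperator (-C : X →L[ℂ] X) := hC.neg
  rcases hC'.hasEigenvalue_or_mem_resolventSet hl with h1 | h1
  · obtain ⟨v, hv⟩ := h1.exists_hasEigenvector
    have h2 : -(C v) = l • v := by simpa using hv.apply_eq_smul
    exact absurd (h v (by rw [← h2]; simp)) hv.2
  · simpa [resolventSet] using h1

/-- The Riesz projection of a compact operator at a nonzero point. -/
theorem IsCompactOperator.exists_riesz_projection {K : X →L[ℂ] X} (hK : IsCompactOperator K)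
    {l : ℂ} (hl : l ≠ 0) : ∃ E S : X →L[ℂ] X, ∃ m : ℕ, E * E = E ∧
      FiniteDimensional ℂ (LinearMap.range (E : X →ₗ[ℂ] X)) ∧
      (∀ B, B * K = K * B → B * E = E * B) ∧ (K - algebraMap ℂ _ l) ^ m * E = 0 ∧
      S * (K - algebraMap ℂ _ l) = 1 - E ∧ (K - algebraMap ℂ _ l) * S = 1 - E ∧
      S * E = 0 ∧ E * S = 0 := by
  obtain ⟨m, hm⟩ := hK.exists_pow_ker_stable hl
  set T := K - algebraMap ℂ (X →L[ℂ] X) l with hT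
  obtain ⟨C, hC, hTC⟩ := exists_isCompactOperator_pow hK l m
  rw [← hT] at hTC
  have hlm : (-l) ^ m ≠ 0 := pow_ne_zero _ (neg_ne_zero.2 hl)
  let N := LinearMap.ker ((T ^ m : X →L[ℂ] X) : X →ₗ[ℂ] X)
  have hNC : ∀ x ∈ N, C x = -((-l) ^ m • x) := by
    intro x hx
    have h1 : (T ^ m) x = 0 := hx
    rw [hTC] at h1
    simp only [Algebra.algebraMap_eq_smul_one, add_apply, smul_apply, one_apply_eq_self] at h1
    rw [eq_neg_iff_add_eq_zero, add_comm]; exact h1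
  have hNf : FiniteDimensional ℂ N := by
    refine .of_isCompactOperator_id ?_
    have h1 : IsCompactOperator ((C : X →ₗ[ℂ] X).restrict (p := N) (q := N)
        (fun x hx => by simpa [hNC x hx] using N.smul_mem _ hx)) :=
      IsCompactOperator.restrict (f := (C : X →ₗ[ℂ] X)) hC _ (T ^ m).isClosed_ker
    have h2 := h1.smul (-((-l) ^ m)⁻¹)
    refine (congrArg IsCompactOperator (funext fun x => Subtype.ext ?_)).mp h2
    have := hNC x x.2
    simp [this, smul_smul, hlm]
  obtain ⟨P', hP'⟩ := Submodule.ClosedComplemented.of_finiteDimensional N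
  let P : X →L[ℂ] X := N.subtypeL ∘L P'
  have hPN : ∀ x, P x ∈ N := fun x => (P' x).2
  have hPid : ∀ x ∈ N, P x = x := fun x hx => by simp [P, hP' ⟨x, hx⟩]
  have hPc : IsCompactOperator P := by
    have : IsCompactOperator P' := by
      have := FiniteDimensional.proper ℂ N
      exact isCompactOperator_id.comp_clm P'
    exact this.clm_comp N.subtypeL
  obtain ⟨V, hV⟩ : IsUnit (T ^ m + P) := by
    rw [hTC, add_assoc]
    refine IsCompactOperator.isUnit_of_injective (C := C + P) (hC.add hPc) hlm fun x hx => ?_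
    have h1 : (T ^ m) x = -(P x) := by
      rw [hTC, eq_neg_iff_add_eq_zero, ← hx]
      simp [Algebra.algebraMap_eq_smul_one, add_assoc]
    have h2 : (T ^ m) x = 0 := hm m x (by
      rw [pow_add, mul_apply_eq_comp, h1]
      exact N.neg_mem (hPN x))
    rw [← hPid x h2, ← neg_eq_zero, ← h1, h2]
  have hV1 : (T ^ m + P) * ((V⁻¹ : (X →L[ℂ] X)ˣ) : X →L[ℂ] X) = 1 := by rw [← hV]; simp
  have hV2 : ((V⁻¹ : (X →L[ℂ] X)ˣ) : X →L[ℂ] X) * (T ^ m + P) = 1 := by rw [← hV]; simp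
  set W : X →L[ℂ] X := ((V⁻¹ : (X →L[ℂ] X)ˣ) : X →L[ℂ] X) with hW
  let E := P * W
  have hEN : ∀ x, E x ∈ N := fun x => hPN _
  have hEid : ∀ x ∈ N, E x = x := by
    intro x hx
    have h1 : (T ^ m + P) x = x := by
      have : (T ^ m) x = 0 := hx
      simp [this, hPid x hx]
    have h2 : W x = x := by
      conv_lhs => rw [← h1, ← mul_apply_eq_comp, hV2]
      simp
    simp [E, h2, hPid x hx]
  have hE1 : 1 - E = T ^ m * W := by
    rw [← hV1]; simp only [E]; noncomm_ring
  have hET : E * T ^ m = 0 := by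
    ext y
    have h1 : E ((T ^ m) y) = (T ^ m) (y - W ((T ^ m) y)) := by
      have := congrArg (fun A : X →L[ℂ] X => A ((T ^ m) y)) hE1
      simp only [sub_apply, one_apply_eq_self, mul_apply_eq_comp] at this
      rw [map_sub, ← this]; abel
    have h2 : (T ^ m) (y - W ((T ^ m) y)) = 0 := hm m _ (by
      rw [pow_add, mul_apply_eq_comp, ← h1]; exact hEN _)
    rw [mul_apply_eq_comp, h1, h2]; rfl
  have hEE : E * E = E := by
    ext x; exact hEid _ (hEN x)
  have hcomm : ∀ B, B * K = K * B → B * E = E * B := by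
    intro B hB
    have hBT : B * T = T * B := by
      rw [hT, mul_sub, sub_mul, hB, Algebra.commutes]
    have hBTm : B * T ^ m = T ^ m * B := (Commute.pow_right hBT m).eq
    have h1 : E * B * E = B * E := by
      ext x
      refine hEid _ ?_
      change (T ^ m) (B (E x)) = 0
      rw [← mul_apply_eq_comp, ← hBTm, mul_apply_eq_comp]
      rw [show (T ^ m) (E x) = 0 from hEN x, map_zero]
    have h2 : E * B * (1 - E) = 0 := by
      rw [hE1, ← mul_assoc, mul_assoc E, hBTm, ← mul_assoc, hET]; simp
    rw [← h1]
    rw [mul_sub, mul_one, sub_eq_zero] at h2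
    exact h2.symm
  have hTE : T * E = E * T := by
    rw [hT, sub_mul, mul_sub, hcomm K rfl, Algebra.commutes]
  have hEc : IsCompactOperator E := hPc.mul_right W
  obtain ⟨U, hU⟩ : IsUnit (T + E) := by
    have h0 : T + E = algebraMap ℂ _ (-l) + (K + E) := by rw [hT, map_neg]; abel
    rw [h0]
    refine IsCompactOperator.isUnit_of_injective (C := K + E) (hK.add hEc)
      (neg_ne_zero.2 hl) fun x hx => ?_
    have h1 : T x = -(E x) := by
      rw [eq_neg_iff_add_eq_zero, ← hx]
      simp [hT, Algebra.algebraMap_eq_smul_one]; abel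
    have h2 : (T ^ m) x = 0 := hm 1 x (by
      rw [pow_add, pow_one, mul_apply_eq_comp, h1]
      exact N.neg_mem (hEN x))
    have h3 : E x = x := hEid x h2
    have h4 : ∀ k : ℕ, (T ^ k) x = (-1 : ℂ) ^ k • x := by
      intro k
      induction k with
      | zero => simp
      | succ k ih => rw [pow_succ, mul_apply_eq_comp, h1, h3, map_neg, ih, pow_succ]; simp
    have h5 := h4 m
    rw [h2] at h5
    exact (smul_eq_zero.1 h5.symm).resolve_left (pow_ne_zero _ (by norm_num))
  have hU1 : (T + E) * ((U⁻¹ : (X →L[ℂ] X)ˣ) : X →L[ℂ] X) = 1 := by rw [← hU]; simp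
  have hU2 : ((U⁻¹ : (X →L[ℂ] X)ˣ) : X →L[ℂ] X) * (T + E) = 1 := by rw [← hU]; simp
  set Z : X →L[ℂ] X := ((U⁻¹ : (X →L[ℂ] X)ˣ) : X →L[ℂ] X) with hZ
  have hZE : Z * E = E * Z := by
    have h1 : (T + E) * E = E * (T + E) := by rw [add_mul, mul_add, hTE]
    calc Z * E = Z * (E * ((T + E) * Z)) := by rw [hU1, mul_one]
      _ = Z * ((E * (T + E)) * Z) := by rw [← mul_assoc E]
      _ = E * Z := by rw [← h1, mul_assoc, ← mul_assoc Z, hU2, one_mul]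
  have h0 : E * (1 - E) = 0 := by rw [mul_sub, hEE, mul_one, sub_self]
  have h0' : (1 - E) * E = 0 := by rw [sub_mul, hEE, one_mul, sub_self]
  have h1 : (1 - E) * T = T * (1 - E) := 
    ((Commute.one_left T).sub_left (show Commute E T from hTE.symm)).eq
  have h2 : (1 - E) * T = (T + E) * (1 - E) := by rw [add_mul, h0, h1, add_zero]
  have h3 : (1 - E) * Z = Z * (1 - E) :=
    ((Commute.one_left Z).sub_left (show Commute E Z from hZE.symm)).eq
  refine ⟨E, Z * (1 - E), m, hEE, ?_, hcomm, ?_, ?_, ?_, ?_, ?_⟩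
  · refine Submodule.finiteDimensional_of_le (S₂ := N) ?_
    rintro _ ⟨x, rfl⟩
    exact hEN x
  · ext x; exact hEN x
  · rw [mul_assoc, h2, ← mul_assoc, hU2, one_mul]
  · rw [← h3, ← mul_assoc, ← h1, h2, mul_assoc, h3, ← mul_assoc, hU1, one_mul]
  · rw [mul_assoc, h0', mul_zero]
  · rw [← mul_assoc, ← hZE, mul_assoc, h0, mul_zero]

theorem IsCompactOperator.finite_spectrum_norm_ge {K : X →L[ℂ] X} (hK : IsCompactOperator K)
    {ε : ℝ} (hε : 0 < ε) : {l ∈ spectrum ℂ K | ε ≤ ‖l‖}.Finite := by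
  by_contra hinf
  let c : ℕ → ℂ := fun n => (Set.Infinite.natEmbedding _ hinf n : ℂ)
  have hcinj : Function.Injective c :=
    Subtype.val_injective.comp (Set.Infinite.natEmbedding _ hinf).injective
  have hcm : ∀ n, c n ∈ spectrum ℂ K ∧ ε ≤ ‖c n‖ := fun n =>
    (Set.Infinite.natEmbedding _ hinf n).2
  have hv : ∀ n, ∃ v, Module.End.HasEigenvector (K : Module.End ℂ X) (c n) v := fun n =>
    ((hK.hasEigenvalue_iff_mem_spectrum (norm_pos_iff.1 (hε.trans_le (hcm n).2))).2
      (hcm n).1).exists_hasEigenvector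
  choose v hv using hv
  have hli : LinearIndependent ℂ v := Module.End.eigenvectors_linearIndependent' _ c hcinj v hv
  have hfd : ∀ n, FiniteDimensional ℂ (Submodule.span ℂ (v '' Set.Iio n)) := fun n =>
    FiniteDimensional.span_of_finite ℂ ((Set.finite_Iio n).image v)
  refine hK.false_of_strictMono (F := fun n => Submodule.span ℂ (v '' Set.Iio n))
    (fun n => Submodule.closed_of_finiteDimensional _)
    (strictMono_nat_of_lt_succ fun n => ?_) hε (c := c) (fun n => (hcm n).2) (fun n => ?_)
  · refine lt_of_le_of_ne (Submodule.span_mono (Set.image_mono fun i hi => ?_)) fun h => ?_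
    · exact lt_trans (Set.mem_Iio.1 hi) (Nat.lt_succ_self n)
    · have h1 : v n ∈ Submodule.span ℂ (v '' Set.Iio (n + 1)) :=
        Submodule.subset_span ⟨n, Nat.lt_succ_self n, rfl⟩
      rw [← h] at h1
      exact hli.notMem_span_image (s := Set.Iio n) (by simp) h1
  · have h1 : Submodule.span ℂ (v '' Set.Iio (n + 1)) ≤
        (Submodule.span ℂ (v '' Set.Iio n)).comap
          ((K - algebraMap ℂ _ (c n) : X →L[ℂ] X) : X →ₗ[ℂ] X) := by
      refine Submodule.span_le.2 ?_
      rintro _ ⟨i, hi, rfl⟩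
      have h2 : K (v i) = c i • v i := (hv i).apply_eq_smul
      simp only [Submodule.comap_coe, Set.mem_preimage, SetLike.mem_coe,
        ContinuousLinearMap.coe_coe, sub_apply, Algebra.algebraMap_eq_smul_one,
        smul_apply, one_apply_eq_self, h2]
      rcases (Nat.lt_succ_iff.1 hi).lt_or_eq with h | rfl
      · exact sub_mem (Submodule.smul_mem _ _ (Submodule.subset_span ⟨i, h, rfl⟩))
          (Submodule.smul_mem _ _ (Submodule.subset_span ⟨i, h, rfl⟩))
      · simp
    intro x hx
    simpa [Algebra.algebraMap_eq_smul_one] using h1 hx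

theorem IsCompactOperator.countable_spectrum {K : X →L[ℂ] X} (hK : IsCompactOperator K) :
    (spectrum ℂ K).Countable := by
  refine Set.Countable.mono (s₂ := {0} ∪ ⋃ n : ℕ, {l ∈ spectrum ℂ K | 1 / ((n : ℝ) + 1) ≤ ‖l‖})
    (fun l hl => ?_) ((Set.countable_singleton 0).union (Set.countable_iUnion fun n =>
      (hK.finite_spectrum_norm_ge (by positivity)).countable))
  by_cases h : l = 0
  · exact Or.inl h
  · obtain ⟨n, hn⟩ := exists_nat_one_div_lt (norm_pos_iff.2 h)
    exact Or.inr (Set.mem_iUnion.2 ⟨n, hl, hn.le⟩)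

end CompactSpectrum

section Newburgh

open Filter Topology

lemma isUnit_of_norm_inverse_mul_lt {A : Type*} [NormedRing A] [CompleteSpace A] {a b : A}
    (hb : IsUnit b)
    (h : ‖Ring.inverse b‖ * ‖a - b‖ < 1) : IsUnit a := by
  have h1 : a = b * (1 - Ring.inverse b * (b - a)) := by
    rw [mul_sub, ← mul_assoc, Ring.mul_inverse_cancel _ hb]; noncomm_ring
  rw [h1]
  refine hb.mul (isUnit_one_sub_of_norm_lt_one ((norm_mul_le _ _).trans_lt ?_))
  rwa [norm_sub_rev b a]

variable {A : Type*} [NormedRing A] [NormedAlgebra ℂ A] [CompleteSpace A]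

lemma Set.Countable.exists_sphere_disjoint {s : Set ℂ} (hs : s.Countable) (ν : ℂ) {ε : ℝ}
    (hε : 0 < ε) : ∃ r, 0 < r ∧ r < ε ∧ ∀ z ∈ Metric.sphere ν r, z ∉ s := by
  have h1 : ¬ (Set.Ioo 0 ε ⊆ (fun z => dist z ν) '' s) := fun h => by
    have h2 := (hs.image (fun z => dist z ν)).mono h
    rw [← Cardinal.le_aleph0_iff_set_countable, Cardinal.mk_Ioo_real hε] at h2
    exact absurd h2 (not_le.2 Cardinal.aleph0_lt_continuum)
  obtain ⟨r, hr, hrs⟩ := Set.not_subset.1 h1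
  exact ⟨r, hr.1, hr.2, fun z hz hzs => hrs ⟨z, hzs, hz⟩⟩

/-- A countable spectrum is lower semicontinuous. -/
theorem spectrum.eventually_exists_dist_lt {a : A} (ha : (spectrum ℂ a).Countable) {ν : ℂ}
    (hν : ν ∈ spectrum ℂ a) {ε : ℝ} (hε : 0 < ε) :
    ∀ᶠ b in 𝓝 a, ∃ ν' ∈ spectrum ℂ b, dist ν' ν < ε := by
  obtain ⟨r, hr0, hrε, hr⟩ := ha.exists_sphere_disjoint ν hε
  have hunit : ∀ z ∈ Metric.sphere ν r, IsUnit (algebraMap ℂ A z - a) := fun z hz =>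
    spectrum.notMem_iff.1 (hr z hz)
  have hcont : ∀ z ∈ Metric.sphere ν r, ContinuousAt
      (fun p : A × ℂ => Ring.inverse (algebraMap ℂ A p.2 - p.1)) (a, z) := by
    intro z hz
    obtain ⟨u, hu⟩ := hunit z hz
    have h1 := NormedRing.inverse_continuousAt u
    refine ContinuousAt.comp (f := fun p : A × ℂ => algebraMap ℂ A p.2 - p.1) (g := Ring.inverse)
      (by simpa [hu] using h1) ?_
    exact (((algebraMapCLM ℂ A).continuous.comp continuous_snd).sub continuous_fst).continuousAt
  obtain ⟨C, hC0, hC⟩ : ∃ C, 0 < C ∧ ∀ z ∈ Metric.sphere ν r,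
      ‖Ring.inverse (algebraMap ℂ A z - a)‖ < C := by
    have h1 : ContinuousOn (fun z => ‖Ring.inverse (algebraMap ℂ A z - a)‖)
        (Metric.sphere ν r) := fun z hz =>
      ((hcont z hz).comp (f := fun z : ℂ => (a, z)) (by fun_prop)).norm.continuousWithinAt
    obtain ⟨C, hC⟩ := ((isCompact_sphere ν r).image_of_continuousOn h1).bddAbove
    exact ⟨max C 0 + 1, by positivity, fun z hz =>
      ((hC ⟨z, hz, rfl⟩).trans (le_max_left _ _)).trans_lt (lt_add_one _)⟩
  have hev : ∀ᶠ b in 𝓝 a, ∀ z ∈ Metric.sphere ν r,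
      ‖Ring.inverse (algebraMap ℂ A z - b)‖ < C := by
    refine (isCompact_sphere ν r).eventually_forall_of_forall_eventually fun z hz => ?_
    exact (hcont z hz).norm.eventually (gt_mem_nhds (hC z hz))
  have hnear : ∀ᶠ b in 𝓝 a, C * ‖a - b‖ < 1 := by
    have : Tendsto (fun b => C * ‖a - b‖) (𝓝 a) (𝓝 (C * ‖a - a‖)) :=
      (Continuous.tendsto (by fun_prop) a)
    exact this.eventually (gt_mem_nhds (by simp))
  filter_upwards [hev, hnear] with b hb1 hb2
  by_contra! hcon
  have hU : ∀ z ∈ Metric.ball ν ε, IsUnit (algebraMap ℂ A z - b) := fun z hz =>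
    spectrum.notMem_iff.1 fun h => absurd (hcon z h) (not_le.2 hz)
  have hdiff : ∀ z ∈ Metric.ball ν ε,
      DifferentiableAt ℂ (fun z => Ring.inverse (algebraMap ℂ A z - b)) z := by
    intro z hz
    exact DifferentiableAt.comp (f := fun z => algebraMap ℂ A z - b) z
      (differentiableAt_inverse (𝕜 := ℂ) (hU z hz))
      ((algebraMapCLM ℂ A).differentiableAt.sub_const b)
  have hmax : ‖Ring.inverse (algebraMap ℂ A ν - b)‖ ≤ C := by
    refine Complex.norm_le_of_forall_mem_frontier_norm_le (U := Metric.ball ν r)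
      (f := fun z => Ring.inverse (algebraMap ℂ A z - b)) Metric.isBounded_ball
      ?_ (fun z hz => ?_) (subset_closure (Metric.mem_ball_self hr0))
    · refine DifferentiableOn.diffContOnCl fun z hz => (hdiff z ?_).differentiableWithinAt
      exact lt_of_le_of_lt (Metric.closure_ball_subset_closedBall hz) hrε
    · rw [frontier_ball ν hr0.ne'] at hz
      exact (hb1 z hz).le
  refine hν (isUnit_of_norm_inverse_mul_lt (hU ν (Metric.mem_ball_self hε)) ?_)
  refine lt_of_le_of_lt (mul_le_mul_of_nonneg_right hmax (norm_nonneg _)) ?_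
  rwa [sub_sub_sub_cancel_left, norm_sub_rev]

lemma spectrum.subset_zero_of_mem_closure {a : A} (ha : (spectrum ℂ a).Countable) {s : Set A}
    (hs : ∀ b ∈ s, spectrum ℂ b ⊆ {0}) (has : a ∈ closure s) : spectrum ℂ a ⊆ {0} := by
  intro ν hν
  by_contra hν0
  have h1 := spectrum.eventually_exists_dist_lt ha hν (norm_pos_iff.2 hν0)
  obtain ⟨b, hb, hbs⟩ := (mem_closure_iff_frequently.1 has).and_eventually h1 |>.exists
  obtain ⟨ν', h2, h3⟩ := hbs
  rw [hs b hb h2, dist_zero_left] at h3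
  exact lt_irrefl _ h3

/-- Inverse-closedness of closed subalgebras at elements with countable spectrum. -/
lemma Subalgebra.inverse_mem_of_countable_spectrum (S : Subalgebra ℂ A) (hS : IsClosed (S : Set A))
    {x : A} (hx : x ∈ S) (hc : (spectrum ℂ x).Countable) {y : A} (h1 : y * x = 1)
    (h2 : x * y = 1) : y ∈ S := by
  have h3 := Subalgebra.spectrum_eq_of_isPreconnected_compl S (hS := hS) ⟨x, hx⟩
    (hc.isConnected_compl_of_one_lt_rank (by simp)).isPreconnected
  have h4 : IsUnit x := ⟨⟨x, y, h2, h1⟩, rfl⟩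
  have h5 : IsUnit (⟨x, hx⟩ : S) := by
    rw [← spectrum.zero_notMem_iff ℂ, h3, spectrum.zero_notMem_iff]; exact h4
  obtain ⟨u, hu⟩ := h5
  have h6 : x * ((u⁻¹ : Sˣ) : S) = 1 := by
    have := congrArg (Subtype.val) u.mul_inv
    rw [hu] at this; exact this
  have : y = ((u⁻¹ : Sˣ) : S) := by
    calc y = y * (x * ((u⁻¹ : Sˣ) : S)) := by rw [h6, mul_one]
      _ = _ := by rw [← mul_assoc, h1, one_mul]
  rw [this]; exact Subtype.property _

end Newburgh

section RieszProjection

open Filter Topology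

variable {X : Type*} [NormedAddCommGroup X] [NormedSpace ℂ X] [CompleteSpace X]

lemma isCompactOperator_of_finiteDimensional_range {X : Type*} [NormedAddCommGroup X]
    [NormedSpace ℂ X] {F : X →L[ℂ] X} (hF : FiniteDimensional ℂ (LinearMap.range (F : X →ₗ[ℂ] X))) :
    IsCompactOperator F := by
  obtain ⟨N, hN⟩ : ∃ N, N = LinearMap.range (F : X →ₗ[ℂ] X) := ⟨_, rfl⟩
  rw [← hN] at hF
  have := FiniteDimensional.proper ℂ N
  let P : X →L[ℂ] N := F.codRestrict N (fun x => hN ▸ ⟨x, rfl⟩)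
  have h1 : IsCompactOperator P := (isCompactOperator_id (E := N)).comp_clm P
  exact h1.clm_comp N.subtypeL

lemma IsCompactOperator.countable_spectrum_algebraMap_add {C : X →L[ℂ] X}
    (hC : IsCompactOperator C) (l : ℂ) :
    (spectrum ℂ (algebraMap ℂ (X →L[ℂ] X) l + C)).Countable := by
  rw [← spectrum.singleton_add_eq]
  exact (Set.countable_singleton l).image2 hC.countable_spectrum _

/-- Riesz projections and reduced resolvents lie in the closed algebra generated by the operator. -/
theorem IsCompactOperator.riesz_projection_mem {K : X →L[ℂ] X} (hK : IsCompactOperator K)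
    {l : ℂ} {E S : X →L[ℂ] X} {m : ℕ} (hEE : E * E = E)
    (hEf : FiniteDimensional ℂ (LinearMap.range (E : X →ₗ[ℂ] X)))
    (hTE : (K - algebraMap ℂ _ l) ^ m * E = 0)
    (hcomm : ∀ B, B * K = K * B → B * E = E * B)
    (hST : S * (K - algebraMap ℂ _ l) = 1 - E) (hTS : (K - algebraMap ℂ _ l) * S = 1 - E)
    (hES : E * S = 0) :
    E ∈ (Algebra.adjoin ℂ {K}).topologicalClosure ∧
      S ∈ (Algebra.adjoin ℂ {K}).topologicalClosure := by
  set 𝒮 := (Algebra.adjoin ℂ {K}).topologicalClosure with h𝒮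
  have hcl : IsClosed (𝒮 : Set (X →L[ℂ] X)) := Subalgebra.isClosed_topologicalClosure _
  have hK𝒮 : K ∈ 𝒮 :=
    (Algebra.adjoin ℂ {K}).le_topologicalClosure (Algebra.self_mem_adjoin_singleton ℂ K)
  have hT𝒮 : K - algebraMap ℂ _ l ∈ 𝒮 := sub_mem hK𝒮 (𝒮.algebraMap_mem l)
  have hcT : Commute (K - algebraMap ℂ (X →L[ℂ] X) l) E :=
    hcomm _ (by rw [sub_mul, mul_sub, Algebra.commutes])
  obtain ⟨C, hC, hTC⟩ := exists_isCompactOperator_pow hK l (m + 1)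
  have hTpE : (K - algebraMap ℂ (X →L[ℂ] X) l) ^ (m + 1) * E = 0 := by
    rw [pow_succ', mul_assoc, hTE, mul_zero]
  have hT1 : K - algebraMap ℂ (X →L[ℂ] X) l = algebraMap ℂ _ (-l) + K := by rw [map_neg]; abel
  generalize hT : K - algebraMap ℂ (X →L[ℂ] X) l = T at *
  have hcS : Commute T S := hTS.trans hST.symm
  have hidem : IsIdempotentElem (1 - E) := (show IsIdempotentElem E from hEE).one_sub
  have hTpS : T ^ (m + 1) * S ^ (m + 1) = 1 - E := by
    rw [← hcS.mul_pow, hTS, hidem.pow_succ_eq]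
  have hESp : E * S ^ (m + 1) = 0 := by rw [pow_succ', ← mul_assoc, hES, zero_mul]
  have hcE : Commute E (T ^ (m + 1)) := (hcT.pow_left _).symm
  have hcTS : Commute (T ^ (m + 1)) (S ^ (m + 1)) := hcS.pow_pow _ _
  generalize hG : T ^ (m + 1) = G at *
  generalize hR : S ^ (m + 1) = R at *
  have hG𝒮 : G ∈ 𝒮 := hG ▸ pow_mem hT𝒮 _
  have hE𝒮 : E ∈ 𝒮 := by
    have hlim : Tendsto (fun ε : ℂ => E + ε • (R * Ring.inverse (1 + ε • R))) (𝓝[≠] 0) (𝓝 E) := by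
      have h1 : ContinuousAt (fun ε : ℂ => E + ε • (R * Ring.inverse (1 + ε • R))) 0 := by
        refine continuousAt_const.add (continuousAt_id.smul (continuousAt_const.mul ?_))
        refine ContinuousAt.comp (f := fun ε : ℂ => 1 + ε • R) (g := Ring.inverse) ?_
          (by fun_prop)
        simpa using NormedRing.inverse_continuousAt (1 : (X →L[ℂ] X)ˣ)
      have h2 := h1.tendsto
      simp only [zero_smul, add_zero] at h2
      exact h2.mono_left nhdsWithin_le_nhds
    have hunit : ∀ᶠ ε : ℂ in 𝓝[≠] 0, IsUnit (1 + ε • R) := by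
      have h1 : ContinuousAt (fun ε : ℂ => 1 + ε • R) 0 := by fun_prop
      exact (h1.eventually (Units.isOpen.mem_nhds (by simp))).filter_mono nhdsWithin_le_nhds
    refine hcl.mem_of_tendsto hlim ?_
    filter_upwards [hunit, self_mem_nhdsWithin] with ε hu hε
    obtain ⟨u, hu⟩ := hu
    rw [← hu, Ring.inverse_unit]
    have hGu : Commute G (u : X →L[ℂ] X) := by
      rw [hu]; exact (Commute.one_right G).add_right (hcTS.smul_right ε)
    have hEu : E * ((u⁻¹ : (X →L[ℂ] X)ˣ) : X →L[ℂ] X) = E := by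
      rw [Units.mul_inv_eq_iff_eq_mul, hu, mul_add, mul_smul_comm, hESp]; simp
    have key : (G + algebraMap ℂ _ ε) *
        (E + ε • (R * ((u⁻¹ : (X →L[ℂ] X)ˣ) : X →L[ℂ] X))) = ε • 1 := by
      have h1 : (1 + ε • R) * ((u⁻¹ : (X →L[ℂ] X)ˣ) : X →L[ℂ] X) = 1 := by rw [← hu]; simp
      have h2 : ((u⁻¹ : (X →L[ℂ] X)ˣ) : X →L[ℂ] X) =
          1 - ε • (R * ((u⁻¹ : (X →L[ℂ] X)ˣ) : X →L[ℂ] X)) := by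
        rw [eq_sub_iff_add_eq]; rw [add_mul, one_mul, smul_mul_assoc] at h1; exact h1
      have h3 : G * (R * ((u⁻¹ : (X →L[ℂ] X)ˣ) : X →L[ℂ] X)) =
          ((u⁻¹ : (X →L[ℂ] X)ˣ) : X →L[ℂ] X) - E := by
        rw [← mul_assoc, hTpS, sub_mul, one_mul, hEu]
      rw [add_mul, mul_add, mul_smul_comm, h3, hTpE, Algebra.algebraMap_eq_smul_one,
        smul_mul_assoc, one_mul, zero_add, ← smul_add]
      congr 1
      rw [← add_assoc, sub_add_cancel]
      exact eq_sub_iff_add_eq.1 h2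
    have hcG : Commute (G + algebraMap ℂ _ ε)
        (E + ε • (R * ((u⁻¹ : (X →L[ℂ] X)ˣ) : X →L[ℂ] X))) := by
      refine Commute.add_left ?_ (Algebra.commute_algebraMap_left _ _)
      exact hcE.symm.add_right (((hcTS.mul_right hGu.units_inv_right)).smul_right ε)
    have hy : ε⁻¹ • (E + ε • (R * ((u⁻¹ : (X →L[ℂ] X)ˣ) : X →L[ℂ] X))) ∈ 𝒮 := by
      refine Subalgebra.inverse_mem_of_countable_spectrum 𝒮 hcl
        (x := G + algebraMap ℂ _ ε) (add_mem hG𝒮 (𝒮.algebraMap_mem _)) ?_ ?_ ?_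
      · rw [hTC, add_right_comm, ← map_add]
        exact hC.countable_spectrum_algebraMap_add _
      · rw [smul_mul_assoc, ← hcG.eq, key, smul_smul, inv_mul_cancel₀ hε, one_smul]
      · rw [mul_smul_comm, key, smul_smul, inv_mul_cancel₀ hε, one_smul]
    have := 𝒮.smul_mem hy ε
    rwa [smul_smul, mul_inv_cancel₀ hε, one_smul] at this
  refine ⟨hE𝒮, ?_⟩
  have hEc := isCompactOperator_of_finiteDimensional_range hEf
  have hunit : IsUnit (T + E) := by
    have h1 : (T + E) * (S + E) = 1 + T * E := by
      rw [add_mul, mul_add, mul_add, hTS, hES, hEE]; abel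
    have hnil : IsNilpotent (T * E) := ⟨m + 1, by
      rw [hcT.mul_pow, (show IsIdempotentElem E from hEE).pow_succ_eq, hG, hTpE]⟩
    have hSE : Commute S E := hcomm S (by
        have h2 : S * T = T * S := hcS.symm
        rw [← hT, mul_sub, sub_mul, Algebra.commutes] at h2
        exact sub_left_inj.1 h2)
    have h2 : Commute (T + E) (S + E) :=
      (hcS.add_right hcT).add_left (hSE.symm.add_right (Commute.refl E))
    have h3 : IsUnit ((T + E) * (S + E)) := by rw [h1]; exact hnil.isUnit_one_add
    exact (h2.isUnit_mul_iff.1 h3).1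
  obtain ⟨u, hu⟩ := hunit
  have hS : S = ((u⁻¹ : (X →L[ℂ] X)ˣ) : X →L[ℂ] X) * (1 - E) := by
    rw [Units.eq_inv_mul_iff_mul_eq, hu, add_mul, hTS, hES, add_zero]
  rw [hS]
  refine mul_mem ?_ (sub_mem 𝒮.one_mem hE𝒮)
  refine Subalgebra.inverse_mem_of_countable_spectrum 𝒮 hcl (x := T + E) (add_mem hT𝒮 hE𝒮) ?_
    (by rw [← hu]; simp) (by rw [← hu]; simp)
  rw [hT1, add_assoc]
  exact (hK.add hEc).countable_spectrum_algebraMap_add _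

/-- The part of a compact operator carrying the spectrum outside a disc around `0` splits off. -/
theorem IsCompactOperator.exists_projection_spectrum_norm_lt {K : X →L[ℂ] X}
    (hK : IsCompactOperator K) {ε : ℝ} (hε : 0 < ε) : ∃ F : X →L[ℂ] X, F * F = F ∧
      FiniteDimensional ℂ (LinearMap.range (F : X →ₗ[ℂ] X)) ∧
      (∀ B, B * K = K * B → B * F = F * B) ∧ ∀ z ∈ spectrum ℂ (K * (1 - F)), ‖z‖ < ε := by
  obtain ⟨n, hn⟩ : ∃ n, {z ∈ spectrum ℂ K | ε ≤ ‖z‖}.ncard < n := exists_gt _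
  induction n generalizing K with
  | zero => exact absurd hn (Nat.not_lt_zero _)
  | succ n ih =>
    by_cases hemp : {z ∈ spectrum ℂ K | ε ≤ ‖z‖} = ∅
    · refine ⟨0, zero_mul 0, ?_, by simp, fun z hz => ?_⟩
      · rw [ContinuousLinearMap.toLinearMap_zero, LinearMap.range_zero]; infer_instance
      · rw [sub_zero, mul_one] at hz
        by_contra h
        exact Set.notMem_empty z (hemp ▸ ⟨hz, not_lt.1 h⟩)
    obtain ⟨l, hl, hlε⟩ := Set.nonempty_iff_ne_empty.2 hemp
    have hl0 : l ≠ 0 := norm_pos_iff.1 (hε.trans_le hlε)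
    obtain ⟨E, S, m, hEE, hEf, hcomm, -, hST, hTS, hSE, hES⟩ := hK.exists_riesz_projection hl0
    have hKE : K * E = E * K := hcomm K rfl
    have hsub : ∀ z ∈ spectrum ℂ (K * (1 - E)), z ≠ 0 → z ∈ spectrum ℂ K ∧ z ≠ l := by
      intro z hz hz0
      suffices h : ∀ V, V * (algebraMap ℂ _ z - K) = 1 - E → (algebraMap ℂ _ z - K) * V = 1 - E →
          V * E = 0 → E * V = 0 → z ∉ spectrum ℂ (K * (1 - E)) by
        by_contra hcon
        rw [not_and_or, not_not] at hcon
        rcases hcon with hz1 | rfl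
        · obtain ⟨u, hu⟩ := spectrum.notMem_iff.1 hz1
          have h1 : Commute (u : X →L[ℂ] X) E := by
            rw [hu]; exact (Algebra.commute_algebraMap_left z E).sub_left hKE
          have h2 := h1.units_inv_left
          refine h (((u⁻¹ : (X →L[ℂ] X)ˣ) : X →L[ℂ] X) * (1 - E)) ?_ ?_ ?_ ?_ hz
          · rw [mul_assoc, ← hu, ← ((Commute.one_right _).sub_right h1).eq, ← mul_assoc]; simp
          · rw [← hu, ← mul_assoc]; simp
          · rw [mul_assoc, sub_mul, hEE, one_mul, sub_self, mul_zero]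
          · rw [← mul_assoc, ← h2.eq, mul_assoc, mul_sub, hEE, mul_one, sub_self, mul_zero]
        · refine h (-S) ?_ ?_ ?_ ?_ hz
          · rw [← hST]; noncomm_ring
          · rw [← hTS]; noncomm_ring
          · rw [neg_mul, hSE, neg_zero]
          · rw [mul_neg, hES, neg_zero]
      intro V h1 h2 h3 h4
      rw [spectrum.notMem_iff]
      have h5 : algebraMap ℂ (X →L[ℂ] X) z - K * (1 - E) =
          (algebraMap ℂ (X →L[ℂ] X) z - K) + K * E := by noncomm_ring
      have h6 : (algebraMap ℂ (X →L[ℂ] X) z - K) * E = z • E - K * E := by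
        rw [sub_mul, Algebra.algebraMap_eq_smul_one, smul_mul_assoc, one_mul]
      have h7 : E * (algebraMap ℂ (X →L[ℂ] X) z - K) = z • E - E * K := by
        rw [mul_sub, Algebra.algebraMap_eq_smul_one, mul_smul_comm, mul_one]
      refine ⟨⟨algebraMap ℂ (X →L[ℂ] X) z - K * (1 - E), V + z⁻¹ • E, ?_, ?_⟩, rfl⟩
      · rw [h5, add_mul, mul_add, h2, mul_smul_comm, h6, mul_add, mul_assoc, h4, mul_zero,
          mul_smul_comm, mul_assoc, hEE, smul_sub, smul_smul, inv_mul_cancel₀ hz0, one_smul]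
        abel
      · rw [h5, mul_add, add_mul, h1, smul_mul_assoc, h7, add_mul, hKE, ← mul_assoc, h3, zero_mul,
          smul_mul_assoc, ← mul_assoc, hEE, smul_sub, smul_smul, inv_mul_cancel₀ hz0, one_smul]
        abel
    obtain ⟨E', hE', hEf', hcomm', hsp⟩ := ih (K := K * (1 - E)) (hK.mul_right _) (by
      refine lt_of_lt_of_le (Set.ncard_lt_ncard ?_ (hK.finite_spectrum_norm_ge hε))
        (Nat.lt_succ_iff.1 hn)
      refine ⟨fun z hz => ⟨(hsub z hz.1 (norm_pos_iff.1 (hε.trans_le hz.2))).1, hz.2⟩, fun h => ?_⟩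
      exact (hsub l (h ⟨hl, hlε⟩).1 hl0).2 rfl)
    have hKK : ∀ B, B * K = K * B → B * (K * (1 - E)) = K * (1 - E) * B := by
      intro B hB
      have h1 : Commute B E := hcomm B hB
      exact (show Commute B K from hB).mul_right ((Commute.one_right B).sub_right h1)
    have hcE : Commute E E' := hcomm' E (hKK E hKE.symm)
    refine ⟨E + E' - E * E', ?_, ?_, ?_, ?_⟩
    · have := (show IsIdempotentElem E from hEE).add_sub_mul_of_commute hcE hE'
      exact this
    · refine Submodule.finiteDimensional_of_le (S₂ := LinearMap.range (E : X →ₗ[ℂ] X) ⊔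
        LinearMap.range (E' : X →ₗ[ℂ] X)) ?_
      rintro _ ⟨x, rfl⟩
      refine Submodule.mem_sup.2 ⟨E (x - E' x), ⟨_, rfl⟩, E' x, ⟨_, rfl⟩, ?_⟩
      simp; abel
    · intro B hB
      have h1 : Commute B E := hcomm B hB
      have h2 : Commute B E' := hcomm' B (hKK B hB)
      exact ((h1.add_right h2).sub_right (h1.mul_right h2)).eq
    · have : K * (1 - (E + E' - E * E')) = K * (1 - E) * (1 - E') := by noncomm_ring
      rwa [this]

end RieszProjection

section BoundedProducts

open Filter Topology
open scoped Pointwise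

variable {A : Type*} [NormedRing A]

lemma List.prod_mem_set_pow {M : Type*} [Monoid M] {s : Set M} :
    ∀ l : List M, (∀ x ∈ l, x ∈ s) → l.prod ∈ s ^ l.length
  | [], _ => by simp
  | a :: l, h => by
    rw [List.prod_cons, List.length_cons, pow_succ']
    exact Set.mul_mem_mul (h a (by simp)) (List.prod_mem_set_pow l fun x hx => h x (by simp [hx]))

lemma IsCompact.exists_ultrafilter_tendsto {Y ι : Type*} [TopologicalSpace Y] {s : Set Y}
    (hs : IsCompact s) (U : Ultrafilter ι) {g : ι → Y} (hg : ∀ᶠ i in U, g i ∈ s) :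
    ∃ y ∈ s, Tendsto g U (𝓝 y) :=
  hs.ultrafilter_le_nhds (U.map g) (le_principal_iff.2 hg)

/-- If all products of elements of `M` stay in a compact set `𝒦` with `1 - p` invertible for
`p ∈ 𝒦`, then long products become arbitrarily small. -/
theorem exists_pow_norm_lt_of_isCompact {M 𝒦 : Set A} (h𝒦 : IsCompact 𝒦)
    (hM : ∀ n, 1 ≤ n → M ^ n ⊆ 𝒦) (hunit : ∀ p ∈ 𝒦, IsUnit (1 - p)) {δ : ℝ} (hδ : 0 < δ) :
    ∃ n, 1 ≤ n ∧ ∀ m ∈ M ^ n, ‖m‖ < δ := by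
  by_contra! hcon
  obtain ⟨K, hK0, hK⟩ := h𝒦.isBounded.exists_pos_norm_le
  have hL : ∀ n : ℕ, ∃ l : List A, l.length = n + 1 ∧ (∀ x ∈ l, x ∈ M) ∧ δ ≤ ‖l.prod‖ := by
    intro n
    obtain ⟨m, hm, hmδ⟩ := hcon (n + 1) (by omega)
    obtain ⟨f, rfl⟩ := Set.mem_pow.1 hm
    refine ⟨_, by simp, ?_, hmδ⟩
    intro x hx
    obtain ⟨i, rfl⟩ := (List.mem_ofFn' _ _).1 hx
    exact (f i).2
  choose L hLn hLM hLδ using hL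
  let u : ℕ → ℕ → A := fun k n => ((L n).take k).prod
  let h : ℕ → ℕ → ℕ → A := fun k l n => (((L n).take l).drop k).prod
  have hu : ∀ k n, 1 ≤ k → k ≤ n → u k n ∈ 𝒦 := fun k n hk hkn => by
    refine hM k hk ?_
    have := List.prod_mem_set_pow (s := M) ((L n).take k) fun x hx =>
      hLM n x (List.mem_of_mem_take hx)
    rwa [List.length_take, hLn, min_eq_left (by omega)] at this
  have hh : ∀ k l n, k < l → l ≤ n → h k l n ∈ 𝒦 := fun k l n hk hln => by
    refine hM (l - k) (by omega) ?_
    have := List.prod_mem_set_pow (s := M) (((L n).take l).drop k) fun x hx =>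
      hLM n x (List.mem_of_mem_take (List.mem_of_mem_drop hx))
    rwa [List.length_drop, List.length_take, hLn, min_eq_left (by omega)] at this
  have huh : ∀ k l n, k < l → u l n = u k n * h k l n := fun k l n hk => by
    simp only [u, h]
    conv_lhs => rw [← List.take_append_drop k ((L n).take l), List.prod_append, List.take_take,
      min_eq_left hk.le]
  have hκ : ∀ k n, k ≤ n → δ / K ≤ ‖u k n‖ := fun k n hkn => by
    have h1 : (L n).prod = u k n * ((L n).drop k).prod := by
      simp only [u]; rw [← List.prod_append, List.take_append_drop]
    have h2 : ((L n).drop k).prod ∈ 𝒦 := by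
      refine hM (n + 1 - k) (by omega) ?_
      have := List.prod_mem_set_pow (s := M) ((L n).drop k) fun x hx =>
        hLM n x (List.mem_of_mem_drop hx)
      rwa [List.length_drop, hLn] at this
    have h3 := hLδ n
    rw [h1] at h3
    rw [div_le_iff₀ hK0]
    exact h3.trans ((norm_mul_le _ _).trans
      (mul_le_mul_of_nonneg_left (hK _ h2) (norm_nonneg _)))
  let U : Ultrafilter ℕ := Filter.hyperfilter ℕ
  have hUge : ∀ k : ℕ, ∀ᶠ n in U, k ≤ n := fun k =>
    (eventually_ge_atTop k).filter_mono Nat.hyperfilter_le_atTop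
  have hUgt : ∀ k : ℕ, ∀ᶠ n in U, k < n := fun k =>
    (eventually_gt_atTop k).filter_mono Nat.hyperfilter_le_atTop
  have hu' : ∀ k, ∃ y, 1 ≤ k → y ∈ 𝒦 ∧ Tendsto (u k) U (𝓝 y) := fun k => by
    by_cases hk : 1 ≤ k
    · obtain ⟨y, h1, h2⟩ := h𝒦.exists_ultrafilter_tendsto U ((hUge k).mono fun n hn => hu k n hk hn)
      exact ⟨y, fun _ => ⟨h1, h2⟩⟩
    · exact ⟨0, fun h => absurd h hk⟩
  choose v hv using hu'
  have hh' : ∀ k l, ∃ y, k < l → y ∈ 𝒦 ∧ Tendsto (h k l) U (𝓝 y) := fun k l => by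
    by_cases hk : k < l
    · obtain ⟨y, h1, h2⟩ :=
        h𝒦.exists_ultrafilter_tendsto U ((hUge l).mono fun n hn => hh k l n hk hn)
      exact ⟨y, fun _ => ⟨h1, h2⟩⟩
    · exact ⟨0, fun h => absurd h hk⟩
  choose q hq using hh'
  have hvq : ∀ k l, 1 ≤ k → k < l → v l = v k * q k l := fun k l hk hkl => by
    refine tendsto_nhds_unique (hv l (by omega)).2 ?_
    exact (((hv k hk).2.mul (hq k l hkl).2)).congr fun n => (huh k l n hkl).symm
  have hvκ : ∀ k, 1 ≤ k → δ / K ≤ ‖v k‖ := fun k hk =>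
    ge_of_tendsto (hv k hk).2.norm ((hUge k).mono fun n hn => hκ k n hn)
  obtain ⟨w, -, hwlim⟩ := h𝒦.exists_ultrafilter_tendsto U ((hUge 1).mono fun k hk => (hv k hk).1)
  have hp' : ∀ k, ∃ y ∈ 𝒦, Tendsto (q k) U (𝓝 y) := fun k =>
    h𝒦.exists_ultrafilter_tendsto U ((hUgt k).mono fun l hl => (hq k l hl).1)
  choose p hp𝒦 hp using hp'
  have hwp : ∀ k, 1 ≤ k → w = v k * p k := fun k hk => by
    refine tendsto_nhds_unique hwlim ((tendsto_const_nhds.mul (hp k)).congr' ?_)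
    exact (hUgt k).mono fun l hl => (hvq k l hk hl).symm
  obtain ⟨r, hr𝒦, hr⟩ := h𝒦.exists_ultrafilter_tendsto U (Eventually.of_forall hp𝒦)
  have hwr : w = w * r := by
    refine tendsto_nhds_unique tendsto_const_nhds ((hwlim.mul hr).congr' ?_)
    exact (hUge 1).mono fun k hk => (hwp k hk).symm
  have hw0 : w = 0 := by
    have h1 : w * (1 - r) = 0 := by rw [mul_sub, mul_one, ← hwr, sub_self]
    exact ((hunit r hr𝒦).mul_left_eq_zero).1 h1
  have hwκ : δ / K ≤ ‖w‖ := ge_of_tendsto hwlim.norm ((hUge 1).mono fun k hk => hvκ k hk)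
  rw [hw0, norm_zero] at hwκ
  exact absurd (div_pos hδ hK0) (not_lt.2 hwκ)

/-- Near-extremal products when the joint spectral radius is `1` but products are unbounded. -/
theorem exists_extremal_product {M : Set A}
    (hbd : ∀ s : ℝ, 1 < s → ∃ K : ℝ, ∀ n, ∀ m ∈ M ^ n, ‖m‖ ≤ K * s ^ n)
    (hub : ∀ K : ℝ, ∃ n, ∃ m ∈ M ^ n, K < ‖m‖) {R : ℝ} (hR : 0 < R) :
    ∃ N, ∃ T ∈ M ^ N, R ≤ ‖T‖ ∧ (∀ n ≤ N, ∀ m ∈ M ^ n, ‖m‖ ≤ 2 * ‖T‖) ∧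
      ∀ n ≤ 2 * N, ∀ m ∈ M ^ n, R * ‖m‖ ≤ ‖T‖ ^ 2 := by
  obtain ⟨n₀, m₀, hm₀, hm₀R⟩ := hub (8 * R)
  obtain ⟨s, hs1, hs2⟩ : ∃ s : ℝ, 1 < s ∧ s ^ n₀ < 2 := by
    have h1 : ContinuousAt (fun s : ℝ => s ^ n₀) 1 := by fun_prop
    have h2 : ∀ᶠ s : ℝ in 𝓝[>] 1, s ^ n₀ < 2 :=
      (h1.eventually (gt_mem_nhds (by norm_num))).filter_mono nhdsWithin_le_nhds
    obtain ⟨s, h3, h4⟩ := (h2.and self_mem_nhdsWithin).exists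
    exact ⟨s, h4, h3⟩
  have hs0 : 0 < s := one_pos.trans hs1
  obtain ⟨K, hK⟩ := hbd s hs1
  let Γ : Set ℝ := {r | ∃ n, ∃ m ∈ M ^ n, r = ‖m‖ / s ^ n}
  have hΓb : BddAbove Γ := ⟨K, by
    rintro _ ⟨n, m, hm, rfl⟩
    rw [div_le_iff₀ (by positivity)]; exact hK n m hm⟩
  have hΓle : ∀ n, ∀ m ∈ M ^ n, ‖m‖ ≤ sSup Γ * s ^ n := fun n m hm => by
    rw [← div_le_iff₀ (by positivity)]; exact le_csSup hΓb ⟨n, m, hm, rfl⟩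
  have hg : 4 * R < sSup Γ := by
    have h1 := hΓle n₀ m₀ hm₀
    by_contra! h2
    have h3 : 0 < s ^ n₀ := by positivity
    nlinarith
  obtain ⟨_, ⟨N, T, hT, rfl⟩, hTg⟩ := exists_lt_of_lt_csSup
    (s := Γ) ⟨_, n₀, m₀, hm₀, rfl⟩ (show sSup Γ / 2 < sSup Γ by linarith)
  rw [lt_div_iff₀ (by positivity)] at hTg
  have hg0 : 0 ≤ sSup Γ := by linarith
  have hsN : 1 ≤ s ^ N := one_le_pow₀ hs1.le
  refine ⟨N, T, hT, by nlinarith, fun n hn m hm => ?_, fun n hn m hm => ?_⟩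
  · have h1 := hΓle n m hm
    have h2 : s ^ n ≤ s ^ N := pow_le_pow_right₀ hs1.le hn
    nlinarith
  · have h1 := hΓle n m hm
    have h2 : s ^ n ≤ (s ^ N) ^ 2 := by
      rw [← pow_mul]; exact pow_le_pow_right₀ hs1.le (by omega)
    have h3 : (sSup Γ / 2 * s ^ N) ^ 2 ≤ ‖T‖ ^ 2 := pow_le_pow_left₀ (by positivity) hTg.le 2
    have h4 : ‖m‖ ≤ sSup Γ * (s ^ N) ^ 2 := h1.trans (mul_le_mul_of_nonneg_left h2 (by linarith))
    have h5 : R * ‖m‖ ≤ R * (sSup Γ * (s ^ N) ^ 2) := mul_le_mul_of_nonneg_left h4 hR.le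
    have h6 : 0 ≤ sSup Γ * (s ^ N) ^ 2 := by positivity
    nlinarith

/-- If products of length `n` have norm at most `1 / 2` then products decay geometrically. -/
theorem exists_geometric_decay {M : Set A} {K : ℝ} (hK : ∀ n, ∀ m ∈ M ^ n, ‖m‖ ≤ K) {n : ℕ}
    (hn : 1 ≤ n) (hlt : ∀ m ∈ M ^ n, ‖m‖ < 1 / 2) :
    ∃ s : ℝ, 0 < s ∧ s < 1 ∧ ∃ K' : ℝ, ∀ N, ∀ m ∈ M ^ N, ‖m‖ ≤ K' * s ^ N := by
  obtain ⟨s, hs0, hs1, hsn⟩ : ∃ s : ℝ, 0 < s ∧ s < 1 ∧ 1 / 2 ≤ s ^ n := by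
    have h1 : ContinuousAt (fun s : ℝ => s ^ n) 1 := by fun_prop
    have h2 : ∀ᶠ s : ℝ in 𝓝[<] 1, 1 / 2 < s ^ n :=
      (h1.eventually (lt_mem_nhds (by norm_num))).filter_mono nhdsWithin_le_nhds
    have h3 : ∀ᶠ s : ℝ in 𝓝[<] 1, 0 < s := (lt_mem_nhds one_pos).filter_mono nhdsWithin_le_nhds
    obtain ⟨s, ⟨h3, h4⟩, h5⟩ := ((h2.and h3).and self_mem_nhdsWithin).exists
    exact ⟨s, h4, h5, h3.le⟩
  refine ⟨s, hs0, hs1, |K| / s ^ n, fun N => ?_⟩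
  have hsn0 : 0 < s ^ n := by positivity
  induction N using Nat.strong_induction_on with
  | _ N ih =>
    intro m hm
    rcases lt_or_ge N n with h | h
    · have h1 : s ^ n ≤ s ^ N := pow_le_pow_of_le_one hs0.le hs1.le h.le
      refine ((hK N m hm).trans (le_abs_self K)).trans ?_
      rw [div_mul_eq_mul_div, le_div_iff₀ hsn0]
      exact mul_le_mul_of_nonneg_left h1 (abs_nonneg K)
    · obtain ⟨k, rfl⟩ := Nat.exists_eq_add_of_le h
      rw [pow_add] at hm
      obtain ⟨m₁, hm₁, m₂, hm₂, rfl⟩ := Set.mem_mul.1 hm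
      have h1 := ih k (by omega) m₂ hm₂
      have h2 : ‖m₁‖ ≤ s ^ n := (hlt m₁ hm₁).le.trans hsn
      calc ‖m₁ * m₂‖ ≤ ‖m₁‖ * ‖m₂‖ := norm_mul_le _ _
        _ ≤ s ^ n * (|K| / s ^ n * s ^ k) := mul_le_mul h2 h1 (norm_nonneg _) hsn0.le
        _ = _ := by rw [pow_add]; ring

end BoundedProducts

section Turovskii

open Filter Topology
open scoped Pointwise

variable {Y : Type*} [NormedAddCommGroup Y] [NormedSpace ℂ Y]

/-- Two-sided multiplication by compact operators is a compact map. -/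
theorem IsCompactOperator.isCompact_closure_mul_mul [CompleteSpace Y] {a b : Y →L[ℂ] Y}
    (ha : IsCompactOperator a) (hb : IsCompactOperator b) (R : ℝ) :
    IsCompact (closure {T : Y →L[ℂ] Y | ∃ Z : Y →L[ℂ] Y, ‖Z‖ ≤ R ∧ T = a * Z * b}) := by
  suffices h : TotallyBounded {T : Y →L[ℂ] Y | ∃ Z : Y →L[ℂ] Y, ‖Z‖ ≤ R ∧ T = a * Z * b} from
    h.closure.isCompact_of_isClosed isClosed_closure
  rcases lt_or_ge R 0 with hR | hR
  · convert totallyBounded_empty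
    refine Set.eq_empty_of_forall_notMem ?_
    rintro _ ⟨Z, hZ, -⟩
    exact absurd (hZ.trans_lt hR) (not_lt.2 (norm_nonneg _))
  rw [Metric.totallyBounded_iff]
  intro ε hε
  obtain ⟨C, hC, hbC⟩ := hb.image_closedBall_subset_compact (1 : ℝ)
  obtain ⟨δ, hδ, hδε⟩ : ∃ δ, 0 < δ ∧ δ + ‖a‖ * (2 * R) * δ < ε := by
    refine ⟨ε / (2 * (1 + ‖a‖ * (2 * R))), by positivity, ?_⟩
    have h1 : 0 < 1 + ‖a‖ * (2 * R) := by positivity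
    have h2 : ε / (2 * (1 + ‖a‖ * (2 * R))) + ‖a‖ * (2 * R) * (ε / (2 * (1 + ‖a‖ * (2 * R)))) =
        ε / 2 := by field_simp
    rw [h2]; linarith
  obtain ⟨t, -, htf, htC⟩ := hC.finite_cover_balls hδ
  have := htf.fintype
  obtain ⟨r, hr⟩ := htf.isBounded.exists_norm_le
  obtain ⟨C', hC', haC'⟩ := ha.image_closedBall_subset_compact (R * r)
  have htb : TotallyBounded ((fun Z : Y →L[ℂ] Y => fun x : t => a (Z x)) '' {Z | ‖Z‖ ≤ R}) := by
    refine (isCompact_univ_pi fun _ : t => hC').totallyBounded.subset ?_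
    rintro _ ⟨Z, hZ, rfl⟩ x -
    refine haC' ⟨Z x, ?_, rfl⟩
    rw [mem_closedBall_zero_iff]
    exact (Z.le_opNorm _).trans (mul_le_mul hZ (hr x x.2) (norm_nonneg _) hR)
  obtain ⟨v, hvS, hvf, hv⟩ := Set.exists_subset_image_finite_and.1
    (htb.exists_subset (Metric.dist_mem_uniformity hδ))
  refine ⟨(fun Z => a * Z * b) '' v, hvf.image _, ?_⟩
  rintro _ ⟨Z, hZ, rfl⟩
  obtain ⟨_, ⟨Z', hZ', rfl⟩, hZZ⟩ := Set.mem_iUnion₂.1 (hv ⟨Z, hZ, rfl⟩)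
  refine Set.mem_iUnion₂.2 ⟨_, ⟨Z', hZ', rfl⟩, ?_⟩
  rw [Metric.mem_ball, dist_eq_norm]
  refine lt_of_le_of_lt (ContinuousLinearMap.opNorm_le_of_unit_norm (by positivity)
    fun y hy => ?_) hδε
  obtain ⟨x, hx, hxy⟩ := Set.mem_iUnion₂.1 (htC (hbC ⟨y, by simp [hy], rfl⟩))
  rw [Metric.mem_ball, dist_eq_norm] at hxy
  have h1 : ‖a (Z x) - a (Z' x)‖ < δ := by
    have h2 : dist (fun x : t => a (Z x)) (fun x : t => a (Z' x)) < δ := hZZ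
    have h3 := (dist_pi_lt_iff hδ).1 h2 ⟨x, hx⟩
    rwa [dist_eq_norm] at h3
  have h2 : ‖Z - Z'‖ ≤ 2 * R := (norm_sub_le _ _).trans (by
    have : ‖Z'‖ ≤ R := hvS hZ'
    linarith)
  have h3 : (a * Z * b - a * Z' * b) y = (a (Z x) - a (Z' x)) + a ((Z - Z') (b y - x)) := by
    simp only [sub_apply, mul_apply_eq_comp, map_sub]; abel
  rw [h3]
  refine (norm_add_le _ _).trans (add_le_add h1.le ((a.le_opNorm _).trans ?_))
  rw [mul_assoc]
  refine mul_le_mul_of_nonneg_left (((Z - Z').le_opNorm _).trans ?_) (norm_nonneg _)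
  exact mul_le_mul h2 hxy.le (norm_nonneg _) (by positivity)

/-- The operators `a * s * b` with `s ∈ S` in the unit ball. -/
def sandwich (S : Set (Y →L[ℂ] Y)) (a b : Y →L[ℂ] Y) : Set (Y →L[ℂ] Y) :=
  {T | ∃ s ∈ S, ‖s‖ ≤ 1 ∧ T = a * s * b}

lemma exists_norm_le_of_mem_span {S : Set (Y →L[ℂ] Y)} (hsmul : ∀ s ∈ S, ∀ t : ℂ, t • s ∈ S)
    {A : Y →L[ℂ] Y} (hA : A ∈ Submodule.span ℂ S) : ∃ C : ℝ, 0 ≤ C ∧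
      ∀ (L : (Y →L[ℂ] Y) →ₗ[ℂ] (Y →L[ℂ] Y)) (β : ℝ), 0 ≤ β →
        (∀ s ∈ S, ‖s‖ ≤ 1 → ‖L s‖ ≤ β) → ‖L A‖ ≤ C * β := by
  induction hA using Submodule.span_induction with
  | mem s hs =>
    refine ⟨‖s‖, norm_nonneg _, fun L β hβ hL => ?_⟩
    rcases eq_or_ne s 0 with rfl | h0
    · simp
    have hn : (‖s‖ : ℂ) ≠ 0 := by exact_mod_cast norm_ne_zero_iff.2 h0
    have h1 := hL ((‖s‖ : ℂ)⁻¹ • s) (hsmul s hs _) (by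
      rw [norm_smul, norm_inv, Complex.norm_real, norm_norm,
        inv_mul_cancel₀ (norm_ne_zero_iff.2 h0)])
    have h2 : L s = (‖s‖ : ℂ) • L ((‖s‖ : ℂ)⁻¹ • s) := by
      rw [map_smul, smul_smul, mul_inv_cancel₀ hn, one_smul]
    rw [h2, norm_smul, Complex.norm_real, norm_norm]
    exact mul_le_mul_of_nonneg_left h1 (norm_nonneg _)
  | zero => exact ⟨0, le_rfl, fun L β _ _ => by simp⟩
  | add a b _ _ ha hb =>
    obtain ⟨C, hC, h1⟩ := ha
    obtain ⟨C', hC', h2⟩ := hb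
    refine ⟨C + C', by positivity, fun L β hβ hL => ?_⟩
    rw [map_add, add_mul]
    exact (norm_add_le _ _).trans (add_le_add (h1 L β hβ hL) (h2 L β hβ hL))
  | smul t a _ ha =>
    obtain ⟨C, hC, h1⟩ := ha
    refine ⟨‖t‖ * C, by positivity, fun L β hβ hL => ?_⟩
    rw [map_smul, norm_smul, mul_assoc]
    exact mul_le_mul_of_nonneg_left (h1 L β hβ hL) (norm_nonneg _)

/-- Hilden's argument: a dense-orbit condition bounds the products of a sandwich from below. -/
theorem exists_sandwich_lower_bound {S : Set (Y →L[ℂ] Y)}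
    (hsmul : ∀ s ∈ S, ∀ t : ℂ, t • s ∈ S)
    (hdense : ∀ y ≠ 0, (Submodule.span ℂ ((fun s : Y →L[ℂ] Y => s y) '' S)).topologicalClosure = ⊤)
    {a b : Y →L[ℂ] Y} (hcpt : IsCompactOperator (b * a)) (hba : b * a ≠ 0) :
    ∃ C η : ℝ, 0 < C ∧ 0 < η ∧ ∀ (n : ℕ) (β : ℝ), 0 ≤ β → (∀ m ∈ sandwich S a b ^ n, ‖m‖ ≤ β) →
      η ≤ C ^ n * β := by
  obtain ⟨x₀, hx₀⟩ : ∃ x, (b * a) x ≠ 0 := by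
    by_contra! h
    exact hba (ContinuousLinearMap.ext h)
  have hη₀ : 0 < ‖(b * a) x₀‖ / 2 := by have := norm_pos_iff.2 hx₀; positivity
  set η₀ := ‖(b * a) x₀‖ / 2 with hη₀def
  obtain ⟨r, hr0, hr⟩ : ∃ r, 0 < r ∧ ‖b * a‖ * r ≤ η₀ := by
    refine ⟨η₀ / (‖b * a‖ + 1), by positivity, ?_⟩
    rw [mul_div_assoc', div_le_iff₀ (by positivity)]
    nlinarith
  have hlow : ∀ y ∈ Metric.closedBall x₀ r, η₀ ≤ ‖(b * a) y‖ := by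
    intro y hy
    rw [mem_closedBall_iff_norm'] at hy
    have h1 : ‖(b * a) (x₀ - y)‖ ≤ η₀ :=
      ((b * a).le_opNorm _).trans ((mul_le_mul_of_nonneg_left hy (norm_nonneg _)).trans hr)
    rw [map_sub] at h1
    have h2 := norm_sub_norm_le ((b * a) x₀) ((b * a) y)
    linarith
  obtain ⟨𝒦₀, h𝒦₀, himg⟩ := hcpt.image_subset_compact_of_bounded
    (f := ((b * a : Y →L[ℂ] Y) : Y →ₗ[ℂ] Y)) (Metric.isBounded_closedBall (x := x₀) (r := r))
  have h𝒦 : IsCompact (𝒦₀ ∩ {z | η₀ ≤ ‖z‖}) :=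
    h𝒦₀.inter_right (isClosed_le continuous_const continuous_norm)
  obtain ⟨t, ht⟩ := h𝒦.elim_finite_subcover
    (fun A : Submodule.span ℂ S => {z | ‖(A : Y →L[ℂ] Y) z - x₀‖ < r})
    (fun A => isOpen_lt (by fun_prop) continuous_const) (by
      rintro z ⟨-, hz⟩
      have hz0 : z ≠ 0 := norm_pos_iff.1 (hη₀.trans_le hz)
      have h1 : x₀ ∈ (Submodule.span ℂ
          ((fun s : Y →L[ℂ] Y => s z) '' S)).topologicalClosure := by rw [hdense z hz0]; trivial
      obtain ⟨w, hw, hwx⟩ := Metric.mem_closure_iff.1 h1 r hr0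
      have h2 : (fun s : Y →L[ℂ] Y => s z) = ((ContinuousLinearMap.apply ℂ Y z :
          (Y →L[ℂ] Y) →L[ℂ] Y) : (Y →L[ℂ] Y) →ₗ[ℂ] Y) := rfl
      rw [h2, ← Submodule.map_span] at hw
      obtain ⟨A, hA, rfl⟩ := hw
      refine Set.mem_iUnion.2 ⟨⟨A, hA⟩, ?_⟩
      rw [dist_eq_norm, norm_sub_rev] at hwx
      exact hwx)
  choose C₁ hC₁0 hC₁ using fun A : Submodule.span ℂ S => exists_norm_le_of_mem_span hsmul A.2
  obtain ⟨C₂, hC₂⟩ := (t.image C₁).exists_le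
  set C := max C₂ 1 with hC
  have hC1 : 1 ≤ C := le_max_right _ _
  have hCt : ∀ A ∈ t, C₁ A ≤ C := fun A hA =>
    (hC₂ _ (Finset.mem_image_of_mem _ hA)).trans (le_max_left _ _)
  let H : Set (Y →L[ℂ] Y) := {T | ∃ A ∈ t, T = a * (A : Y →L[ℂ] Y) * b}
  have hH : ∀ n, ∀ h ∈ H ^ n, ∀ (L : (Y →L[ℂ] Y) →ₗ[ℂ] (Y →L[ℂ] Y)) (β : ℝ), 0 ≤ β →
      (∀ m ∈ sandwich S a b ^ n, ‖L m‖ ≤ β) → ‖L h‖ ≤ C ^ n * β := by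
    intro n
    induction n with
    | zero =>
      intro h hh L β hβ hL
      rw [pow_zero] at hh hL
      rw [pow_zero, one_mul, Set.mem_one.1 hh]
      exact hL 1 (Set.mem_one.2 rfl)
    | succ n ih =>
      intro h hh L β hβ hL
      rw [pow_succ'] at hh hL
      obtain ⟨_, ⟨A, hA, rfl⟩, h₂, hh₂, rfl⟩ := Set.mem_mul.1 hh
      have h1 : ∀ m ∈ sandwich S a b, ‖L (m * h₂)‖ ≤ C ^ n * β := fun m hm =>
        ih h₂ hh₂ (L ∘ₗ LinearMap.mulLeft ℂ m) β hβ fun m' hm' =>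
          hL _ (Set.mul_mem_mul hm hm')
      have h2 := hC₁ A (L ∘ₗ LinearMap.mulLeft ℂ a ∘ₗ LinearMap.mulRight ℂ (b * h₂)) (C ^ n * β)
        (by positivity) fun s hs hs1 => by
          have := h1 (a * s * b) ⟨s, hs, hs1, rfl⟩
          simpa [mul_assoc] using this
      have h3 : (L ∘ₗ LinearMap.mulLeft ℂ a ∘ₗ LinearMap.mulRight ℂ (b * h₂)) A =
          L (a * (A : Y →L[ℂ] Y) * b * h₂) := by simp [mul_assoc]
      rw [← h3, pow_succ', mul_assoc]
      exact h2.trans (mul_le_mul_of_nonneg_right (hCt A hA) (by positivity))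
  have horb : ∀ n, ∃ h ∈ H ^ n, ∃ y ∈ Metric.closedBall x₀ r, (b * h * a) x₀ = (b * a) y := by
    intro n
    induction n with
    | zero => exact ⟨1, by simp, x₀, Metric.mem_closedBall_self hr0.le, by simp⟩
    | succ n ih =>
      obtain ⟨h, hh, y, hy, hhy⟩ := ih
      obtain ⟨A, hA, hAy⟩ := Set.mem_iUnion₂.1 (ht ⟨himg ⟨y, hy, rfl⟩, hlow y hy⟩)
      refine ⟨a * A * b * h, ?_, (A : Y →L[ℂ] Y) ((b * a) y), ?_, ?_⟩
      · rw [pow_succ']; exact Set.mul_mem_mul ⟨A, hA, rfl⟩ hh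
      · rw [mem_closedBall_iff_norm]; exact (show ‖_‖ < r from hAy).le
      · rw [← hhy]; simp
  refine ⟨C, η₀ / ((‖b‖ * ‖a‖ + 1) * (‖x₀‖ + 1)), by positivity, by positivity,
    fun n β hβ hm => ?_⟩
  obtain ⟨h, hh, y, hy, hhy⟩ := horb n
  have h1 := hH n h hh (LinearMap.mulLeft ℂ b ∘ₗ LinearMap.mulRight ℂ a) (‖b‖ * ‖a‖ * β)
    (by positivity) fun m hm' => by
      have h2 : ‖b * (m * a)‖ ≤ ‖b‖ * (‖m‖ * ‖a‖) := (norm_mul_le _ _).trans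
        (mul_le_mul_of_nonneg_left (norm_mul_le _ _) (norm_nonneg _))
      have h3 : ‖b‖ * (‖m‖ * ‖a‖) ≤ ‖b‖ * (β * ‖a‖) := by gcongr; exact hm m hm'
      calc ‖(LinearMap.mulLeft ℂ b ∘ₗ LinearMap.mulRight ℂ a) m‖ = ‖b * (m * a)‖ := rfl
        _ ≤ _ := h2.trans (h3.trans (le_of_eq (by ring)))
  have h2 : η₀ ≤ ‖b * h * a‖ * ‖x₀‖ := by
    refine (hlow y hy).trans ?_
    rw [← hhy]; exact ContinuousLinearMap.le_opNorm _ _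
  have h3 : ‖b * h * a‖ ≤ C ^ n * (‖b‖ * ‖a‖ * β) := by rw [mul_assoc]; exact h1
  rw [div_le_iff₀ (by positivity)]
  calc η₀ ≤ ‖b * h * a‖ * ‖x₀‖ := h2
    _ ≤ C ^ n * (‖b‖ * ‖a‖ * β) * ‖x₀‖ := by gcongr
    _ ≤ C ^ n * ((‖b‖ * ‖a‖ + 1) * β) * (‖x₀‖ + 1) := by gcongr <;> linarith
    _ = _ := by ring

end Turovskii

section Turovskii

open Filter Topology
open scoped Pointwise

/-- Normalisation of the joint spectral radius to `1`. -/
lemma exists_normalization {A : Type*} [NormedRing A] [NormedAlgebra ℂ A] {M : Set A} {s₀ : ℝ}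
    (hs₀ : 0 < s₀) (hup : ∀ n, ∀ m ∈ M ^ n, ‖m‖ ≤ s₀ ^ n) {C η : ℝ} (hC : 0 < C) (hη : 0 < η)
    (hlow : ∀ (n : ℕ) (β : ℝ), 0 ≤ β → (∀ m ∈ M ^ n, ‖m‖ ≤ β) → η ≤ C ^ n * β) :
    ∃ ρ : ℝ, 0 < ρ ∧
      (∀ s : ℝ, 1 < s → ∃ K : ℝ, ∀ n, ∀ m ∈ ((ρ : ℂ)⁻¹ • M) ^ n, ‖m‖ ≤ K * s ^ n) ∧
      ∀ s : ℝ, 0 < s → s < 1 → ¬ ∃ K : ℝ, ∀ n, ∀ m ∈ ((ρ : ℂ)⁻¹ • M) ^ n, ‖m‖ ≤ K * s ^ n := by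
  let B : Set ℝ := {s | 0 < s ∧ ∃ K : ℝ, ∀ n, ∀ m ∈ M ^ n, ‖m‖ ≤ K * s ^ n}
  have hB0 : s₀ ∈ B := ⟨hs₀, 1, by simpa using hup⟩
  have hBlow : ∀ s ∈ B, C⁻¹ ≤ s := by
    rintro s ⟨hs, K, hK⟩
    by_contra! h
    have h1 : C * s < 1 := by
      rw [← mul_inv_cancel₀ hC.ne']; exact mul_lt_mul_of_pos_left h hC
    have h2 : Tendsto (fun n : ℕ => |K| * (C * s) ^ n) atTop (𝓝 (|K| * 0)) :=
      (tendsto_pow_atTop_nhds_zero_of_lt_one (by positivity) h1).const_mul _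
    rw [mul_zero] at h2
    refine absurd (ge_of_tendsto' h2 fun n => ?_) (not_le.2 hη)
    have h3 := hlow n (|K| * s ^ n) (by positivity) fun m hm =>
      (hK n m hm).trans (mul_le_mul_of_nonneg_right (le_abs_self K) (by positivity))
    exact h3.trans (le_of_eq (by rw [mul_pow]; ring))
  have hBb : BddBelow B := ⟨C⁻¹, hBlow⟩
  have hρ : 0 < sInf B := (inv_pos.2 hC).trans_le (le_csInf ⟨s₀, hB0⟩ hBlow)
  generalize hρB : sInf B = ρ at hρ
  have hnorm : ‖((ρ : ℂ)⁻¹)‖ = ρ⁻¹ := by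
    rw [norm_inv, Complex.norm_real, Real.norm_of_nonneg hρ.le]
  refine ⟨ρ, hρ, fun s hs => ?_, fun s hs0 hs1 hK => ?_⟩
  · obtain ⟨s', ⟨hs'0, K, hK⟩, hs'⟩ := exists_lt_of_csInf_lt (s := B) ⟨s₀, hB0⟩
      (show sInf B < ρ * s by rw [hρB]; exact lt_mul_of_one_lt_right hρ hs)
    refine ⟨|K|, fun n m hm => ?_⟩
    rw [smul_pow] at hm
    obtain ⟨m', hm', rfl⟩ := Set.mem_smul_set.1 hm
    rw [norm_smul, norm_pow, hnorm]
    have h1 : ‖m'‖ ≤ |K| * (ρ * s) ^ n := (hK n m' hm').trans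
      (mul_le_mul (le_abs_self K) (pow_le_pow_left₀ hs'0.le hs'.le n) (by positivity)
        (abs_nonneg K))
    calc ρ⁻¹ ^ n * ‖m'‖ ≤ ρ⁻¹ ^ n * (|K| * (ρ * s) ^ n) := by gcongr
      _ = |K| * s ^ n := by rw [mul_pow, inv_pow]; field_simp
  · obtain ⟨K, hK⟩ := hK
    have h1 : ρ * s ∈ B := by
      refine ⟨by positivity, K, fun n m hm => ?_⟩
      have h2 := hK n ((ρ : ℂ)⁻¹ ^ n • m) (by rw [smul_pow]; exact Set.smul_mem_smul_set hm)
      rw [norm_smul, norm_pow, hnorm, inv_pow, inv_mul_le_iff₀ (by positivity)] at h2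
      exact h2.trans (le_of_eq (by rw [mul_pow]; ring))
    have h2 := csInf_le hBb h1
    rw [hρB] at h2
    nlinarith

variable {Y : Type*} [NormedAddCommGroup Y] [NormedSpace ℂ Y]

lemma smul_sandwich (S : Set (Y →L[ℂ] Y)) (a b : Y →L[ℂ] Y) (t : ℂ) :
    sandwich S (t • a) b = t • sandwich S a b := by
  ext T
  simp only [sandwich, Set.mem_ofPred_eq, Set.mem_smul_set]
  constructor
  · rintro ⟨s, hs, hs1, rfl⟩
    exact ⟨_, ⟨s, hs, hs1, rfl⟩, by simp only [smul_mul_assoc]⟩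
  · rintro ⟨_, ⟨s, hs, hs1, rfl⟩, rfl⟩
    exact ⟨s, hs, hs1, by simp only [smul_mul_assoc]⟩

lemma norm_le_pow_of_mem_sandwich_pow {S : Set (Y →L[ℂ] Y)} {a b : Y →L[ℂ] Y} :
    ∀ n, ∀ m ∈ sandwich S a b ^ n, ‖m‖ ≤ (‖a‖ * ‖b‖ + 1) ^ n
  | 0, m, hm => by
    rw [pow_zero] at hm ⊢
    rw [Set.mem_one.1 hm]
    exact ContinuousLinearMap.norm_id_le
  | n + 1, m, hm => by
    rw [pow_succ] at hm ⊢
    obtain ⟨m', hm', _, ⟨s, -, hs1, rfl⟩, rfl⟩ := Set.mem_mul.1 hm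
    have h1 : ‖a * s * b‖ ≤ ‖a‖ * ‖s‖ * ‖b‖ :=
      (norm_mul_le _ _).trans (mul_le_mul_of_nonneg_right (norm_mul_le _ _) (norm_nonneg _))
    have h2 : ‖a‖ * ‖s‖ * ‖b‖ ≤ ‖a‖ * 1 * ‖b‖ := by gcongr
    exact (norm_mul_le _ _).trans (mul_le_mul (norm_le_pow_of_mem_sandwich_pow n m' hm')
      (by linarith) (norm_nonneg _) (by positivity))

lemma sandwich_pow_subset {S : Set (Y →L[ℂ] Y)} (hmul : ∀ s ∈ S, ∀ t ∈ S, s * t ∈ S)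
    {a b : Y →L[ℂ] Y} (ha : a ∈ S) (hb : b ∈ S) : ∀ n, sandwich S a b ^ (n + 1) ⊆ S
  | 0, m, hm => by
    rw [zero_add, pow_one] at hm
    obtain ⟨s, hs, -, rfl⟩ := hm
    exact hmul _ (hmul _ ha _ hs) _ hb
  | n + 1, m, hm => by
    rw [pow_succ] at hm
    obtain ⟨m', hm', _, ⟨s, hs, -, rfl⟩, rfl⟩ := Set.mem_mul.1 hm
    exact hmul _ (sandwich_pow_subset hmul ha hb n hm') _ (hmul _ (hmul _ ha _ hs) _ hb)

lemma exists_eq_mul_mul_of_mem_sandwich_pow {S : Set (Y →L[ℂ] Y)} {a b : Y →L[ℂ] Y} {n : ℕ}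
    {K : ℝ} (hK : ∀ k ≤ n, ∀ m ∈ sandwich S a b ^ k, ‖m‖ ≤ K) {T : Y →L[ℂ] Y}
    (hT : T ∈ sandwich S a b ^ (n + 1)) :
    ∃ Z : Y →L[ℂ] Y, ‖Z‖ ≤ 1 + ‖b‖ * K * ‖a‖ ∧ T = a * Z * b := by
  have hK0 : 0 ≤ K := (norm_nonneg _).trans (hK 0 (Nat.zero_le _) 1 (by simp))
  rcases n with - | n
  · rw [zero_add, pow_one] at hT
    obtain ⟨s, -, hs1, rfl⟩ := hT
    exact ⟨s, hs1.trans (le_add_of_nonneg_right (by positivity)), rfl⟩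
  · rw [pow_succ, pow_succ'] at hT
    obtain ⟨_, h1, _, ⟨s', -, hs', rfl⟩, rfl⟩ := Set.mem_mul.1 hT
    obtain ⟨_, ⟨s, -, hs, rfl⟩, m, hm, rfl⟩ := Set.mem_mul.1 h1
    refine ⟨s * (b * m * a) * s', ?_, by simp only [mul_assoc]⟩
    have h2 : ‖b * m * a‖ ≤ ‖b‖ * K * ‖a‖ := by
      refine (norm_mul_le _ _).trans (mul_le_mul_of_nonneg_right ?_ (norm_nonneg _))
      exact (norm_mul_le _ _).trans
        (mul_le_mul_of_nonneg_left (hK n (Nat.le_succ n) m hm) (norm_nonneg _))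
    calc ‖s * (b * m * a) * s'‖ ≤ ‖s‖ * ‖b * m * a‖ * ‖s'‖ :=
          (norm_mul_le _ _).trans (mul_le_mul_of_nonneg_right (norm_mul_le _ _) (norm_nonneg _))
      _ ≤ 1 * (‖b‖ * K * ‖a‖) * 1 := by gcongr
      _ ≤ _ := by linarith

lemma norm_mul_mul_le_of_mem_sandwich_pow {S : Set (Y →L[ℂ] Y)}
    (hmul : ∀ s ∈ S, ∀ t ∈ S, s * t ∈ S) (hsmul : ∀ s ∈ S, ∀ t : ℂ, t • s ∈ S)
    {a b : Y →L[ℂ] Y} (ha : a ∈ S) (hb : b ∈ S) {n : ℕ} {K : ℝ}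
    (hK : ∀ m ∈ sandwich S a b ^ (2 * n + 1), ‖m‖ ≤ K) {T W : Y →L[ℂ] Y}
    (hT : T ∈ sandwich S a b ^ (n + 1)) (hW : W ∈ S) :
    ‖T * W * T‖ ≤ (‖b‖ * ‖W‖ * ‖a‖ + 1) * K := by
  obtain ⟨P, hP, _, ⟨s, hs, hs1, rfl⟩, hT1⟩ := Set.mem_mul.1 (pow_succ (sandwich S a b) n ▸ hT)
  obtain ⟨_, ⟨s', hs', hs'1, rfl⟩, P', hP', hT2⟩ :=
    Set.mem_mul.1 (pow_succ' (sandwich S a b) n ▸ hT)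
  set κ : ℝ := ‖b‖ * ‖W‖ * ‖a‖ + 1 with hκ
  have hκ0 : 0 < κ := by positivity
  have hκc : (κ : ℂ) ≠ 0 := by exact_mod_cast hκ0.ne'
  let V : Y →L[ℂ] Y := s * (b * W * a) * s'
  have hV : ‖V‖ ≤ κ := by
    calc ‖V‖ ≤ ‖s‖ * ‖b * W * a‖ * ‖s'‖ :=
          (norm_mul_le _ _).trans (mul_le_mul_of_nonneg_right (norm_mul_le _ _) (norm_nonneg _))
      _ ≤ 1 * (‖b‖ * ‖W‖ * ‖a‖) * 1 := by
          gcongr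
          exact (norm_mul_le _ _).trans
            (mul_le_mul_of_nonneg_right (norm_mul_le _ _) (norm_nonneg _))
      _ ≤ _ := by linarith
  have hVS : V ∈ S := hmul _ (hmul _ hs _ (hmul _ (hmul _ hb _ hW) _ ha)) _ hs'
  have hmem : P * (a * ((κ : ℂ)⁻¹ • V) * b) * P' ∈ sandwich S a b ^ (2 * n + 1) := by
    have h1 : 2 * n + 1 = n + 1 + n := by ring
    rw [h1, pow_add, pow_succ]
    refine Set.mul_mem_mul (Set.mul_mem_mul hP ⟨_, hsmul V hVS _, ?_, rfl⟩) hP'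
    rw [norm_smul, norm_inv, Complex.norm_real, Real.norm_of_nonneg hκ0.le]
    exact inv_mul_le_one_of_le₀ hV hκ0.le
  have heq : T * W * T = (κ : ℂ) • (P * (a * ((κ : ℂ)⁻¹ • V) * b) * P') := by
    conv_lhs => lhs; rw [← hT1]
    conv_lhs => rw [← hT2]
    simp only [V, mul_smul_comm, smul_mul_assoc, smul_smul, mul_inv_cancel₀ hκc, one_smul,
      mul_assoc]
  rw [heq, norm_smul, Complex.norm_real, Real.norm_of_nonneg hκ0.le]
  exact mul_le_mul_of_nonneg_left (hK _ hmem) hκ0.le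

/-- Turovskii's theorem: a semigroup of compact quasinilpotent operators is reducible. -/
theorem isReducible_of_compact_quasinilpotent_semigroup [CompleteSpace Y] {S : Set (Y →L[ℂ] Y)}
    (hmul : ∀ s ∈ S, ∀ t ∈ S, s * t ∈ S) (hsmul : ∀ s ∈ S, ∀ t : ℂ, t • s ∈ S)
    (hc : ∀ s ∈ S, IsCompactOperator s) (hq : ∀ s ∈ S, spectrum ℂ s ⊆ {0})
    (h0 : ∃ s ∈ S, s ≠ 0) : IsReducible S := by
  by_contra hirr
  obtain ⟨s₀, hs₀, hs₀0⟩ := h0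
  have hdense : ∀ y ≠ 0,
      (Submodule.span ℂ ((fun s : Y →L[ℂ] Y => s y) '' S)).topologicalClosure = ⊤ := by
    intro y hy
    by_contra hne
    have hkill : ∀ s ∈ S, s y = 0 := by
      by_contra! h
      obtain ⟨s, hs, hsy⟩ := h
      refine hirr ⟨_, Submodule.isClosed_topologicalClosure _, fun h => hsy ?_, hne, ?_⟩
      · have : s y ∈ (Submodule.span ℂ ((fun s : Y →L[ℂ] Y => s y) '' S)).topologicalClosure :=
          Submodule.le_topologicalClosure _ (Submodule.subset_span ⟨s, hs, rfl⟩)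
        rwa [h, Submodule.mem_bot] at this
      · intro a ha x hx
        have h1 : Submodule.span ℂ ((fun s : Y →L[ℂ] Y => s y) '' S) ≤
            (Submodule.span ℂ ((fun s : Y →L[ℂ] Y => s y) '' S)).comap (a : Y →ₗ[ℂ] Y) := by
          refine Submodule.span_le.2 ?_
          rintro _ ⟨s, hs, rfl⟩
          exact Submodule.subset_span ⟨a * s, hmul a ha s hs, rfl⟩
        exact map_mem_closure a.continuous hx fun z hz => h1 hz
    refine hirr ⟨Submodule.span ℂ {y}, Submodule.closed_of_finiteDimensional _, ?_, fun h => ?_, ?_⟩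
    · rwa [Ne, Submodule.span_singleton_eq_bot]
    · refine hs₀0 (ContinuousLinearMap.ext fun x => ?_)
      have hx : x ∈ Submodule.span ℂ {y} := h ▸ Submodule.mem_top
      obtain ⟨t, rfl⟩ := Submodule.mem_span_singleton.1 hx
      simp [hkill s₀ hs₀]
    · intro s hs x hx
      obtain ⟨t, rfl⟩ := Submodule.mem_span_singleton.1 hx
      simp [hkill s hs]
  have hdense' : ∀ y ≠ 0, ∀ T : Y →L[ℂ] Y, (∀ s ∈ S, T (s y) = 0) → T = 0 := by
    intro y hy T hT
    have h1 : (Submodule.span ℂ ((fun s : Y →L[ℂ] Y => s y) '' S)).topologicalClosure ≤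
        LinearMap.ker (T : Y →ₗ[ℂ] Y) := by
      refine Submodule.topologicalClosure_minimal _ (Submodule.span_le.2 ?_) T.isClosed_ker
      rintro _ ⟨s, hs, rfl⟩
      exact hT s hs
    rw [hdense y hy] at h1
    exact ContinuousLinearMap.ext fun x => h1 (Submodule.mem_top (x := x))
  obtain ⟨b, hb, a, ha, hba⟩ : ∃ b ∈ S, ∃ a ∈ S, b * a ≠ 0 := by
    by_contra! h
    obtain ⟨y, hy⟩ : ∃ y, s₀ y ≠ 0 := by
      by_contra! h
      exact hs₀0 (ContinuousLinearMap.ext h)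
    have hy0 : y ≠ 0 := fun h => hy (by rw [h, map_zero])
    refine hs₀0 (hdense' y hy0 s₀ fun s hs => ?_)
    rw [← mul_apply_eq_comp, h s₀ hs₀ s hs]; rfl
  obtain ⟨C, η, hC, hη, hlow⟩ := exists_sandwich_lower_bound hsmul hdense
    ((hc a ha).mul_left b) hba
  obtain ⟨ρ, hρ, hbd, hnbd⟩ := exists_normalization (by positivity)
    norm_le_pow_of_mem_sandwich_pow hC hη hlow
  rw [← smul_sandwich] at hbd hnbd
  have ha' := hsmul a ha (ρ : ℂ)⁻¹
  generalize (ρ : ℂ)⁻¹ • a = a' at hbd hnbd ha'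
  have hM := sandwich_pow_subset hmul ha' hb
  by_cases hK : ∃ K : ℝ, ∀ n, ∀ m ∈ sandwich S a' b ^ n, ‖m‖ ≤ K
  · obtain ⟨K, hK⟩ := hK
    have hsub : ⋃ n, sandwich S a' b ^ (n + 1) ⊆ {T : Y →L[ℂ] Y | ∃ Z : Y →L[ℂ] Y,
        ‖Z‖ ≤ 1 + ‖b‖ * K * ‖a'‖ ∧ T = a' * Z * b} := Set.iUnion_subset fun n T hT =>
      exists_eq_mul_mul_of_mem_sandwich_pow (fun k _ => hK k) hT
    obtain ⟨n, hn, hlt⟩ := exists_pow_norm_lt_of_isCompact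
      (𝒦 := closure (⋃ n, sandwich S a' b ^ (n + 1)))
      (((hc a' ha').isCompact_closure_mul_mul (hc b hb) _).of_isClosed_subset isClosed_closure
        (closure_mono hsub))
      (fun n hn => by
        obtain ⟨k, rfl⟩ := Nat.exists_eq_add_of_le' hn
        exact (Set.subset_iUnion (fun n => sandwich S a' b ^ (n + 1)) k).trans subset_closure)
      (fun p hp => by
        have hsubS : ⋃ n, sandwich S a' b ^ (n + 1) ⊆ S := Set.iUnion_subset hM
        have hpc : IsCompactOperator p := by
          have h1 : closure S ⊆ {f : Y →L[ℂ] Y | IsCompactOperator f} :=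
            closure_minimal hc isClosed_setOfPred_isCompactOperator
          exact h1 (closure_mono hsubS hp)
        have h1 : (1 : ℂ) ∉ spectrum ℂ p := fun h => one_ne_zero
          (spectrum.subset_zero_of_mem_closure hpc.countable_spectrum hq
            (closure_mono hsubS hp) h)
        simpa using spectrum.notMem_iff.1 h1)
      (show (0 : ℝ) < 1 / 2 by norm_num)
    obtain ⟨s, hs0, hs1, hs⟩ := exists_geometric_decay hK hn hlt
    exact hnbd s hs0 hs1 hs
  · push Not at hK
    have hT : ∀ j : ℕ, ∃ n, ∃ T ∈ sandwich S a' b ^ (n + 1), (j : ℝ) + 2 ≤ ‖T‖ ∧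
        (∀ k ≤ n, ∀ m ∈ sandwich S a' b ^ k, ‖m‖ ≤ 2 * ‖T‖) ∧
        ∀ m ∈ sandwich S a' b ^ (2 * n + 1), ‖m‖ ≤ ‖T‖ ^ 2 / ((j : ℝ) + 2) := by
      intro j
      obtain ⟨N, T, hT, hTj, h1, h2⟩ := exists_extremal_product hbd hK
        (show (0 : ℝ) < (j : ℝ) + 2 by positivity)
      rcases N with - | n
      · have h3 := norm_le_pow_of_mem_sandwich_pow 0 T hT
        rw [pow_zero] at h3
        have : (0 : ℝ) ≤ j := Nat.cast_nonneg j
        linarith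
      · refine ⟨n, T, hT, hTj, fun k hk => h1 k (by omega), fun m hm => ?_⟩
        rw [le_div_iff₀' (by positivity)]
        exact h2 (2 * n + 1) (by omega) m hm
    choose n T hT hTj hT1 hT2 using hT
    have hTpos : ∀ j, 0 < ‖T j‖ := fun j => lt_of_lt_of_le (by positivity) (hTj j)
    have hTge1 : ∀ j, 1 ≤ ‖T j‖ := fun j => le_trans
      (by have : (0 : ℝ) ≤ j := Nat.cast_nonneg j
          linarith) (hTj j)
    let Θ : ℕ → Y →L[ℂ] Y := fun j => (‖T j‖ : ℂ)⁻¹ • T j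
    have hnorm : ∀ j, ‖((‖T j‖ : ℂ)⁻¹)‖ = ‖T j‖⁻¹ := fun j => by
      rw [norm_inv, Complex.norm_real, norm_norm]
    have hΘ1 : ∀ j, ‖Θ j‖ = 1 := fun j => by
      simp only [Θ]
      rw [norm_smul, hnorm, inv_mul_cancel₀ (hTpos j).ne']
    have hcpt := (hc a' ha').isCompact_closure_mul_mul (hc b hb) (1 + 2 * ‖b‖ * ‖a'‖)
    obtain ⟨Ω, -, hΩ⟩ := hcpt.exists_ultrafilter_tendsto (Filter.hyperfilter ℕ) (g := Θ)
      (Eventually.of_forall fun j => subset_closure (by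
        obtain ⟨Z, hZ, hTZ⟩ := exists_eq_mul_mul_of_mem_sandwich_pow (hT1 j) (hT j)
        refine ⟨(‖T j‖ : ℂ)⁻¹ • Z, ?_, ?_⟩
        · rw [norm_smul, hnorm, inv_mul_le_iff₀ (hTpos j)]
          refine hZ.trans ?_
          have := hTge1 j
          have h3 : 0 ≤ ‖b‖ * ‖a'‖ := by positivity
          nlinarith
        · simp only [Θ, mul_smul_comm, smul_mul_assoc]
          exact congrArg (fun A => (‖T j‖ : ℂ)⁻¹ • A) hTZ))
    have hΩ1 : ‖Ω‖ = 1 := by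
      refine tendsto_nhds_unique hΩ.norm ?_
      simp only [hΘ1]; exact tendsto_const_nhds
    have hΩW : ∀ W ∈ S, Ω * W * Ω = 0 := by
      intro W hW
      refine tendsto_nhds_unique ((hΩ.mul_const W).mul hΩ) ?_
      have hlim : Tendsto (fun j : ℕ => (‖b‖ * ‖W‖ * ‖a'‖ + 1) / ((j : ℝ) + 2)) atTop (𝓝 0) :=
        tendsto_const_nhds.div_atTop
          (tendsto_atTop_add_const_right _ _ tendsto_natCast_atTop_atTop)
      refine squeeze_zero_norm (fun j => ?_) (hlim.mono_left Nat.hyperfilter_le_atTop)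
      have h1 := norm_mul_mul_le_of_mem_sandwich_pow hmul hsmul ha' hb (hT2 j) (hT j) hW
      have h2 : Θ j * W * Θ j = ((‖T j‖ : ℂ)⁻¹ * (‖T j‖ : ℂ)⁻¹) • (T j * W * T j) := by
        simp only [Θ, mul_smul_comm, smul_mul_assoc, smul_smul]
      rw [h2, norm_smul, norm_mul, hnorm]
      have h3 := hTpos j
      calc ‖T j‖⁻¹ * ‖T j‖⁻¹ * ‖T j * W * T j‖ ≤ ‖T j‖⁻¹ * ‖T j‖⁻¹ *
            ((‖b‖ * ‖W‖ * ‖a'‖ + 1) * (‖T j‖ ^ 2 / ((j : ℝ) + 2))) := by gcongr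
        _ = _ := by field_simp
    have hΩ0 : Ω ≠ 0 := fun h => by rw [h, norm_zero] at hΩ1; exact zero_ne_one hΩ1
    obtain ⟨y, hy⟩ : ∃ y, Ω y ≠ 0 := by
      by_contra! h
      exact hΩ0 (ContinuousLinearMap.ext h)
    exact hΩ0 (hdense' (Ω y) hy Ω fun s hs => by
      rw [← mul_apply_eq_comp, ← mul_apply_eq_comp, hΩW s hs]; rfl)

end Turovskii

section LocalDecay

open Filter Topology Metric

variable {A : Type*} [NormedRing A] [NormedAlgebra ℂ A] [CompleteSpace A]

lemma spectrum.exists_mul_of_forall_commute (hcomm : ∀ x y : A, x * y = y * x) {a b : A} {ν : ℂ}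
    (hν : ν ∈ spectrum ℂ (a * b)) : ∃ α ∈ spectrum ℂ a, ∃ β ∈ spectrum ℂ b, ν = α * β := by
  let _ : NormedCommRing A := { (inferInstance : NormedRing A) with mul_comm := hcomm }
  obtain ⟨χ, hχ⟩ := WeakDual.CharacterSpace.mem_spectrum_iff_exists.1 hν
  exact ⟨χ a, WeakDual.CharacterSpace.mem_spectrum_iff_exists.2 ⟨χ, rfl⟩, χ b,
    WeakDual.CharacterSpace.mem_spectrum_iff_exists.2 ⟨χ, rfl⟩, by rw [← hχ, map_mul]⟩

lemma spectrum.exists_mul_of_mem_mul {a b : A} (hab : a * b = b * a)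
    (ha : (spectrum ℂ a).Countable) (hb : (spectrum ℂ b).Countable) {ν : ℂ}
    (hν : ν ∈ spectrum ℂ (a * b)) : ∃ α ∈ spectrum ℂ a, ∃ β ∈ spectrum ℂ b, ν = α * β := by
  obtain ⟨S, hS, haS, hbS, hcomm⟩ : ∃ S : Subalgebra ℂ A, IsClosed (S : Set A) ∧ a ∈ S ∧ b ∈ S ∧
      ∀ x y : S, x * y = y * x := by
    have h1 : ∀ c ∈ ({a, b} : Set A), c ∈ Set.centralizer ({a, b} : Set A) := by
      rintro x (rfl | rfl) y (rfl | rfl) <;> simp [hab]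
    refine ⟨Subalgebra.centralizer ℂ (Set.centralizer {a, b}), Set.isClosed_centralizer _,
      fun y hy => (hy a (by simp)).symm, fun y hy => (hy b (by simp)).symm, fun x y => ?_⟩
    exact Subtype.ext (y.2 x fun c hc => x.2 c (h1 c hc))
  have : CompleteSpace S := hS.completeSpace_coe
  have hspec : ∀ x (hx : x ∈ S), (spectrum ℂ x).Countable →
      spectrum ℂ (⟨x, hx⟩ : S) = spectrum ℂ x := fun x hx hc =>
    Subalgebra.spectrum_eq_of_isPreconnected_compl S (hS := hS) ⟨x, hx⟩
      (hc.isConnected_compl_of_one_lt_rank (by simp)).isPreconnected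
  have h2 : ν ∈ spectrum ℂ ((⟨a, haS⟩ : S) * ⟨b, hbS⟩) :=
    spectrum.subset_subalgebra (R := ℂ) (A := A) (S := Subalgebra ℂ A) (s := S) _ hν
  obtain ⟨α, hα, β, hβ, h⟩ := spectrum.exists_mul_of_forall_commute hcomm h2
  rw [hspec a haS ha] at hα
  rw [hspec b hbS hb] at hβ
  exact ⟨α, hα, β, hβ, h⟩

lemma differentiableAt_inverse_sub {T : A} {w : ℂ} (hw : w ∉ spectrum ℂ T) :
    DifferentiableAt ℂ (fun w => Ring.inverse (algebraMap ℂ A w - T)) w := by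
  have h1 : IsUnit (algebraMap ℂ A w - T) := spectrum.notMem_iff.1 hw
  have h2 : DifferentiableAt ℂ (fun w : ℂ => algebraMap ℂ A w - T) w := by
    simp only [Algebra.algebraMap_eq_smul_one]; fun_prop
  exact (differentiableAt_inverse (𝕜 := ℂ) h1).comp w h2

/-- The resolvent integrates to the identity over a circle surrounding the spectrum. -/
lemma circleIntegral_inverse_sub_eq {T : A} {c : ℂ} {r : ℝ} (hr : 0 < r)
    (hT : ∀ z ∈ spectrum ℂ T, dist z c < r) :
    (∮ w in C(c, r), Ring.inverse (algebraMap ℂ A w - T)) = (2 * Real.pi * Complex.I : ℂ) • (1 : A) := by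
  rcases subsingleton_or_nontrivial A with _ | _
  · exact Subsingleton.elim _ _
  set N : ℝ := ‖T - algebraMap ℂ A c‖ with hN
  have hN0 : 0 ≤ N := norm_nonneg _
  set f : ℂ → A := fun w => Ring.inverse (algebraMap ℂ A w - T) with hf
  have hdiff : ∀ w, r ≤ dist w c → DifferentiableAt ℂ f w := fun w hw =>
    differentiableAt_inverse_sub fun h => absurd (hT w h) (not_lt.2 hw)
  have hmul : ∀ w, r ≤ dist w c → (algebraMap ℂ A w - T) * f w = 1 := fun w hw =>
    Ring.mul_inverse_cancel _ (spectrum.notMem_iff.1 fun h => absurd (hT w h) (not_lt.2 hw))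
  have hconst : ∀ R, r ≤ R → (∮ w in C(c, R), f w) = ∮ w in C(c, r), f w := by
    intro R hR
    have h := Complex.circleIntegral_sub_center_inv_smul_eq_of_differentiable_on_annulus_off_countable
      hr hR (Set.countable_empty) (f := fun w => (w - c) • f w) (c := c) (fun w hw => by
        have : r ≤ dist w c := by simpa using hw.2
        exact ((by fun_prop : DifferentiableAt ℂ (fun w => w - c) w).smul
          (hdiff w this)).continuousAt.continuousWithinAt) (fun w hw => by
        have : r ≤ dist w c := by
          have := hw.1.2; simp at this; exact this.le
        exact (by fun_prop : DifferentiableAt ℂ (fun w => w - c) w).smul (hdiff w this))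
    have e : ∀ ρ, r ≤ ρ → (∮ w in C(c, ρ), (w - c)⁻¹ • (w - c) • f w) = ∮ w in C(c, ρ), f w := by
      intro ρ hρ
      refine circleIntegral.integral_congr (hr.le.trans hρ) fun w hw => ?_
      have h0 : w - c ≠ 0 := by
        intro h0
        rw [mem_sphere, dist_eq_norm, h0, norm_zero] at hw
        linarith
      simp only [smul_smul, inv_mul_cancel₀ h0, one_smul]
    rwa [e R hR, e r le_rfl] at h
  have hbig : ∀ R, r ≤ R → 2 * N ≤ R → ‖(∮ w in C(c, r), f w) - (2 * Real.pi * Complex.I : ℂ) • (1 : A)‖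
      ≤ 2 * Real.pi * (2 * N * ‖(1 : A)‖) * R⁻¹ := by
    intro R hR hNR
    have hR0 : 0 < R := hr.trans_le hR
    have h1 : (∮ w in C(c, R), (w - c)⁻¹ • (1 : A)) = (2 * Real.pi * Complex.I : ℂ) • (1 : A) := by
      rw [circleIntegral.integral_smul_const, circleIntegral.integral_sub_center_inv c hR0.ne']
    have hne : ∀ w ∈ sphere c R, w - c ≠ 0 := fun w hw h0 => by
      rw [mem_sphere, dist_eq_norm, h0, norm_zero] at hw
      linarith
    have hrw : ∀ w ∈ sphere c R, r ≤ dist w c := fun w hw => by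
      rw [mem_sphere.1 hw]; exact hR
    have hcf : ContinuousOn f (sphere c R) := fun w hw =>
      (hdiff w (hrw w hw)).continuousAt.continuousWithinAt
    have hcg : ContinuousOn (fun w => (w - c)⁻¹ • (1 : A)) (sphere c R) := fun w hw =>
      (((by fun_prop : ContinuousAt (fun w => w - c) w).inv₀ (hne w hw)).smul
        continuousAt_const).continuousWithinAt
    rw [← hconst R hR, ← h1, ← circleIntegral.integral_sub (hcf.circleIntegrable hR0.le)
      (hcg.circleIntegrable hR0.le)]
    have h2 : 2 * Real.pi * (2 * N * ‖(1 : A)‖) * R⁻¹ =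
        2 * Real.pi * R * (R⁻¹ * N * (2 * R⁻¹ * ‖(1 : A)‖)) := by
      field_simp
    rw [h2]
    refine circleIntegral.norm_integral_le_of_norm_le_const hR0.le fun w hw => ?_
    have hwR : ‖w - c‖ = R := by rw [← dist_eq_norm]; exact hw
    have h3 : f w = (w - c)⁻¹ • (1 : A) + (w - c)⁻¹ • ((T - algebraMap ℂ A c) * f w) := by
      rw [← smul_add]
      rw [eq_inv_smul_iff₀ (hne w hw)]
      have := hmul w (hrw w hw)
      rw [← this, ← add_mul, Algebra.smul_def, map_sub]
      congr 1; abel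
    have h4 : ‖f w‖ ≤ 2 * R⁻¹ * ‖(1 : A)‖ := by
      have h5 : ‖f w‖ ≤ R⁻¹ * ‖(1 : A)‖ + R⁻¹ * (N * ‖f w‖) := by
        conv_lhs => rw [h3]
        refine (norm_add_le _ _).trans ?_
        rw [norm_smul, norm_smul, norm_inv, hwR]
        gcongr
        exact norm_mul_le _ _
      have h6 : R⁻¹ * (N * ‖f w‖) ≤ 2⁻¹ * ‖f w‖ := by
        rw [← mul_assoc]
        gcongr
        rw [inv_mul_le_iff₀ hR0]; linarith
      linarith
    rw [show f w - (w - c)⁻¹ • (1 : A) = (w - c)⁻¹ • ((T - algebraMap ℂ A c) * f w) by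
      conv_lhs => rw [h3]
      abel]
    rw [norm_smul, norm_inv, hwR, mul_assoc]
    gcongr
    exact (norm_mul_le _ _).trans (by gcongr)
  have hlim : Tendsto (fun R : ℝ => 2 * Real.pi * (2 * N * ‖(1 : A)‖) * R⁻¹) atTop (𝓝 0) := by
    simpa using tendsto_inv_atTop_zero.const_mul (2 * Real.pi * (2 * N * ‖(1 : A)‖))
  have := ge_of_tendsto hlim (by
    filter_upwards [eventually_ge_atTop r, eventually_ge_atTop (2 * N)] with R h1 h2
    exact hbig R h1 h2)
  exact sub_eq_zero.1 (norm_le_zero_iff.1 this)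

variable {V : Type*} [NormedAddCommGroup V] [NormedSpace ℂ V] [CompleteSpace V]

lemma norm_pow_apply_le_of_circleIntegral_eq {B : V →L[ℂ] V} {c : ℂ} {r : ℝ} (hr : 0 < r)
    (hB : ∀ w ∈ sphere c r, w ∉ spectrum ℂ B) {x : V}
    (hx : (∮ w in C(c, r), Ring.inverse (algebraMap ℂ _ w - B) x) = (2 * Real.pi * Complex.I : ℂ) • x) :
    ∃ C : ℝ, ∀ n : ℕ, ‖((B - algebraMap ℂ _ c) ^ n) x‖ ≤ C * r ^ n := by
  set f : ℂ → V := fun w => Ring.inverse (algebraMap ℂ (V →L[ℂ] V) w - B) x with hf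
  have hcf : ContinuousOn f (sphere c r) := fun w hw =>
    ((differentiableAt_inverse_sub (hB w hw)).continuousAt.clm_apply
      continuousAt_const).continuousWithinAt
  have hcn : ∀ n : ℕ, ContinuousOn (fun w => (w - c) ^ n • f w) (sphere c r) := fun n =>
    ContinuousOn.smul (by fun_prop) hcf
  have hmul : ∀ w ∈ sphere c r, (algebraMap ℂ (V →L[ℂ] V) w - B) (f w) = x := fun w hw => by
    rw [hf, ← mul_apply_eq_comp, Ring.mul_inverse_cancel _ (spectrum.notMem_iff.1 (hB w hw))]; rfl
  have hint : ∀ n : ℕ, (2 * Real.pi * Complex.I : ℂ) • ((B - algebraMap ℂ _ c) ^ n) x =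
      ∮ w in C(c, r), (w - c) ^ n • f w := by
    intro n
    induction n with
    | zero => simpa using hx.symm
    | succ n ih =>
      have h1 : (∮ w in C(c, r), (w - c) ^ n • x) = 0 := by
        rw [circleIntegral.integral_smul_const]
        have := circleIntegral.integral_sub_zpow_of_ne (n := (n : ℤ)) (by lia) c c r
        simp only [zpow_natCast] at this
        rw [this, zero_smul]
      have h2 : (B - algebraMap ℂ (V →L[ℂ] V) c) (∮ w in C(c, r), (w - c) ^ n • f w) =
          ∮ w in C(c, r), (B - algebraMap ℂ (V →L[ℂ] V) c) ((w - c) ^ n • f w) := by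
        simp only [circleIntegral]
        rw [← ContinuousLinearMap.intervalIntegral_comp_comm]
        · simp only [map_smul]
        · exact ((hcn n).circleIntegrable hr.le).out
      rw [pow_succ', mul_apply_eq_comp, ← map_smul, ih, h2]
      have h3 : (∮ w in C(c, r), (w - c) ^ (n + 1) • f w) = ∮ w in C(c, r),
          ((B - algebraMap ℂ (V →L[ℂ] V) c) ((w - c) ^ n • f w) + (w - c) ^ n • x) := by
        refine circleIntegral.integral_congr hr.le fun w hw => ?_
        have h4 : (B - algebraMap ℂ (V →L[ℂ] V) c) (f w) + x = (w - c) • f w := by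
          have h5 := hmul w hw
          simp only [sub_apply, Algebra.algebraMap_eq_smul_one, smul_apply,
            one_apply_eq_self] at h5 ⊢
          rw [← h5, sub_smul]
          abel
        simp only [map_smul]
        rw [← smul_add, h4, smul_smul, pow_succ]
      rw [h3, circleIntegral.integral_add, h1, add_zero]
      · exact (ContinuousOn.circleIntegrable hr.le
          ((B - algebraMap ℂ (V →L[ℂ] V) c).continuous.comp_continuousOn (hcn n)))
      · exact (ContinuousOn.circleIntegrable hr.le (by fun_prop))
  obtain ⟨M, hM⟩ := (isCompact_sphere c r).exists_bound_of_continuousOn hcf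
  refine ⟨r * M, fun n => ?_⟩
  have h1 : ((B - algebraMap ℂ _ c) ^ n) x =
      (2 * Real.pi * Complex.I : ℂ)⁻¹ • ∮ w in C(c, r), (w - c) ^ n • f w := by
    rw [← hint n, smul_smul, inv_mul_cancel₀ Complex.two_pi_I_ne_zero, one_smul]
  rw [h1]
  refine (circleIntegral.norm_two_pi_i_inv_smul_integral_le_of_norm_le_const hr.le
    (C := r ^ n * M) fun w hw => ?_).trans_eq (by ring)
  rw [norm_smul, norm_pow, ← dist_eq_norm, mem_sphere.1 hw]
  gcongr
  exact hM w hw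

/-- If `L` intertwines `B` with an operator whose spectrum lies in a disc and `L` is injective on a
closed `B`-invariant subspace, then `B - c` decays on this subspace. -/
lemma norm_pow_apply_le_of_intertwining {B B₀ L : V →L[ℂ] V} {c : ℂ} {r : ℝ} (hr : 0 < r)
    (hBc : (spectrum ℂ B).Countable) (hB : ∀ w ∈ sphere c r, w ∉ spectrum ℂ B)
    (hB₀ : ∀ z ∈ spectrum ℂ B₀, dist z c < r) (hL : L * B = B₀ * L) {Q : Submodule ℂ V}
    (hQ : IsClosed (Q : Set V)) (hQB : ∀ q ∈ Q, B q ∈ Q) (hQL : ∀ q ∈ Q, L q = 0 → q = 0)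
    {q : V} (hq : q ∈ Q) :
    ∃ C : ℝ, ∀ n : ℕ, ‖((B - algebraMap ℂ _ c) ^ n) q‖ ≤ C * r ^ n := by
  refine norm_pow_apply_le_of_circleIntegral_eq hr hB ?_
  let S : Subalgebra ℂ (V →L[ℂ] V) :=
    { carrier := {T | ∀ q ∈ Q, T q ∈ Q}
      mul_mem' := fun {S T} hS hT q hq => hS _ (hT q hq)
      add_mem' := fun {S T} hS hT q hq => add_mem (hS q hq) (hT q hq)
      algebraMap_mem' := fun t q hq => by
        simpa [Algebra.algebraMap_eq_smul_one] using Q.smul_mem t hq }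
  have hS : IsClosed (S : Set (V →L[ℂ] V)) := by
    have : (S : Set (V →L[ℂ] V)) = ⋂ q ∈ Q, (fun T : V →L[ℂ] V => T q) ⁻¹' Q := by
      ext T; simp only [Set.mem_iInter]; rfl
    rw [this]
    exact isClosed_biInter fun q _ => hQ.preimage (by fun_prop)
  have hSc : CompleteSpace Q := hQ.completeSpace_coe
  have hmem : ∀ w ∈ sphere c r, Ring.inverse (algebraMap ℂ _ w - B) q ∈ Q := by
    intro w hw
    have hu := spectrum.notMem_iff.1 (hB w hw)
    refine Subalgebra.inverse_mem_of_countable_spectrum S hS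
      (x := algebraMap ℂ _ w - B) (sub_mem (S.algebraMap_mem w) hQB) ?_
      (Ring.inverse_mul_cancel _ hu) (Ring.mul_inverse_cancel _ hu) q hq
    rw [← spectrum.singleton_sub_eq]
    exact (Set.countable_singleton w).image2 hBc _
  set f : ℂ → V := fun w => Ring.inverse (algebraMap ℂ (V →L[ℂ] V) w - B) q with hf
  have hcf : ContinuousOn f (sphere c r) := fun w hw =>
    ((differentiableAt_inverse_sub (hB w hw)).continuousAt.clm_apply
      continuousAt_const).continuousWithinAt
  have hint : (∮ w in C(c, r), f w) ∈ Q := by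
    have h0 : ∀ θ : ℝ, circleMap c r θ ∈ sphere c r := circleMap_mem_sphere c hr.le
    have h1 : Continuous fun θ : ℝ => f (circleMap c r θ) :=
      hcf.comp_continuous (continuous_circleMap c r) h0
    let g : ℝ → Q := fun θ => deriv (circleMap c r) θ • ⟨f (circleMap c r θ), hmem _ (h0 θ)⟩
    have hg : Continuous g := by
      have h2 : Continuous fun θ : ℝ => (⟨f (circleMap c r θ), hmem _ (h0 θ)⟩ : Q) :=
        h1.subtype_mk _
      have h3 : Continuous fun θ : ℝ => deriv (circleMap c r) θ := by
        simp only [deriv_circleMap]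
        fun_prop
      exact h3.smul h2
    have h2 := Q.subtypeL.intervalIntegral_comp_comm (μ := MeasureTheory.volume)
      (hg.intervalIntegrable 0 (2 * Real.pi))
    have h3 : (∮ w in C(c, r), f w) = ∫ θ in 0..2 * Real.pi, Q.subtypeL (g θ) := rfl
    rw [h3, h2]
    exact Subtype.prop _
  refine (sub_eq_zero.1 (hQL _ (Q.sub_mem hint (Q.smul_mem _ hq)) ?_))
  rw [map_sub, map_smul]
  have h2 : L (∮ w in C(c, r), f w) = ∮ w in C(c, r), L (f w) := by
    simp only [circleIntegral]
    rw [← ContinuousLinearMap.intervalIntegral_comp_comm]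
    · simp only [map_smul]
    · exact (hcf.circleIntegrable hr.le).out
  have h3 : (∮ w in C(c, r), L (f w)) =
      ∮ w in C(c, r), Ring.inverse (algebraMap ℂ (V →L[ℂ] V) w - B₀) (L q) := by
    refine circleIntegral.integral_congr hr.le fun w hw => ?_
    have hu := spectrum.notMem_iff.1 (hB w hw)
    have hu₀ : IsUnit (algebraMap ℂ (V →L[ℂ] V) w - B₀) := spectrum.notMem_iff.1 fun h =>
      (hB₀ w h).ne hw
    have h4 : Ring.inverse (algebraMap ℂ (V →L[ℂ] V) w - B₀) * L =
        L * Ring.inverse (algebraMap ℂ (V →L[ℂ] V) w - B) := by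
      have h5 : L * (algebraMap ℂ (V →L[ℂ] V) w - B) = (algebraMap ℂ (V →L[ℂ] V) w - B₀) * L := by
        rw [mul_sub, sub_mul, hL, Algebra.commutes]
      calc _ = Ring.inverse (algebraMap ℂ (V →L[ℂ] V) w - B₀) *
            (L * (algebraMap ℂ (V →L[ℂ] V) w - B)) * Ring.inverse (algebraMap ℂ (V →L[ℂ] V) w - B) := by
            rw [mul_assoc, mul_assoc, Ring.mul_inverse_cancel _ hu, mul_one]
        _ = _ := by rw [h5, ← mul_assoc, Ring.inverse_mul_cancel _ hu₀, one_mul]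
    exact (DFunLike.congr_fun h4 q).symm
  have h6 := circleIntegral_inverse_sub_eq hr hB₀
  have h7 : (∮ w in C(c, r), Ring.inverse (algebraMap ℂ (V →L[ℂ] V) w - B₀) (L q)) =
      (∮ w in C(c, r), Ring.inverse (algebraMap ℂ (V →L[ℂ] V) w - B₀)) (L q) := by
    simp only [circleIntegral]
    rw [ContinuousLinearMap.intervalIntegral_apply]
    · simp
    · have : ContinuousOn (fun w => Ring.inverse (algebraMap ℂ (V →L[ℂ] V) w - B₀))
          (sphere c r) := fun w hw => (differentiableAt_inverse_sub fun h =>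
            (hB₀ w h).ne hw).continuousAt.continuousWithinAt
      exact (this.circleIntegrable hr.le).out
  rw [h2, h3, h7, h6]
  simp

end LocalDecay

section QuasinilpotentIdeal

open Filter Topology Metric

variable {Y : Type*} [NormedAddCommGroup Y] [NormedSpace ℂ Y]

lemma spectrum_mulLeft_subset {A : Type*} [NormedRing A] [NormedAlgebra ℂ A] (a : A) :
    spectrum ℂ (ContinuousLinearMap.mul ℂ A a) ⊆ spectrum ℂ a := by
  intro z hz
  contrapose! hz
  rw [spectrum.notMem_iff] at hz ⊢
  obtain ⟨u, hu⟩ := hz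
  refine ⟨⟨ContinuousLinearMap.mul ℂ A u, ContinuousLinearMap.mul ℂ A (↑u⁻¹ : A), ?_, ?_⟩, ?_⟩
  · ext x; simp
  · ext x; simp
  · ext x; simp [hu, Algebra.algebraMap_eq_smul_one]

lemma spectrum_mulRight_subset {A : Type*} [NormedRing A] [NormedAlgebra ℂ A] (a : A) :
    spectrum ℂ ((ContinuousLinearMap.mul ℂ A).flip a) ⊆ spectrum ℂ a := by
  intro z hz
  contrapose! hz
  rw [spectrum.notMem_iff] at hz ⊢
  obtain ⟨u, hu⟩ := hz
  refine ⟨⟨(ContinuousLinearMap.mul ℂ A).flip u, (ContinuousLinearMap.mul ℂ A).flip (↑u⁻¹ : A),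
    ?_, ?_⟩, ?_⟩
  · ext x; simp
  · ext x; simp
  · ext x; simp [hu, Algebra.algebraMap_eq_smul_one]

/-- The operator `x ↦ a * x * b`. -/
noncomputable def twoSidedMul {A : Type*} [NormedRing A] [NormedAlgebra ℂ A] (a b : A) :
    A →L[ℂ] A :=
  ContinuousLinearMap.mul ℂ A a * (ContinuousLinearMap.mul ℂ A).flip b

lemma twoSidedMul_apply {A : Type*} [NormedRing A] [NormedAlgebra ℂ A] (a b x : A) :
    twoSidedMul a b x = a * x * b := by
  simp [twoSidedMul, mul_assoc]

lemma exists_mul_of_mem_spectrum_twoSidedMul {A : Type*} [NormedRing A] [NormedAlgebra ℂ A]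
    [CompleteSpace A] {a b : A} (ha : (spectrum ℂ a).Countable) (hb : (spectrum ℂ b).Countable)
    {ν : ℂ} (hν : ν ∈ spectrum ℂ (twoSidedMul a b)) :
    ∃ α ∈ spectrum ℂ a, ∃ β ∈ spectrum ℂ b, ν = α * β := by
  obtain ⟨α, hα, β, hβ, h⟩ := spectrum.exists_mul_of_mem_mul (by ext x; simp [mul_assoc])
    (ha.mono (spectrum_mulLeft_subset a)) (hb.mono (spectrum_mulRight_subset b)) hν
  exact ⟨α, spectrum_mulLeft_subset a hα, β, spectrum_mulRight_subset b hβ, h⟩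

variable [CompleteSpace Y]

theorem exists_norm_twoSidedMul_pow_le {K K' : Y →L[ℂ] Y} (hK : IsCompactOperator K)
    (hK' : IsCompactOperator K') (ζ : ℂ) {Q : Submodule ℂ (Y →L[ℂ] Y)}
    (hQ : IsClosed (Q : Set (Y →L[ℂ] Y)))
    (hinv : ∀ q ∈ Q, (algebraMap ℂ _ ζ + K) * q * (algebraMap ℂ _ ζ + K') ∈ Q)
    (hfin : ∀ q ∈ Q, FiniteDimensional ℂ (LinearMap.range (q : Y →ₗ[ℂ] Y)) → q = 0)
    {ε : ℝ} (hε : 0 < ε) {q : Y →L[ℂ] Y} (hq : q ∈ Q) :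
    ∃ r C : ℝ, 0 < r ∧ r < ε ∧ ∀ n : ℕ, ‖((twoSidedMul (algebraMap ℂ _ ζ + K)
      (algebraMap ℂ _ ζ + K') - algebraMap ℂ _ (ζ ^ 2)) ^ n) q‖ ≤ C * r ^ n := by
  have hcount : (spectrum ℂ (twoSidedMul (algebraMap ℂ (Y →L[ℂ] Y) ζ + K)
      (algebraMap ℂ _ ζ + K'))).Countable := by
    refine (((hK.countable_spectrum_algebraMap_add ζ).prod
      (hK'.countable_spectrum_algebraMap_add ζ)).image fun p => p.1 * p.2).mono fun ν hν => ?_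
    obtain ⟨α, hα, β, hβ, rfl⟩ := exists_mul_of_mem_spectrum_twoSidedMul
      (hK.countable_spectrum_algebraMap_add ζ) (hK'.countable_spectrum_algebraMap_add ζ) hν
    exact ⟨(α, β), ⟨hα, hβ⟩, rfl⟩
  obtain ⟨r, hr0, hrε, hr⟩ := hcount.exists_sphere_disjoint (ζ ^ 2) hε
  obtain ⟨δ, hδ0, hδ⟩ : ∃ δ : ℝ, 0 < δ ∧ δ * (2 * ‖ζ‖ + δ) < r := by
    have h1 : Tendsto (fun δ : ℝ => δ * (2 * ‖ζ‖ + δ)) (𝓝[>] 0) (𝓝 0) := by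
      have : ContinuousAt (fun δ : ℝ => δ * (2 * ‖ζ‖ + δ)) 0 := by fun_prop
      simpa using this.tendsto.mono_left nhdsWithin_le_nhds
    obtain ⟨δ, h2, h3⟩ := ((h1.eventually_lt_const hr0).and self_mem_nhdsWithin).exists
    exact ⟨δ, h3, h2⟩
  obtain ⟨F, hFF, hFf, hFc, hFs⟩ := hK.exists_projection_spectrum_norm_lt hδ0
  obtain ⟨F', hFF', hFf', hFc', hFs'⟩ := hK'.exists_projection_spectrum_norm_lt hδ0
  have hKF := hFc K rfl
  have hKF' := hFc' K' rfl
  have hspec : ∀ {T : Y →L[ℂ] Y}, (∀ z ∈ spectrum ℂ T, ‖z‖ < δ) →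
      ∀ z ∈ spectrum ℂ (algebraMap ℂ _ ζ + T), ‖z - ζ‖ < δ := by
    intro T hT z hz
    rw [← spectrum.singleton_add_eq] at hz
    obtain ⟨_, rfl, w, hw, rfl⟩ := hz
    simpa using hT w hw
  suffices H : ∃ C : ℝ, ∀ n : ℕ, ‖((twoSidedMul (algebraMap ℂ _ ζ + K)
      (algebraMap ℂ _ ζ + K') - algebraMap ℂ _ (ζ ^ 2)) ^ n) q‖ ≤ C * r ^ n from
    H.elim fun C hC => ⟨r, C, hr0, hrε, hC⟩
  refine norm_pow_apply_le_of_intertwining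
    (B₀ := twoSidedMul (algebraMap ℂ _ ζ + K * (1 - F)) (algebraMap ℂ _ ζ + K' * (1 - F')))
    (L := twoSidedMul (1 - F) (1 - F')) hr0 hcount hr ?_ ?_ hQ ?_ ?_ hq
  · intro z hz
    obtain ⟨α, hα, β, hβ, rfl⟩ := exists_mul_of_mem_spectrum_twoSidedMul
      ((hK.mul_right (1 - F)).countable_spectrum_algebraMap_add ζ)
      ((hK'.mul_right (1 - F')).countable_spectrum_algebraMap_add ζ) hz
    have h1 := hspec hFs α hα
    have h2 := hspec hFs' β hβ
    rw [dist_eq_norm, show α * β - ζ ^ 2 = ζ * (β - ζ) + (α - ζ) * ζ + (α - ζ) * (β - ζ) by ring]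
    refine lt_of_le_of_lt ?_ hδ
    calc _ ≤ ‖ζ‖ * ‖β - ζ‖ + ‖α - ζ‖ * ‖ζ‖ + ‖α - ζ‖ * ‖β - ζ‖ := by
          rw [← norm_mul, ← norm_mul, ← norm_mul]; exact norm_add₃_le
      _ ≤ ‖ζ‖ * δ + δ * ‖ζ‖ + δ * δ := by gcongr
      _ = _ := by ring
  · ext1 x
    simp only [mul_apply_eq_comp, twoSidedMul_apply]
    have h1 : (1 - F) * (algebraMap ℂ (Y →L[ℂ] Y) ζ + K) =
        (algebraMap ℂ _ ζ + K * (1 - F)) * (1 - F) := by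
      have e : (1 - F) * (1 - F) = 1 - F := by rw [mul_sub, mul_one, sub_mul, hFF]; simp
      rw [mul_add, add_mul, mul_assoc, e, Algebra.commutes]
      congr 1
      rw [sub_mul, mul_sub, ← hKF, one_mul, mul_one]
    have h2 : (algebraMap ℂ (Y →L[ℂ] Y) ζ + K') * (1 - F') =
        (1 - F') * (algebraMap ℂ _ ζ + K' * (1 - F')) := by
      have e : (1 - F') * (K' * (1 - F')) = K' * (1 - F') := by
        rw [sub_mul, ← mul_assoc F', ← hKF', mul_assoc K' F', mul_sub F', hFF']; simp
      rw [mul_add, add_mul, e, Algebra.commutes]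
    rw [← mul_assoc, ← mul_assoc, h1, mul_assoc _ _ (1 - F'), h2]
    simp only [mul_assoc]
  · intro q hq
    rw [twoSidedMul_apply]; exact hinv q hq
  · intro q hq h
    rw [twoSidedMul_apply] at h
    refine hfin q hq ?_
    have h1 : q = F * q + (1 - F) * q * F' := by
      have : (1 - F) * q * (1 - F') = q - F * q - (1 - F) * q * F' := by noncomm_ring
      rw [this] at h
      rw [sub_sub, sub_eq_zero] at h
      exact h
    have h2 : LinearMap.range (q : Y →ₗ[ℂ] Y) ≤ LinearMap.range (F : Y →ₗ[ℂ] Y) ⊔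
        (LinearMap.range (F' : Y →ₗ[ℂ] Y)).map (((1 - F) * q : Y →L[ℂ] Y) : Y →ₗ[ℂ] Y) := by
      rintro _ ⟨y, rfl⟩
      have h3 : q y = F (q y) + ((1 - F) * q) (F' y) := by
        conv_lhs => rw [h1]
        rfl
      exact h3 ▸ Submodule.add_mem_sup ⟨q y, rfl⟩ ⟨F' y, ⟨y, rfl⟩, rfl⟩
    exact Submodule.finiteDimensional_of_le h2

theorem mul_riesz_projection_eq_zero {K K' : Y →L[ℂ] Y} (hK : IsCompactOperator K)
    (hK' : IsCompactOperator K') {ζ l μ : ℂ} {Q : Submodule ℂ (Y →L[ℂ] Y)}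
    (hQ : IsClosed (Q : Set (Y →L[ℂ] Y)))
    (hinv : ∀ q ∈ Q, (algebraMap ℂ _ ζ + K') * q * (algebraMap ℂ _ ζ + K) ∈ Q)
    (hfin : ∀ q ∈ Q, FiniteDimensional ℂ (LinearMap.range (q : Y →ₗ[ℂ] Y)) → q = 0)
    (hl : l ≠ 0) (hlμ : l * μ = ζ ^ 2)
    {E E' S' : Y →L[ℂ] Y} {m : ℕ}
    (hE : (K - algebraMap ℂ _ (l - ζ)) ^ m * E = 0) (hEK : K' * E' = E' * K')
    (hE' : E' * E' = E')
    (hS' : S' * (K' - algebraMap ℂ _ (μ - ζ)) = 1 - E') {q : Y →L[ℂ] Y} (hq : q ∈ Q) :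
    (1 - E') * q * E = 0 := by
  set T := K - algebraMap ℂ (Y →L[ℂ] Y) (l - ζ) with hT
  set g := algebraMap ℂ (Y →L[ℂ] Y) ζ + K with hg
  set g' := algebraMap ℂ (Y →L[ℂ] Y) ζ + K' with hg'
  have key : ∀ (j : ℕ) (v : Y), (T ^ j) v = 0 → ∀ q ∈ Q, ((1 - E') * q) v = 0 := by
    intro j
    induction j with
    | zero => intro v hv q _; simp at hv; simp [hv]
    | succ j ih =>
      intro v hv q hq
      have hv' : ∀ q ∈ Q, ((1 - E') * q) (T v) = 0 := fun q hq => ih _ (by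
        rw [← mul_apply_eq_comp, ← pow_succ]; exact hv) q hq
      set U := twoSidedMul g' g - algebraMap ℂ _ (ζ ^ 2) with hU
      have hUq : ∀ q ∈ Q, U q ∈ Q := fun q hq => by
        rw [hU, sub_apply, twoSidedMul_apply, Algebra.algebraMap_eq_smul_one]
        exact Q.sub_mem (hinv q hq) (Q.smul_mem _ hq)
      have hstep : ∀ q ∈ Q, ((1 - E') * q) v = (l⁻¹ • S') (((1 - E') * U q) v) := by
        intro q hq
        have e1 : g v = l • v + T v := by
          simp [hg, hT, Algebra.algebraMap_eq_smul_one, sub_smul]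
          abel
        have e2 : (1 - E') * g' = g' * (1 - E') := by
          rw [hg', sub_mul, mul_sub, mul_add E', add_mul _ _ E', hEK, Algebra.commutes, one_mul, mul_one]
        have e3 : ((1 - E') * U q) v = l • ((K' - algebraMap ℂ _ (μ - ζ)) (((1 - E') * q) v)) := by
          have e4 : ((1 - E') * (g' * q * g)) v = l • g' (((1 - E') * q) v) := by
            have : (1 - E') * (g' * q * g) = g' * ((1 - E') * q) * g := by
              simp only [← mul_assoc, e2]
            rw [this, mul_apply_eq_comp, mul_apply_eq_comp, e1, map_add, hv' q hq, map_smul,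
              add_zero, map_smul]
          have e5 : U q = g' * q * g - (ζ ^ 2) • q := by
            rw [hU, sub_apply, twoSidedMul_apply, Algebra.algebraMap_eq_smul_one]; rfl
          rw [e5, mul_sub, sub_apply, e4, ← hlμ, mul_smul_comm, smul_apply, mul_smul, ← smul_sub]
          congr 1
          simp [hg', Algebra.algebraMap_eq_smul_one, sub_smul]
          abel
        rw [e3, smul_apply, map_smul, smul_smul, inv_mul_cancel₀ hl, one_smul,
          ← mul_apply_eq_comp, ← mul_apply_eq_comp, hS', ← mul_assoc]
        have : (1 - E') * (1 - E') = 1 - E' := by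
          rw [mul_sub, mul_one, sub_mul, hE']; simp
        rw [this]
      have hiter : ∀ n : ℕ, (U ^ n) q ∈ Q ∧
          ((1 - E') * q) v = ((l⁻¹ • S') ^ n) (((1 - E') * (U ^ n) q) v) := by
        intro n
        induction n with
        | zero => simpa using hq
        | succ n ihn =>
          rw [pow_succ', pow_succ, mul_apply_eq_comp, mul_apply_eq_comp]
          refine ⟨hUq _ ihn.1, ?_⟩
          rw [mul_apply_eq_comp ((l⁻¹ • S') ^ n), ← hstep _ ihn.1]; exact ihn.2
      have hb : 0 < (‖l⁻¹ • S'‖ + 1)⁻¹ := by positivity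
      obtain ⟨r, C, hr0, hrε, hC⟩ := exists_norm_twoSidedMul_pow_le hK' hK ζ hQ hinv hfin hb hq
      have hr1 : ‖l⁻¹ • S'‖ * r < 1 := by
        have h1 : r * (‖l⁻¹ • S'‖ + 1) < 1 := by
          rwa [← one_div, lt_div_iff₀ (by positivity)] at hrε
        nlinarith
      have hbound : ∀ n : ℕ, ‖((1 - E') * q) v‖ ≤
          (‖1 - E'‖ * C * ‖v‖) * (‖l⁻¹ • S'‖ * r) ^ n := by
        intro n
        rw [(hiter n).2]
        calc _ ≤ ‖(l⁻¹ • S') ^ n‖ * (‖(1 - E') * (U ^ n) q‖ * ‖v‖) :=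
              ((_ : Y →L[ℂ] Y).le_opNorm _).trans
                (mul_le_mul_of_nonneg_left ((_ : Y →L[ℂ] Y).le_opNorm _) (norm_nonneg _))
          _ ≤ ‖l⁻¹ • S'‖ ^ n * ((‖1 - E'‖ * (C * r ^ n)) * ‖v‖) := by
              rcases subsingleton_or_nontrivial Y with _ | _
              · have h0 : ‖v‖ = 0 := by rw [Subsingleton.elim v 0, norm_zero]
                simp [h0]
              · gcongr
                · exact norm_pow_le _ _
                · exact (norm_mul_le _ _).trans (by gcongr; exact hC n)
          _ = _ := by rw [mul_pow]; ring
      have hlim : Tendsto (fun n : ℕ => (‖1 - E'‖ * C * ‖v‖) * (‖l⁻¹ • S'‖ * r) ^ n) atTop (𝓝 0) := by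
        simpa using (tendsto_pow_atTop_nhds_zero_of_lt_one (by positivity) hr1).const_mul
          (‖1 - E'‖ * C * ‖v‖)
      exact norm_le_zero_iff.1 (ge_of_tendsto' hlim hbound)
  ext y
  exact key m (E y) (by rw [← mul_apply_eq_comp, hE]; rfl) q hq

end QuasinilpotentIdeal

section QuasinilpotentIdeal

open Filter Topology Metric

variable {Y : Type*} [NormedAddCommGroup Y] [NormedSpace ℂ Y]

lemma mem_spectrum_of_apply_eq_smul {a : Y →L[ℂ] Y} {μ : ℂ} {x : Y} (hx : x ≠ 0)
    (h : a x = μ • x) : μ ∈ spectrum ℂ a := by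
  intro hu
  obtain ⟨u, hu⟩ := hu
  apply hx
  have h1 : (u : Y →L[ℂ] Y) x = 0 := by
    rw [hu]; simp [Algebra.algebraMap_eq_smul_one, h]
  calc x = ((u⁻¹ : (Y →L[ℂ] Y)ˣ) * u : Y →L[ℂ] Y) x := by simp
    _ = 0 := by rw [mul_apply_eq_comp, h1, map_zero]

lemma exists_pow_apply_eq_zero_of_quasinilpotent {a : Y →L[ℂ] Y} (ha : spectrum ℂ a ⊆ {0})
    (W : Submodule ℂ Y) [FiniteDimensional ℂ W] (hW : ∀ w ∈ W, a w ∈ W) :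
    ∃ n : ℕ, ∀ w ∈ W, (a ^ n) w = 0 := by
  let f : Module.End ℂ W := (a : Y →ₗ[ℂ] Y).restrict hW
  have hf : ∀ (n : ℕ) (w : W), ((f ^ n) w : Y) = (a ^ n) w := by
    intro n
    induction n with
    | zero => simp
    | succ n ih =>
      intro w
      rw [pow_succ, pow_succ, Module.End.mul_apply, mul_apply_eq_comp, ih]
      rfl
  have h0 : ∀ μ : ℂ, μ ≠ 0 → f.maxGenEigenspace μ = ⊥ := by
    intro μ hμ
    by_contra h
    have h1 : f.HasEigenvalue μ := by
      by_contra h2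
      apply h
      rw [Module.End.maxGenEigenspace_eq_genEigenspace_finrank]
      by_contra h3
      exact h2 (Module.End.hasEigenvalue_of_hasGenEigenvalue h3)
    obtain ⟨v, hv⟩ := h1.exists_hasEigenvector
    refine hμ (ha (mem_spectrum_of_apply_eq_smul (x := (v : Y)) ?_ ?_))
    · simpa using hv.2
    · exact congrArg Subtype.val hv.apply_eq_smul
  have h1 := Module.End.iSup_maxGenEigenspace_eq_top f
  have h2 : f.maxGenEigenspace 0 = ⊤ := by
    rw [← h1]
    refine le_antisymm (le_iSup (fun μ => f.maxGenEigenspace μ) 0) (iSup_le fun μ => ?_)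
    by_cases hμ : μ = 0
    · rw [hμ]
    · rw [h0 μ hμ]; exact bot_le
  refine ⟨Module.finrank ℂ W, fun w hw => ?_⟩
  have h3 : (⟨w, hw⟩ : W) ∈ f.maxGenEigenspace 0 := h2 ▸ Submodule.mem_top
  rw [Module.End.maxGenEigenspace_eq_genEigenspace_finrank, Module.End.mem_genEigenspace_nat] at h3
  simp only [zero_smul, sub_zero, LinearMap.mem_ker] at h3
  rw [← hf _ ⟨w, hw⟩, h3]; rfl

lemma isNilpotent_of_finiteDimensional_range {a : Y →L[ℂ] Y} (ha : spectrum ℂ a ⊆ {0})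
    (hfin : FiniteDimensional ℂ (LinearMap.range (a : Y →ₗ[ℂ] Y))) : IsNilpotent a := by
  obtain ⟨n, hn⟩ := exists_pow_apply_eq_zero_of_quasinilpotent ha
    (LinearMap.range (a : Y →ₗ[ℂ] Y)) (fun w _ => ⟨w, rfl⟩)
  exact ⟨n + 1, ContinuousLinearMap.ext fun y => by
    rw [pow_succ, mul_apply_eq_comp]; exact hn _ ⟨y, rfl⟩⟩

/-- The finite rank operators in a subspace. -/
def finiteRankSubmodule (Q : Submodule ℂ (Y →L[ℂ] Y)) : Submodule ℂ (Y →L[ℂ] Y) where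
  carrier := {a | a ∈ Q ∧ FiniteDimensional ℂ (LinearMap.range (a : Y →ₗ[ℂ] Y))}
  zero_mem' := ⟨Q.zero_mem, by
    rw [show ((0 : Y →L[ℂ] Y) : Y →ₗ[ℂ] Y) = 0 from rfl, LinearMap.range_zero]; infer_instance⟩
  add_mem' := by
    rintro a b ⟨ha, ha'⟩ ⟨hb, hb'⟩
    exact ⟨Q.add_mem ha hb, Submodule.finiteDimensional_of_le
      (LinearMap.range_add_le (a : Y →ₗ[ℂ] Y) (b : Y →ₗ[ℂ] Y))⟩
  smul_mem' := by
    rintro c a ⟨ha, ha'⟩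
    refine ⟨Q.smul_mem c ha, Submodule.finiteDimensional_of_le
      (S₂ := LinearMap.range (a : Y →ₗ[ℂ] Y)) ?_⟩
    rintro _ ⟨y, rfl⟩
    exact ⟨c • y, by simp⟩

lemma isReducible_of_apply_eq_zero {J Q : Submodule ℂ (Y →L[ℂ] Y)}
    (hideal : ∀ b ∈ J, ∀ q ∈ Q, b * q + q * b ∈ Q) (hQ0 : Q ≠ ⊥) {w : Y} (hw : w ≠ 0)
    (hQw : ∀ q ∈ Q, q w = 0) : IsReducible (J : Set (Y →L[ℂ] Y)) := by
  let M : Submodule ℂ Y := ⨅ q ∈ Q, LinearMap.ker (q : Y →ₗ[ℂ] Y)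
  have hM : ∀ y, y ∈ M ↔ ∀ q ∈ Q, q y = 0 := fun y => by simp [M, Submodule.mem_iInf]
  refine ⟨M, ?_, ?_, ?_, ?_⟩
  · have : (M : Set Y) = ⋂ q ∈ Q, (LinearMap.ker (q : Y →ₗ[ℂ] Y) : Set Y) := by
      ext y; simp only [SetLike.mem_coe, hM, Set.mem_iInter]; rfl
    rw [this]
    exact isClosed_biInter fun q _ => q.isClosed_ker
  · exact fun h => hw ((Submodule.mem_bot ℂ).1 (h ▸ (hM w).2 hQw))
  · intro h
    refine hQ0 ((Submodule.eq_bot_iff _).2 fun q hq => ContinuousLinearMap.ext fun y => ?_)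
    exact (hM y).1 (h ▸ Submodule.mem_top) q hq
  · intro b hb y hy
    rw [hM] at hy ⊢
    intro q hq
    have h1 := hy _ (hideal b hb q hq)
    rw [add_apply, mul_apply_eq_comp, mul_apply_eq_comp, hy q hq, map_zero, zero_add] at h1
    exact h1

variable {J Q : Submodule ℂ (Y →L[ℂ] Y)}

lemma mul_mul_mem_of_jordan (hJ : ∀ a ∈ J, ∀ b ∈ J, a * b + b * a ∈ J)
    (hideal : ∀ b ∈ J, ∀ q ∈ Q, b * q + q * b ∈ Q) {b q : Y →L[ℂ] Y} (hb : b ∈ J) (hq : q ∈ Q) :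
    b * q * b ∈ Q := by
  have h1 : b * q * b = (2⁻¹ : ℂ) • (b * (b * q + q * b) + (b * q + q * b) * b -
      (2⁻¹ : ℂ) • ((b * b + b * b) * q + q * (b * b + b * b))) := by
    have : (2⁻¹ : ℂ) • ((b * b + b * b) * q + q * (b * b + b * b)) = b * b * q + q * (b * b) := by
      rw [← two_smul ℂ (b * b), smul_mul_assoc, mul_smul_comm, ← smul_add, smul_smul,
        inv_mul_cancel₀ two_ne_zero, one_smul]
    rw [this, eq_inv_smul_iff₀ two_ne_zero, two_smul]
    noncomm_ring
  rw [h1]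
  exact Q.smul_mem _ (Q.sub_mem (hideal b hb _ (hideal b hb q hq))
    (Q.smul_mem _ (hideal _ (hJ b hb b hb) q hq)))

lemma algebraMap_add_mul_mul_mem (hJ : ∀ a ∈ J, ∀ b ∈ J, a * b + b * a ∈ J)
    (hideal : ∀ b ∈ J, ∀ q ∈ Q, b * q + q * b ∈ Q) (z : ℂ) {b q : Y →L[ℂ] Y} (hb : b ∈ J)
    (hq : q ∈ Q) : (algebraMap ℂ _ z + b) * q * (algebraMap ℂ _ z + b) ∈ Q := by
  have h1 : (algebraMap ℂ _ z + b) * q * (algebraMap ℂ _ z + b) =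
      (z * z) • q + z • (b * q + q * b) + b * q * b := by
    simp only [Algebra.algebraMap_eq_smul_one, add_mul, mul_add, smul_mul_assoc, mul_smul_comm,
      one_mul, mul_one, smul_smul, smul_add]
    abel
  rw [h1]
  exact Q.add_mem (Q.add_mem (Q.smul_mem _ hq) (Q.smul_mem _ (hideal b hb q hq)))
    (mul_mul_mem_of_jordan hJ hideal hb hq)

lemma prod_map_mul_mul_mem (hJ : ∀ a ∈ J, ∀ b ∈ J, a * b + b * a ∈ J)
    (hideal : ∀ b ∈ J, ∀ q ∈ Q, b * q + q * b ∈ Q) (z : ℂ) (L : List (Y →L[ℂ] Y))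
    (hL : ∀ b ∈ L, b ∈ J) : ∀ q ∈ Q,
    (L.map (algebraMap ℂ _ z + ·)).prod * q * (L.reverse.map (algebraMap ℂ _ z + ·)).prod ∈ Q := by
  induction L with
  | nil => intro q hq; simpa using hq
  | cons b L ih =>
    intro q hq
    have h1 := algebraMap_add_mul_mul_mem hJ hideal z (hL b (by simp))
      (ih (fun c hc => hL c (by simp [hc])) q hq)
    simpa [mul_assoc] using h1

lemma prod_map_eq_algebraMap_add (hc : ∀ a ∈ J, IsCompactOperator a) (z : ℂ)
    (L : List (Y →L[ℂ] Y)) (hL : ∀ b ∈ L, b ∈ J) : ∃ K : Y →L[ℂ] Y, IsCompactOperator K ∧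
    (L.map (algebraMap ℂ _ z + ·)).prod = algebraMap ℂ _ (z ^ L.length) + K := by
  induction L with
  | nil => exact ⟨0, isCompactOperator_zero, by simp⟩
  | cons b L ih =>
    obtain ⟨K, hK, h⟩ := ih fun c hc => hL c (by simp [hc])
    refine ⟨algebraMap ℂ _ z * K + b * (algebraMap ℂ _ (z ^ L.length) + K),
      (hK.mul_left _).add ((hc b (hL b (by simp))).mul_right _), ?_⟩
    rw [List.map_cons, List.prod_cons, h, List.length_cons, pow_succ', map_mul]
    noncomm_ring

lemma isCompactOperator_list_prod (hc : ∀ a ∈ J, IsCompactOperator a) {L : List (Y →L[ℂ] Y)}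
    (hL : ∀ b ∈ L, b ∈ J) (hne : L ≠ []) : IsCompactOperator L.prod := by
  obtain ⟨b, L, rfl⟩ := List.exists_cons_of_ne_nil hne
  rw [List.prod_cons]
  exact (hc b (hL b (by simp))).mul_right _

variable [CompleteSpace Y]

lemma isReducible_of_mem_spectrum_list_prod (hJ : ∀ a ∈ J, ∀ b ∈ J, a * b + b * a ∈ J)
    (hc : ∀ a ∈ J, IsCompactOperator a) (hQJ : Q ≤ J)
    (hideal : ∀ b ∈ J, ∀ q ∈ Q, b * q + q * b ∈ Q) (hQcl : IsClosed (Q : Set (Y →L[ℂ] Y)))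
    (hqn : ∀ q ∈ Q, spectrum ℂ q ⊆ {0}) (hQ0 : Q ≠ ⊥)
    (hfin : ∀ q ∈ Q, FiniteDimensional ℂ (LinearMap.range (q : Y →ₗ[ℂ] Y)) → q = 0)
    {L : List (Y →L[ℂ] Y)} (hL : ∀ b ∈ L, b ∈ J) (hne : L ≠ []) {ν : ℂ}
    (hν : ν ∈ spectrum ℂ L.prod) (hν0 : ν ≠ 0) : IsReducible (J : Set (Y →L[ℂ] Y)) := by
  have hcont : ∀ L : List (Y →L[ℂ] Y), ContinuousAt
      (fun z : ℂ => (L.map (algebraMap ℂ (Y →L[ℂ] Y) z + ·)).prod) 0 := by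
    intro L
    induction L with
    | nil => simpa using continuousAt_const
    | cons b L ih =>
      simp only [List.map_cons, List.prod_cons, Algebra.algebraMap_eq_smul_one] at ih ⊢
      exact ContinuousAt.mul (by fun_prop) ih
  have hlim := hcont L
  have hlen : L.length ≠ 0 := fun h => hne (List.length_eq_zero_iff.1 h)
  have hpos : 0 < ‖ν‖ / 2 := by have := norm_pos_iff.2 hν0; positivity
  have hev := spectrum.eventually_exists_dist_lt
    (isCompactOperator_list_prod hc hL hne).countable_spectrum hν hpos
  unfold ContinuousAt at hlim
  simp only [map_zero, zero_add, List.map_id'] at hlim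
  have hsmall : ∀ᶠ z : ℂ in 𝓝 0, ‖z ^ L.length‖ < ‖ν‖ / 2 := by
    have : Tendsto (fun z : ℂ => ‖z ^ L.length‖) (𝓝 0) (𝓝 0) := by
      have h : ContinuousAt (fun z : ℂ => ‖z ^ L.length‖) 0 := by fun_prop
      simpa [ContinuousAt, hlen] using h
    exact this.eventually_lt_const hpos
  obtain ⟨z, hz0, ⟨l, hl, hlν⟩, hzs⟩ := (eventually_mem_nhdsWithin.and
    (((hlim.eventually hev).and hsmall).filter_mono nhdsWithin_le_nhds) :
      ∀ᶠ z in 𝓝[≠] (0 : ℂ), _).exists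
  set ζ := z ^ L.length with hζ
  have hζ0 : ζ ≠ 0 := pow_ne_zero _ hz0
  have hl2 : ‖ν‖ / 2 < ‖l‖ := by
    have := norm_sub_norm_le ν l
    rw [dist_comm, dist_eq_norm] at hlν
    linarith
  have hl0 : l ≠ 0 := fun h => by rw [h, norm_zero] at hl2; linarith
  have hlζ : l - ζ ≠ 0 := fun h => by rw [sub_eq_zero.1 h] at hl2; linarith
  have hLr : ∀ b ∈ L.reverse, b ∈ J := fun b hb => hL b (List.mem_reverse.1 hb)
  obtain ⟨K, hK, hKL⟩ := prod_map_eq_algebraMap_add hc z L hL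
  obtain ⟨K', hK', hKL'⟩ := prod_map_eq_algebraMap_add hc z L.reverse hLr
  rw [List.length_reverse] at hKL'
  have hinv : ∀ q ∈ Q, (algebraMap ℂ _ ζ + K) * q * (algebraMap ℂ _ ζ + K') ∈ Q := fun q hq => by
    rw [← hKL, ← hKL']; exact prod_map_mul_mul_mem hJ hideal z L hL q hq
  have hinv' : ∀ q ∈ Q, (algebraMap ℂ _ ζ + K') * q * (algebraMap ℂ _ ζ + K) ∈ Q := fun q hq => by
    rw [← hKL, ← hKL']
    simpa using prod_map_mul_mul_mem hJ hideal z L.reverse hLr q hq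
  set μ := ζ ^ 2 / l with hμ
  have hlμ : l * μ = ζ ^ 2 := by rw [hμ]; field_simp
  have hμ0 : μ ≠ 0 := div_ne_zero (pow_ne_zero _ hζ0) hl0
  have hμζ : μ - ζ ≠ 0 := fun h => by
    rw [sub_eq_zero.1 h, sq] at hlμ
    exact hlζ (sub_eq_zero.2 (mul_right_cancel₀ hζ0 hlμ))
  obtain ⟨E, S, m, hE1, hE2, hE3, hE4, hE5, -, -, -⟩ := hK.exists_riesz_projection hlζ
  obtain ⟨E', S', m', hE1', hE2', hE3', hE4', hE5', -, -, -⟩ := hK'.exists_riesz_projection hμζ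
  have h1 : ∀ q ∈ Q, (1 - E') * q * E = 0 := fun q hq =>
    mul_riesz_projection_eq_zero hK hK' hQcl hinv' hfin hl0 hlμ hE4 (hE3' K' rfl) hE1' hE5' hq
  have h2 : ∀ q ∈ Q, (1 - E) * q * E' = 0 := fun q hq =>
    mul_riesz_projection_eq_zero hK' hK hQcl hinv hfin hμ0 (by rw [mul_comm]; exact hlμ) hE4'
      (hE3 K rfl) hE1 hE5 hq
  have hmaps : ∀ {F G q : Y →L[ℂ] Y}, (1 - F) * q * G = 0 → ∀ y, q (G y) = F (q (G y)) := by
    intro F G q h y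
    have := DFunLike.congr_fun h y
    simpa [sub_eq_zero] using this
  let W := LinearMap.range (E : Y →ₗ[ℂ] Y) ⊔ LinearMap.range (E' : Y →ₗ[ℂ] Y)
  have hW : ∀ q ∈ Q, ∀ w ∈ W, q w ∈ W := by
    intro q hq w hw
    obtain ⟨_, ⟨y, rfl⟩, _, ⟨y', rfl⟩, rfl⟩ := Submodule.mem_sup.1 hw
    rw [map_add]
    refine W.add_mem (Submodule.mem_sup_right ⟨q (E y), ?_⟩) (Submodule.mem_sup_left ⟨q (E' y'), ?_⟩)
    · exact (hmaps (h1 q hq) y).symm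
    · exact (hmaps (h2 q hq) y').symm
  have hW0 : W ≠ ⊥ := by
    intro h
    have hE0 : E = 0 := by
      ext y
      have : E y ∈ W := Submodule.mem_sup_left ⟨y, rfl⟩
      rw [h] at this
      simpa using this
    have h3 : l - ζ ∈ spectrum ℂ K := by
      rw [hKL, ← spectrum.singleton_add_eq] at hl
      obtain ⟨_, rfl, w, hw, h4⟩ := hl
      rwa [← h4, add_sub_cancel_left]
    obtain ⟨v, hv⟩ := ((hK.hasEigenvalue_iff_mem_spectrum hlζ).2 h3).exists_hasEigenvector
    have h4 : (K - algebraMap ℂ (Y →L[ℂ] Y) (l - ζ)) v = 0 := by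
      have : K v = (l - ζ) • v := hv.apply_eq_smul
      simp [Algebra.algebraMap_eq_smul_one, this, sub_smul]
    have h5 := DFunLike.congr_fun hE5 v
    rw [mul_apply_eq_comp, h4, hE0, map_zero, sub_zero] at h5
    exact hv.2 h5.symm
  obtain ⟨w, hw0, hw⟩ := exists_common_kernel_vector Q
    (fun a ha b hb => hideal a (hQJ ha) b hb) W hW
    (fun a ha => exists_pow_apply_eq_zero_of_quasinilpotent (hqn a ha) W (hW a ha)) hW0
  exact isReducible_of_apply_eq_zero hideal hQ0 hw0 hw

/-- A Jordan algebra of compact operators with a nonzero closed Jordan ideal of quasinilpotent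
operators is reducible. -/
theorem isReducible_of_quasinilpotent_ideal (hJ : ∀ a ∈ J, ∀ b ∈ J, a * b + b * a ∈ J)
    (hc : ∀ a ∈ J, IsCompactOperator a) (hQJ : Q ≤ J)
    (hideal : ∀ b ∈ J, ∀ q ∈ Q, b * q + q * b ∈ Q) (hQcl : IsClosed (Q : Set (Y →L[ℂ] Y)))
    (hqn : ∀ q ∈ Q, spectrum ℂ q ⊆ {0}) (hQ0 : Q ≠ ⊥) : IsReducible (J : Set (Y →L[ℂ] Y)) := by
  by_cases hR : finiteRankSubmodule Q = ⊥
  swap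
  · refine isReducible_of_finiteRank_ideal J (finiteRankSubmodule Q) (fun a ha => hQJ ha.1) ?_
      (fun a ha => ha.2) (fun a ha => isNilpotent_of_finiteDimensional_range (hqn a ha.1) ha.2) hR
    rintro b hb x ⟨hx, hx'⟩
    refine ⟨hideal b hb x hx, ?_⟩
    have h1 : LinearMap.range ((b * x + x * b : Y →L[ℂ] Y) : Y →ₗ[ℂ] Y) ≤
        (LinearMap.range (x : Y →ₗ[ℂ] Y)).map (b : Y →ₗ[ℂ] Y) ⊔
          LinearMap.range (x : Y →ₗ[ℂ] Y) := by
      rintro _ ⟨y, rfl⟩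
      exact Submodule.add_mem_sup ⟨x y, ⟨y, rfl⟩, rfl⟩ ⟨b y, rfl⟩
    exact Submodule.finiteDimensional_of_le h1
  have hfin : ∀ q ∈ Q, FiniteDimensional ℂ (LinearMap.range (q : Y →ₗ[ℂ] Y)) → q = 0 :=
    fun q hq hq' => (Submodule.eq_bot_iff _).1 hR q ⟨hq, hq'⟩
  by_cases hspec : ∃ L : List (Y →L[ℂ] Y), (∀ b ∈ L, b ∈ J) ∧ L ≠ [] ∧
      ∃ ν ∈ spectrum ℂ L.prod, ν ≠ 0
  · obtain ⟨L, hL, hne, ν, hν, hν0⟩ := hspec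
    exact isReducible_of_mem_spectrum_list_prod hJ hc hQJ hideal hQcl hqn hQ0 hfin hL hne hν hν0
  push Not at hspec
  obtain ⟨q, hq, hq0⟩ := (Submodule.ne_bot_iff _).1 hQ0
  have hred : IsReducible {s | ∃ L : List (Y →L[ℂ] Y), (∀ b ∈ L, b ∈ J) ∧ L ≠ [] ∧ L.prod = s} := by
    refine isReducible_of_compact_quasinilpotent_semigroup ?_ ?_ ?_ ?_ ?_
    · rintro _ ⟨L, hL, hne, rfl⟩ _ ⟨L', hL', hne', rfl⟩
      refine ⟨L ++ L', fun b hb => ?_, by simp [hne], by simp⟩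
      rcases List.mem_append.1 hb with h | h
      exacts [hL b h, hL' b h]
    · rintro _ ⟨L, hL, hne, rfl⟩ t
      obtain ⟨b, L, rfl⟩ := List.exists_cons_of_ne_nil hne
      refine ⟨t • b :: L, fun c hc => ?_, by simp, by simp⟩
      rcases List.mem_cons.1 hc with rfl | h
      · exact J.smul_mem t (hL b (by simp))
      · exact hL c (by simp [h])
    · rintro _ ⟨L, hL, hne, rfl⟩
      exact isCompactOperator_list_prod hc hL hne
    · rintro _ ⟨L, hL, hne, rfl⟩ ν hν
      exact hspec L hL hne ν hν
    · exact ⟨q, ⟨[q], by simpa using hQJ hq, by simp, by simp⟩, hq0⟩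
  obtain ⟨M, hM1, hM2, hM3, hM4⟩ := hred
  exact ⟨M, hM1, hM2, hM3, fun a ha => hM4 a ⟨[a], by simpa using ha, by simp, by simp⟩⟩

end QuasinilpotentIdeal

section Sublinear

open Filter Topology

variable {Y : Type*} [NormedAddCommGroup Y] [NormedSpace ℂ Y]

lemma notMem_spectrum_add {b q : Y →L[ℂ] Y} {z : ℂ} (hzb : z ∉ spectrum ℂ b)
    (h : spectrum ℂ (Ring.inverse (algebraMap ℂ _ z - b) * q) ⊆ {0}) :
    z ∉ spectrum ℂ (b + q) := by
  have hu := spectrum.notMem_iff.1 hzb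
  have h1 : IsUnit (algebraMap ℂ (Y →L[ℂ] Y) 1 - Ring.inverse (algebraMap ℂ _ z - b) * q) :=
    spectrum.notMem_iff.1 fun h2 => one_ne_zero (h h2)
  rw [spectrum.notMem_iff]
  have h2 := hu.mul h1
  rwa [map_one, mul_sub, mul_one, ← mul_assoc, Ring.mul_inverse_cancel _ hu, one_mul, sub_sub] at h2

variable [CompleteSpace Y]

lemma countable_not_isUnit_pencil {b q : Y →L[ℂ] Y} (hb : IsCompactOperator b)
    (hq : IsCompactOperator q) {β γ : ℂ} (hγ : IsUnit (algebraMap ℂ (Y →L[ℂ] Y) γ - q))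
    (hγ0 : γ ≠ 0) :
    {μ : ℂ | ¬ IsUnit (algebraMap ℂ (Y →L[ℂ] Y) (β + μ * γ) - (b + μ • q))}.Countable := by
  obtain ⟨u, hu⟩ := hγ
  obtain ⟨R, hR⟩ : ∃ R : Y →L[ℂ] Y, R = ((u⁻¹ : (Y →L[ℂ] Y)ˣ) : Y →L[ℂ] Y) := ⟨_, rfl⟩
  have h1 : R * (algebraMap ℂ (Y →L[ℂ] Y) γ - q) = 1 := by rw [← hu, hR]; simp
  have h2 : (algebraMap ℂ (Y →L[ℂ] Y) γ - q) * R = 1 := by rw [← hu, hR]; simp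
  have h3 : R = γ⁻¹ • (1 + R * q) := by
    rw [eq_inv_smul_iff₀ hγ0]
    have : R * algebraMap ℂ (Y →L[ℂ] Y) γ = γ • R := by
      rw [Algebra.algebraMap_eq_smul_one, mul_smul_comm, mul_one]
    rw [← this, ← h1]; noncomm_ring
  have h4 : -(R * (algebraMap ℂ (Y →L[ℂ] Y) β - b)) =
      algebraMap ℂ (Y →L[ℂ] Y) (-(β * γ⁻¹)) + (R * b - (β * γ⁻¹) • (R * q)) := by
    have : R * algebraMap ℂ (Y →L[ℂ] Y) β = (β * γ⁻¹) • (1 + R * q) := by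
      rw [Algebra.algebraMap_eq_smul_one, mul_smul_comm, mul_one, mul_smul, ← h3]
    rw [mul_sub, this, map_neg, Algebra.algebraMap_eq_smul_one, smul_add]
    abel
  have h5 : (spectrum ℂ (-(R * (algebraMap ℂ (Y →L[ℂ] Y) β - b)))).Countable := by
    rw [h4]
    refine IsCompactOperator.countable_spectrum_algebraMap_add ?_ _
    have h6 : IsCompactOperator ((β * γ⁻¹) • (R * q) : Y →L[ℂ] Y) := (hq.mul_left R).smul _
    exact (hb.mul_left R).sub h6
  refine Set.Countable.mono (fun μ hμ => spectrum.mem_iff.2 fun hunit => hμ ?_) h5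
  have h6 : algebraMap ℂ (Y →L[ℂ] Y) (β + μ * γ) - (b + μ • q) =
      (algebraMap ℂ (Y →L[ℂ] Y) γ - q) *
        (algebraMap ℂ (Y →L[ℂ] Y) μ - -(R * (algebraMap ℂ (Y →L[ℂ] Y) β - b))) := by
    rw [sub_neg_eq_add, mul_add, ← mul_assoc, h2, one_mul]
    simp only [Algebra.algebraMap_eq_smul_one, mul_smul_comm, mul_one, add_smul, smul_sub, mul_smul]
    abel
  rw [h6]
  exact (IsUnit.mul ⟨u, hu⟩ hunit)

/-- If the spectra of `b + lam • q` are carried by countably many lines and `q` is quasinilpotent,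
then so is `(z - b)⁻¹ * q` for `z` outside the spectrum of `b`. -/
lemma spectrum_inverse_mul_subset_zero {b q : Y →L[ℂ] Y} (hb : IsCompactOperator b)
    (hq : IsCompactOperator q) (hqn : spectrum ℂ q ⊆ {0}) {D : Set (ℂ × ℂ)} (hD : D.Countable)
    (hline : ∀ lam ν : ℂ, ν ∈ spectrum ℂ (b + lam • q) → ν ≠ 0 →
      ∃ d ∈ D, ν = d.1 + lam * d.2) {z : ℂ} (hz : z ≠ 0) (hzb : z ∉ spectrum ℂ b) :
    spectrum ℂ (Ring.inverse (algebraMap ℂ _ z - b) * q) ⊆ {0} := by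
  intro ν hν
  by_contra hν0
  obtain ⟨u, hu⟩ : IsUnit (algebraMap ℂ (Y →L[ℂ] Y) z - b) := spectrum.notMem_iff.1 hzb
  have hcont : ContinuousAt (fun w : ℂ => Ring.inverse (algebraMap ℂ (Y →L[ℂ] Y) w - b) * q) z := by
    have h1 : ContinuousAt (fun w : ℂ => Ring.inverse (algebraMap ℂ (Y →L[ℂ] Y) w - b)) z := by
      refine ContinuousAt.comp (f := fun w : ℂ => algebraMap ℂ (Y →L[ℂ] Y) w - b)
        (g := Ring.inverse) ?_ ((algebraMapCLM ℂ (Y →L[ℂ] Y)).continuous.continuousAt.sub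
          continuousAt_const)
      rw [← hu]
      exact NormedRing.inverse_continuousAt u
    exact h1.mul continuousAt_const
  have hnear := hcont.eventually (spectrum.eventually_exists_dist_lt
    (hq.mul_left _).countable_spectrum hν (norm_pos_iff.2 hν0))
  have hunit : ∀ᶠ w in 𝓝 z, IsUnit (algebraMap ℂ (Y →L[ℂ] Y) w - b) := by
    have h1 : ContinuousAt (fun w : ℂ => algebraMap ℂ (Y →L[ℂ] Y) w - b) z :=
      (algebraMapCLM ℂ (Y →L[ℂ] Y)).continuous.continuousAt.sub continuousAt_const
    exact h1.eventually (Units.isOpen.mem_nhds ⟨u, hu⟩)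
  have hne : ∀ᶠ w in 𝓝 z, w ≠ 0 := isOpen_ne.mem_nhds hz
  have hbad : (⋃ d ∈ D, (fun μ => d.1 + μ * d.2) ''
      {μ : ℂ | ¬ IsUnit (algebraMap ℂ (Y →L[ℂ] Y) (d.1 + μ * d.2) - (b + μ • q))}).Countable := by
    refine hD.biUnion fun d _ => ?_
    by_cases hd : d.2 = 0
    · refine (Set.countable_singleton d.1).mono ?_
      rintro _ ⟨μ, -, rfl⟩
      simp [hd]
    · refine Set.Countable.image (countable_not_isUnit_pencil hb hq ?_ hd) _
      exact spectrum.notMem_iff.1 fun h => hd (hqn h)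
  obtain ⟨w, hw, hwbad⟩ := mem_closure_iff_nhds.1 (hbad.dense_compl ℂ z) _
    (hnear.and (hunit.and hne))
  obtain ⟨⟨ν', hν', hdist⟩, hwu, hw0⟩ := hw
  have hν'0 : ν' ≠ 0 := by
    rintro rfl
    rw [dist_zero_left] at hdist
    exact lt_irrefl _ hdist
  have h1 : ¬ IsUnit (algebraMap ℂ (Y →L[ℂ] Y) w - (b + ν'⁻¹ • q)) := by
    intro h
    apply hν'
    have h2 : algebraMap ℂ (Y →L[ℂ] Y) ν' - Ring.inverse (algebraMap ℂ (Y →L[ℂ] Y) w - b) * q =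
        ν' • (Ring.inverse (algebraMap ℂ (Y →L[ℂ] Y) w - b) *
          (algebraMap ℂ (Y →L[ℂ] Y) w - (b + ν'⁻¹ • q))) := by
      rw [← sub_sub, mul_sub, Ring.inverse_mul_cancel _ hwu, mul_smul_comm, smul_sub,
        smul_smul, mul_inv_cancel₀ hν'0, one_smul, Algebra.algebraMap_eq_smul_one]
    rw [spectrum.mem_resolventSet_iff, h2]
    exact ((hwu.ringInverse).mul h).smul (Units.mk0 ν' hν'0)
  obtain ⟨d, hd, hwd⟩ := hline ν'⁻¹ w h1 hw0
  refine hwbad (Set.mem_biUnion hd ⟨ν'⁻¹, ?_, hwd.symm⟩)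
  rw [Set.mem_ofPred_eq, ← hwd]
  exact h1

end Sublinear

section CountablePencils

open Filter Topology

variable {Y : Type*} [NormedAddCommGroup Y] [NormedSpace ℂ Y]

/-- The nonzero spectra of each pencil `b + lam • a` in `J` are carried by countably many lines. -/
def HasCountablePencils (J : Submodule ℂ (Y →L[ℂ] Y)) : Prop :=
  ∀ a ∈ J, ∀ b ∈ J, ∃ D : Set (ℂ × ℂ), D.Countable ∧
    ∀ lam ν : ℂ, ν ∈ spectrum ℂ (b + lam • a) → ν ≠ 0 → ∃ d ∈ D, ν = d.1 + lam * d.2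

variable {J : Submodule ℂ (Y →L[ℂ] Y)}

lemma pow_succ_mem_of_jordan (hJ : ∀ a ∈ J, ∀ b ∈ J, a * b + b * a ∈ J) {c : Y →L[ℂ] Y}
    (hcJ : c ∈ J) (n : ℕ) : c ^ (n + 1) ∈ J := by
  induction n with
  | zero => simpa using hcJ
  | succ n ih =>
    have h1 := J.smul_mem (2⁻¹ : ℂ) (hJ c hcJ _ ih)
    rwa [← pow_succ, ← pow_succ', ← two_smul ℂ, smul_smul, inv_mul_cancel₀ two_ne_zero,
      one_smul] at h1

variable [CompleteSpace Y]

/-- The quasinilpotent elements form a subspace. -/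
def quasinilpotentSubmodule (J : Submodule ℂ (Y →L[ℂ] Y)) (hc : ∀ a ∈ J, IsCompactOperator a)
    (hline : HasCountablePencils J) : Submodule ℂ (Y →L[ℂ] Y) where
  carrier := {q | q ∈ J ∧ spectrum ℂ q ⊆ {0}}
  zero_mem' := ⟨J.zero_mem, by
    cases subsingleton_or_nontrivial (Y →L[ℂ] Y)
    · simp
    · simp⟩
  add_mem' := by
    rintro a b ⟨ha, ha'⟩ ⟨hb, hb'⟩
    refine ⟨J.add_mem ha hb, fun z hz => ?_⟩
    by_contra hz0
    obtain ⟨D, hD, hD'⟩ := hline b hb a ha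
    have hza : z ∉ spectrum ℂ a := fun h => hz0 (ha' h)
    exact notMem_spectrum_add hza
      (spectrum_inverse_mul_subset_zero (hc a ha) (hc b hb) hb' hD hD' hz0 hza) hz
  smul_mem' := by
    rintro t a ⟨ha, ha'⟩
    refine ⟨J.smul_mem t ha, fun z hz => ?_⟩
    by_contra hz0
    have hz0' : z ≠ 0 := hz0
    obtain ⟨D, hD, hD'⟩ := hline a ha 0 J.zero_mem
    rcases eq_or_ne t 0 with rfl | ht
    · rw [zero_smul] at hz
      cases subsingleton_or_nontrivial (Y →L[ℂ] Y)
      · simp at hz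
      · simp at hz; exact hz0 hz
    · have h1 := (spectrum.smul_mem_smul_iff (a := a) (s := t⁻¹ * z) (r := Units.mk0 t ht)).1 (by
        rw [Units.smul_def, Units.smul_def, Units.val_mk0, smul_eq_mul, mul_inv_cancel_left₀ ht]
        exact hz)
      exact (mul_ne_zero (inv_ne_zero ht) hz0') (ha' h1)

lemma spectrum_one_sub_mul_mul_subset_zero (hJ : ∀ a ∈ J, ∀ b ∈ J, a * b + b * a ∈ J)
    (hc : ∀ a ∈ J, IsCompactOperator a) (hline : HasCountablePencils J) {c q : Y →L[ℂ] Y}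
    (hcJ : c ∈ J) (hc1 : ‖c‖ < 1) (hq : q ∈ J) (hqn : spectrum ℂ q ⊆ {0}) :
    spectrum ℂ ((1 - c) * q * (1 - c)) ⊆ {0} := by
  have hs1 := geom_series_mul_neg c hc1
  have hs2 := mul_neg_geom_series c hc1
  obtain ⟨s, hs⟩ : ∃ s, s = ∑' i : ℕ, c ^ i := ⟨_, rfl⟩
  rw [← hs] at hs1 hs2
  have htend : Tendsto (fun n => ∑ i ∈ Finset.range n, c ^ i) atTop (𝓝 s) := by
    rw [hs]; exact (summable_geometric_of_norm_lt_one hc1).hasSum.tendsto_sum_nat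
  let u : (Y →L[ℂ] Y)ˣ := ⟨s, 1 - c, hs1, hs2⟩
  have htend2 : Tendsto (fun n => (∑ i ∈ Finset.range (n + 1), c ^ i) ^ 2) atTop
      (𝓝 ((u ^ 2 : (Y →L[ℂ] Y)ˣ) : Y →L[ℂ] Y)) :=
    ((tendsto_add_atTop_iff_nat 1).2 htend).pow 2
  have hunit := htend2.eventually (Units.isOpen.mem_nhds ⟨u ^ 2, rfl⟩)
  have hlim : Tendsto (fun n => Ring.inverse ((∑ i ∈ Finset.range (n + 1), c ^ i) ^ 2) * q) atTop
      (𝓝 ((1 - c) ^ 2 * q)) := by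
    have h1 := ((NormedRing.inverse_continuousAt (u ^ 2)).tendsto.comp htend2).mul_const q
    rw [Ring.inverse_unit] at h1
    exact h1
  have hmem : ∀ n, (∑ i ∈ Finset.range n, c ^ (i + 1)) ∈ J := fun n =>
    J.sum_mem fun i _ => pow_succ_mem_of_jordan hJ hcJ i
  have h1 : spectrum ℂ ((1 - c) ^ 2 * q) ⊆ {0} := by
    refine spectrum.subset_zero_of_mem_closure ((hc q hq).mul_left _).countable_spectrum
      (s := {b | spectrum ℂ b ⊆ {0}}) (fun b hb => hb) (mem_closure_of_tendsto hlim ?_)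
    filter_upwards [hunit] with n hn
    obtain ⟨e, he⟩ : ∃ e, e = ∑ i ∈ Finset.range n, c ^ (i + 1) := ⟨_, rfl⟩
    have hb : -((2 : ℂ) • e + e ^ (1 + 1)) ∈ J :=
      J.neg_mem (J.add_mem (J.smul_mem _ (he ▸ hmem n))
        (pow_succ_mem_of_jordan hJ (he ▸ hmem n) 1))
    have h2 : (∑ i ∈ Finset.range (n + 1), c ^ i) ^ 2 =
        algebraMap ℂ (Y →L[ℂ] Y) 1 - -((2 : ℂ) • e + e ^ (1 + 1)) := by
      rw [Finset.sum_range_succ', ← he, two_smul, map_one]; noncomm_ring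
    have h2' := h2 ▸ hn
    obtain ⟨D, hD, hD'⟩ := hline q hq _ hb
    rw [h2]
    exact spectrum_inverse_mul_subset_zero (hc _ hb) (hc q hq) hqn hD hD' one_ne_zero
      (spectrum.notMem_iff.2 h2')
  intro z hz
  by_contra hz0
  have h3 : z ∈ spectrum ℂ ((1 - c) * ((1 - c) * q)) \ {0} := by
    rw [spectrum.nonzero_mul_comm]
    exact ⟨hz, hz0⟩
  rw [← mul_assoc, ← sq] at h3
  exact hz0 (h1 h3.1)

lemma jordan_mem_quasinilpotentSubmodule (hJ : ∀ a ∈ J, ∀ b ∈ J, a * b + b * a ∈ J)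
    (hc : ∀ a ∈ J, IsCompactOperator a) (hline : HasCountablePencils J) {b q : Y →L[ℂ] Y}
    (hb : b ∈ J) (hq : q ∈ quasinilpotentSubmodule J hc hline) :
    b * q + q * b ∈ quasinilpotentSubmodule J hc hline := by
  have key : ∀ c ∈ J, ‖c‖ < 1 → (1 - c) * q * (1 - c) ∈ quasinilpotentSubmodule J hc hline := by
    intro c hcJ hc1
    refine ⟨?_, spectrum_one_sub_mul_mul_subset_zero hJ hc hline hcJ hc1 hq.1 hq.2⟩
    have h1 : (1 - c) * q * (1 - c) = q - (c * q + q * c) + c * q * c := by noncomm_ring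
    rw [h1]
    exact J.add_mem (J.sub_mem hq.1 (hJ c hcJ q hq.1)) (mul_mul_mem_of_jordan hJ hJ hcJ hq.1)
  obtain ⟨t, ht0, ht⟩ : ∃ t : ℂ, t ≠ 0 ∧ ‖t • b‖ < 1 := by
    refine ⟨((2 * (1 + ‖b‖))⁻¹ : ℝ), ?_, ?_⟩
    · have : (2 * (1 + ‖b‖))⁻¹ ≠ 0 := by positivity
      exact_mod_cast this
    · rw [norm_smul, Complex.norm_real, Real.norm_eq_abs, abs_of_nonneg (by positivity),
        inv_mul_lt_iff₀ (by positivity)]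
      linarith [norm_nonneg b]
  have h1 := key (t • b) (J.smul_mem t hb) ht
  have h2 := key (-(t • b)) (J.neg_mem (J.smul_mem t hb)) (by rwa [norm_neg])
  have h3 : b * q + q * b = (2 * t)⁻¹ • ((1 - -(t • b)) * q * (1 - -(t • b)) -
      (1 - t • b) * q * (1 - t • b)) := by
    rw [eq_inv_smul_iff₀ (mul_ne_zero two_ne_zero ht0), mul_smul, smul_add, ← smul_mul_assoc,
      ← mul_smul_comm, two_smul]
    generalize t • b = s
    noncomm_ring
  rw [h3]
  exact Submodule.smul_mem _ _ (Submodule.sub_mem _ h2 h1)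

end CountablePencils

section SublinearReducible

open Filter Topology

variable {Y : Type*} [NormedAddCommGroup Y] [NormedSpace ℂ Y] [CompleteSpace Y]
  {J : Submodule ℂ (Y →L[ℂ] Y)}

lemma spectrum_subset_zero_of_idempotent_derivation (hline : HasCountablePencils J)
    {p c : Y →L[ℂ] Y} (hp : p ∈ J) (hcJ : c ∈ J) (hpp : p * p = p) (hpc : p * c + c * p = c) :
    spectrum ℂ c ⊆ {0} := by
  intro ν hν
  by_contra hν0
  have hν0' : ν ≠ 0 := hν0
  have hnt : Nontrivial (Y →L[ℂ] Y) := by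
    by_contra h
    rw [not_nontrivial_iff_subsingleton] at h
    simp at hν
  obtain ⟨D, hD, hD'⟩ := hline c hcJ p hp
  have hroot : ∀ μ : ℂ, μ ≠ 0 → ∃ d ∈ D, (d.1 + μ * d.2) ^ 2 - (d.1 + μ * d.2) = μ ^ 2 * ν ^ 2 := by
    intro μ hμ
    have h1 : (p + μ • c) ^ 2 - (p + μ • c) = (μ ^ 2) • c ^ 2 := by
      have : (p + μ • c) ^ 2 = p * p + μ • (p * c + c * p) + (μ ^ 2) • c ^ 2 := by
        simp only [sq, mul_add, add_mul, smul_mul_assoc, mul_smul_comm, smul_add, mul_smul]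
        abel
      rw [this, hpp, hpc]; abel
    have h2 : Polynomial.aeval (p + μ • c) (Polynomial.X ^ 2 - Polynomial.X : Polynomial ℂ) =
        Polynomial.aeval c (Polynomial.C (μ ^ 2) * Polynomial.X ^ 2 : Polynomial ℂ) := by
      simp [h1, Algebra.algebraMap_eq_smul_one, smul_pow]
    have h3 : μ ^ 2 * ν ^ 2 ∈ spectrum ℂ (Polynomial.aeval (p + μ • c)
        (Polynomial.X ^ 2 - Polynomial.X : Polynomial ℂ)) := by
      rw [h2, spectrum.map_polynomial_aeval]
      exact ⟨ν, hν, by simp⟩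
    rw [spectrum.map_polynomial_aeval] at h3
    obtain ⟨a, ha, haν⟩ := h3
    simp only [Polynomial.eval_sub, Polynomial.eval_pow, Polynomial.eval_X] at haν
    have ha0 : a ≠ 0 := by
      rintro rfl
      have : μ ^ 2 * ν ^ 2 ≠ 0 := mul_ne_zero (pow_ne_zero _ hμ) (pow_ne_zero _ hν0')
      apply this
      rw [← haν]; simp
    obtain ⟨d, hd, rfl⟩ := hD' μ a ha ha0
    exact ⟨d, hd, haν⟩
  have hfin : ∀ d ∈ D, {μ : ℂ | (d.1 + μ * d.2) ^ 2 - (d.1 + μ * d.2) = μ ^ 2 * ν ^ 2}.Countable := by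
    rintro ⟨α, β⟩ -
    refine Set.Finite.countable ?_
    by_contra hinf
    let P : Polynomial ℂ := Polynomial.C (β ^ 2 - ν ^ 2) * Polynomial.X ^ 2 +
      Polynomial.C (2 * α * β - β) * Polynomial.X + Polynomial.C (α ^ 2 - α)
    have hP : P = 0 := by
      refine Polynomial.eq_zero_of_infinite_isRoot P (Set.Infinite.mono (fun μ hμ => ?_) hinf)
      have hμ' : (α + μ * β) ^ 2 - (α + μ * β) = μ ^ 2 * ν ^ 2 := hμ
      change P.eval μ = 0
      simp only [P, Polynomial.eval_add, Polynomial.eval_mul, Polynomial.eval_C,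
        Polynomial.eval_pow, Polynomial.eval_X]
      linear_combination hμ'
    have e0 : α ^ 2 - α = 0 := by
      have := congrArg (Polynomial.eval 0) hP
      simpa [P] using this
    have e1 := congrArg (Polynomial.eval 1) hP
    have e2 := congrArg (Polynomial.eval (-1)) hP
    simp only [P, Polynomial.eval_add, Polynomial.eval_mul, Polynomial.eval_C,
        Polynomial.eval_pow, Polynomial.eval_X, Polynomial.eval_zero] at e1 e2
    have e3 : β ^ 2 = ν ^ 2 := by linear_combination (e1 + e2) / 2 - e0
    have e4 : β * (2 * α - 1) = 0 := by linear_combination (e1 - e2) / 2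
    have hβ : β ≠ 0 := by
      rintro rfl
      exact hν0' (by simpa using e3.symm)
    have e5 : 2 * α - 1 = 0 := (mul_eq_zero.1 e4).resolve_left hβ
    have : (1 : ℂ) = 0 := by linear_combination (2 * α - 1) * e5 - 4 * e0
    exact one_ne_zero this
  obtain ⟨μ, hμ⟩ :=
    (((hD.biUnion hfin).union (Set.countable_singleton 0)).dense_compl ℂ).nonempty
  obtain ⟨d, hd, h⟩ := hroot μ fun h => hμ (Or.inr h)
  exact hμ (Or.inl (Set.mem_biUnion hd h))

lemma commute_idempotent_of_quasinilpotent_eq_zero (hJ : ∀ a ∈ J, ∀ b ∈ J, a * b + b * a ∈ J)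
    (hline : HasCountablePencils J) (hqn : ∀ q ∈ J, spectrum ℂ q ⊆ {0} → q = 0)
    {p x : Y →L[ℂ] Y} (hp : p ∈ J) (hpp : p * p = p) (hx : x ∈ J) : x * p = p * x := by
  have hpxp := mul_mul_mem_of_jordan hJ hJ hp hx
  have hcJ : p * x + x * p - (2 : ℂ) • (p * x * p) ∈ J :=
    J.sub_mem (hJ p hp x hx) (J.smul_mem _ hpxp)
  have e1 : ∀ y, p * (p * y) = p * y := fun y => by rw [← mul_assoc, hpp]
  have h0 := hqn _ hcJ (spectrum_subset_zero_of_idempotent_derivation hline hp hcJ hpp (by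
    simp only [two_smul, mul_sub, mul_add, sub_mul, add_mul, mul_assoc, hpp, e1]
    abel))
  have h1 : p * x = p * x * p := by
    have := congrArg (p * ·) h0
    simp only [two_smul, mul_sub, mul_add, mul_assoc, e1, mul_zero] at this
    rw [mul_assoc]
    rw [← sub_eq_zero, ← this]; abel
  have h2 : x * p = p * x * p := by
    have := congrArg (· * p) h0
    simp only [two_smul, sub_mul, add_mul, mul_assoc, hpp, zero_mul] at this
    rw [mul_assoc]
    rw [← sub_eq_zero, ← this]; abel
  rw [h1, h2]

/-- Every nonzero spectral value of an element of `J` has a spectral idempotent in `J`. -/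
def HasSpectralIdempotents (J : Submodule ℂ (Y →L[ℂ] Y)) : Prop :=
  ∀ b ∈ J, ∀ l ∈ spectrum ℂ b, l ≠ 0 → ∃ p ∈ J, p ≠ 0 ∧ p * p = p ∧
    ∃ m : ℕ, (b - algebraMap ℂ _ l) ^ m * p = 0

lemma isReducible_of_quasinilpotent_eq_zero (hJ : ∀ a ∈ J, ∀ b ∈ J, a * b + b * a ∈ J)
    (hline : HasCountablePencils J) (hidem : HasSpectralIdempotents J)
    (hqn : ∀ q ∈ J, spectrum ℂ q ⊆ {0} → q = 0)
    {M : Submodule ℂ Y} (hM : IsClosed (M : Set Y)) (hM0 : M ≠ ⊥) (hM1 : M ≠ ⊤) :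
    IsReducible (J : Set (Y →L[ℂ] Y)) := by
  by_contra hirr
  have hone : ∀ p ∈ J, p ≠ 0 → p * p = p → p = 1 := by
    intro p hp hp0 hpp
    by_contra hp1
    refine hirr ⟨LinearMap.ker ((1 - p : Y →L[ℂ] Y) : Y →ₗ[ℂ] Y), (1 - p).isClosed_ker, ?_, ?_, ?_⟩
    · intro h
      apply hp0
      ext y
      have h1 : p y ∈ LinearMap.ker ((1 - p : Y →L[ℂ] Y) : Y →ₗ[ℂ] Y) := by
        have : (p * p) y = p y := by rw [hpp]
        rw [mul_apply_eq_comp] at this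
        simp [this]
      rw [h] at h1
      simpa using h1
    · intro h
      apply hp1
      ext y
      have h1 : y ∈ LinearMap.ker ((1 - p : Y →L[ℂ] Y) : Y →ₗ[ℂ] Y) := h ▸ Submodule.mem_top
      simp [sub_eq_zero] at h1
      simpa using h1.symm
    · intro a ha y hy
      have h1 := commute_idempotent_of_quasinilpotent_eq_zero hJ hline hqn hp hpp ha
      have h2 : (a * p) y = (p * a) y := by rw [h1]
      simp only [mul_apply_eq_comp] at h2
      simp [sub_eq_zero] at hy ⊢
      rw [← h2, ← hy]
  have hscalar : ∀ b ∈ J, ∃ l : ℂ, b = algebraMap ℂ _ l := by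
    intro b hb
    by_cases hbq : spectrum ℂ b ⊆ {0}
    · exact ⟨0, by rw [hqn b hb hbq, map_zero]⟩
    obtain ⟨l, hl, hl0⟩ := Set.not_subset.1 hbq
    obtain ⟨p, hp, hp0, hpp, m, hm⟩ := hidem b hb l hl hl0
    have hp1 := hone p hp hp0 hpp
    rw [hp1, mul_one] at hm
    refine ⟨l, sub_eq_zero.1 (hqn _ ?_ ?_)⟩
    · rw [Algebra.algebraMap_eq_smul_one]
      exact J.sub_mem hb (J.smul_mem l (hp1 ▸ hp))
    · intro ν hν
      have h1 := spectrum.pow_mem_pow _ m hν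
      rw [hm] at h1
      by_contra hν0
      refine (pow_ne_zero m (show ν ≠ 0 from hν0)) ?_
      cases subsingleton_or_nontrivial (Y →L[ℂ] Y)
      · simp at h1
      · simpa using h1
  refine hirr ⟨M, hM, hM0, hM1, fun b hb x hx => ?_⟩
  obtain ⟨l, rfl⟩ := hscalar b hb
  rw [Algebra.algebraMap_eq_smul_one]
  simpa using M.smul_mem l hx

theorem isReducible_of_hasCountablePencils (hJ : ∀ a ∈ J, ∀ b ∈ J, a * b + b * a ∈ J)
    (hc : ∀ a ∈ J, IsCompactOperator a) (hline : HasCountablePencils J)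
    (hidem : HasSpectralIdempotents J)
    {M : Submodule ℂ Y} (hM : IsClosed (M : Set Y)) (hM0 : M ≠ ⊥) (hM1 : M ≠ ⊤) :
    IsReducible (J : Set (Y →L[ℂ] Y)) := by
  by_cases hQ : quasinilpotentSubmodule J hc hline = ⊥
  · exact isReducible_of_quasinilpotent_eq_zero hJ hline hidem
      (fun q hq hq' => (Submodule.eq_bot_iff _).1 hQ q ⟨hq, hq'⟩) hM hM0 hM1
  obtain ⟨Q, hQdef⟩ : ∃ Q, Q = quasinilpotentSubmodule J hc hline := ⟨_, rfl⟩
  have hQJ : Q ≤ J := fun q hq => by rw [hQdef] at hq; exact hq.1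
  have hideal : ∀ b ∈ J, ∀ q ∈ Q, b * q + q * b ∈ Q := by
    intro b hb q hq
    rw [hQdef] at hq ⊢
    exact jordan_mem_quasinilpotentSubmodule hJ hc hline hb hq
  have hcc : ∀ a ∈ J.topologicalClosure, IsCompactOperator a := fun a ha =>
    closure_minimal (t := {a : Y →L[ℂ] Y | IsCompactOperator a}) (fun a ha => hc a ha)
      isClosed_setOfPred_isCompactOperator ha
  have hclos : ∀ {P : Submodule ℂ (Y →L[ℂ] Y)}, (∀ a ∈ J, ∀ b ∈ P, a * b + b * a ∈ P) →
      ∀ a ∈ J.topologicalClosure, ∀ b ∈ P.topologicalClosure,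
        a * b + b * a ∈ P.topologicalClosure := by
    intro P hP a ha b hb
    exact map_mem_closure₂ (f := fun a b : Y →L[ℂ] Y => a * b + b * a) (by fun_prop) ha hb hP
  have h1 : IsReducible (J.topologicalClosure : Set (Y →L[ℂ] Y)) := by
    refine isReducible_of_quasinilpotent_ideal (Q := Q.topologicalClosure) (hclos hJ) hcc
      (Submodule.topologicalClosure_mono hQJ) (hclos hideal)
      (Submodule.isClosed_topologicalClosure _) ?_ ?_
    · intro q hq
      refine spectrum.subset_zero_of_mem_closure
        (hcc q (Submodule.topologicalClosure_mono hQJ hq)).countable_spectrum ?_ hq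
      intro b hb
      rw [hQdef] at hb
      exact hb.2
    · rw [hQdef]
      exact fun h => hQ (le_bot_iff.1 (h ▸ Submodule.le_topologicalClosure _))
  obtain ⟨N, hN1, hN2, hN3, hN4⟩ := h1
  exact ⟨N, hN1, hN2, hN3, fun a ha => hN4 a (Submodule.le_topologicalClosure _ ha)⟩

end SublinearReducible

section Induced

open Filter Topology

variable {X Y : Type*} [NormedAddCommGroup X] [NormedSpace ℂ X] [NormedAddCommGroup Y]
  [NormedSpace ℂ Y] {N : Submodule ℂ X} {ρ : N →L[ℂ] Y} {a b : X →L[ℂ] X} {S T : Y →L[ℂ] Y}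

/-- `T` is induced by `a` through the map `ρ` defined on the `a`-invariant subspace `N`. -/
def IsInduced (ρ : N →L[ℂ] Y) (a : X →L[ℂ] X) (T : Y →L[ℂ] Y) : Prop :=
  ∀ x : N, ∃ h : a x ∈ N, ρ ⟨a x, h⟩ = T (ρ x)

namespace IsInduced

lemma add (ha : IsInduced ρ a S) (hb : IsInduced ρ b T) : IsInduced ρ (a + b) (S + T) := by
  intro x
  obtain ⟨h1, h2⟩ := ha x
  obtain ⟨h3, h4⟩ := hb x
  refine ⟨N.add_mem h1 h3, ?_⟩
  change _ = S (ρ x) + T (ρ x)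
  rw [← h2, ← h4, ← map_add]
  rfl

lemma smul (t : ℂ) (ha : IsInduced ρ a S) : IsInduced ρ (t • a) (t • S) := by
  intro x
  obtain ⟨h1, h2⟩ := ha x
  refine ⟨N.smul_mem t h1, ?_⟩
  change _ = t • S (ρ x)
  rw [← h2, ← map_smul]
  rfl

lemma mul (ha : IsInduced ρ a S) (hb : IsInduced ρ b T) : IsInduced ρ (a * b) (S * T) := by
  intro x
  obtain ⟨h1, h2⟩ := hb x
  obtain ⟨h3, h4⟩ := ha ⟨b x, h1⟩
  refine ⟨h3, ?_⟩
  change _ = S (T (ρ x))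
  rw [← h2, ← h4]
  rfl

lemma one : IsInduced ρ 1 1 := fun x => ⟨x.2, rfl⟩

lemma zero : IsInduced ρ 0 0 := fun _ => ⟨N.zero_mem, map_zero ρ⟩

lemma pow (ha : IsInduced ρ a S) (n : ℕ) : IsInduced ρ (a ^ n) (S ^ n) := by
  induction n with
  | zero => simpa using one
  | succ n ih => rw [pow_succ, pow_succ]; exact ih.mul ha

lemma sub_algebraMap (ha : IsInduced ρ a S) (l : ℂ) :
    IsInduced ρ (a - algebraMap ℂ _ l) (S - algebraMap ℂ _ l) := by
  have h1 := ha.add ((one (ρ := ρ)).smul (-l))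
  rwa [neg_smul, neg_smul, ← sub_eq_add_neg, ← sub_eq_add_neg,
    ← Algebra.algebraMap_eq_smul_one, ← Algebra.algebraMap_eq_smul_one] at h1

lemma unique (hρ : Function.Surjective ρ) (hS : IsInduced ρ a S) (hT : IsInduced ρ a T) :
    S = T := by
  ext y
  obtain ⟨x, rfl⟩ := hρ y
  obtain ⟨h1, h2⟩ := hS x
  obtain ⟨h3, h4⟩ := hT x
  rw [← h2, ← h4]

lemma isCompactOperator (hN : IsClosed (N : Set X)) (hρ : IsOpenMap ρ) (hS : IsInduced ρ a S)
    (ha : IsCompactOperator a) : IsCompactOperator S := by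
  have h1 := ha.restrict (f := (a : X →ₗ[ℂ] X)) (V := N) (fun v hv => (hS ⟨v, hv⟩).1) hN
  obtain ⟨K, hK, hK0⟩ := h1
  refine ⟨ρ '' K, hK.image ρ.continuous, ?_⟩
  have h2 := hρ.image_mem_nhds hK0
  rw [map_zero] at h2
  refine mem_of_superset h2 ?_
  rintro _ ⟨x, hx, rfl⟩
  obtain ⟨h3, h4⟩ := hS x
  exact ⟨_, hx, h4⟩

end IsInduced

/-- The operators induced by the elements of `J`. -/
def inducedSubmodule (ρ : N →L[ℂ] Y) (J : Submodule ℂ (X →L[ℂ] X)) :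
    Submodule ℂ (Y →L[ℂ] Y) where
  carrier := {T | ∃ a ∈ J, IsInduced ρ a T}
  zero_mem' := ⟨0, J.zero_mem, IsInduced.zero⟩
  add_mem' := by
    rintro S T ⟨a, ha, ha'⟩ ⟨b, hb, hb'⟩
    exact ⟨a + b, J.add_mem ha hb, ha'.add hb'⟩
  smul_mem' := by
    rintro t S ⟨a, ha, ha'⟩
    exact ⟨t • a, J.smul_mem t ha, ha'.smul t⟩

lemma apply_mem_of_mem_adjoin_closure {M : Submodule ℂ X} (hM : IsClosed (M : Set X))
    (hb : ∀ x ∈ M, b x ∈ M) {e : X →L[ℂ] X}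
    (he : e ∈ (Algebra.adjoin ℂ {b}).topologicalClosure) : ∀ x ∈ M, e x ∈ M := by
  let P : Subalgebra ℂ (X →L[ℂ] X) :=
    { carrier := {c | ∀ x ∈ M, c x ∈ M}
      mul_mem' := fun {c d} hc hd x hx => hc _ (hd x hx)
      add_mem' := fun {c d} hc hd x hx => M.add_mem (hc x hx) (hd x hx)
      algebraMap_mem' := fun t x hx => by
        rw [Algebra.algebraMap_eq_smul_one]
        exact M.smul_mem t hx }
  have hP : IsClosed (P : Set (X →L[ℂ] X)) := by
    have : (P : Set (X →L[ℂ] X)) = ⋂ x ∈ M, {c | c x ∈ M} := by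
      ext c
      simp only [Set.mem_iInter]
      exact Iff.rfl
    rw [this]
    exact isClosed_biInter fun x _ => hM.preimage (by fun_prop)
  have h1 : Algebra.adjoin ℂ {b} ≤ P := Algebra.adjoin_le (Set.singleton_subset_iff.2 hb)
  exact Subalgebra.topologicalClosure_minimal h1 hP he

lemma aeval_mem_of_jordan {J : Submodule ℂ (X →L[ℂ] X)}
    (hJ : ∀ a ∈ J, ∀ b ∈ J, a * b + b * a ∈ J) (hb : b ∈ J) {f : Polynomial ℂ}
    (hf : f.coeff 0 = 0) : Polynomial.aeval b f ∈ J := by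
  rw [Polynomial.aeval_eq_sum_range]
  refine J.sum_mem fun i _ => ?_
  cases i with
  | zero => rw [hf, zero_smul]; exact J.zero_mem
  | succ i => exact J.smul_mem _ (pow_succ_mem_of_jordan hJ hb i)

lemma idempotent_mem_of_jordan {J : Submodule ℂ (X →L[ℂ] X)}
    (hJ : ∀ a ∈ J, ∀ b ∈ J, a * b + b * a ∈ J) (hJcl : IsClosed (J : Set (X →L[ℂ] X)))
    (hb : b ∈ J) {l : ℂ} (hl : l ≠ 0) {e : X →L[ℂ] X} {m : ℕ}
    (he : e ∈ (Algebra.adjoin ℂ {b}).topologicalClosure)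
    (hm : (b - algebraMap ℂ _ l) ^ m * e = 0) : e ∈ J := by
  let f : Polynomial ℂ := 1 - (Polynomial.C (-l⁻¹) * (Polynomial.X - Polynomial.C l)) ^ m
  have hf : f.coeff 0 = 0 := by
    simp [f, Polynomial.coeff_zero_eq_eval_zero, hl]
  have h1 : Polynomial.aeval b f * e = e := by
    have : Polynomial.aeval b f = 1 - (-l⁻¹) ^ m • (b - algebraMap ℂ _ l) ^ m := by
      simp only [f, map_sub, map_one, map_pow, map_mul, Polynomial.aeval_C, Polynomial.aeval_X,
        ← Algebra.smul_def, smul_pow]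
    rw [this, sub_mul, smul_mul_assoc, hm]; simp
  have h2 : ∀ y ∈ Algebra.adjoin ℂ {b}, Polynomial.aeval b f * y ∈ J := by
    intro y hy
    rw [Algebra.adjoin_singleton_eq_range_aeval] at hy
    obtain ⟨g, rfl⟩ := hy
    change Polynomial.aeval b f * Polynomial.aeval b g ∈ J
    rw [← map_mul]
    exact aeval_mem_of_jordan hJ hb (by rw [Polynomial.mul_coeff_zero, hf, zero_mul])
  have h3 := map_mem_closure (f := fun y => Polynomial.aeval b f * y) (by fun_prop) he h2
  rw [h1, hJcl.closure_eq] at h3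
  exact h3

variable [CompleteSpace X] [CompleteSpace Y]

/-- Spectral idempotents of an operator induced on a subquotient come from Riesz projections. -/
lemma IsInduced.exists_idempotent {J : Submodule ℂ (X →L[ℂ] X)}
    (hJ : ∀ a ∈ J, ∀ b ∈ J, a * b + b * a ∈ J) (hJcl : IsClosed (J : Set (X →L[ℂ] X)))
    (hc : IsCompactOperator b) (hb : b ∈ J) (hN : IsClosed (N : Set X)) (hρo : IsOpenMap ρ)
    (hρ : Function.Surjective ρ) {M : Submodule ℂ X} (hM : IsClosed (M : Set X))
    (hker : ∀ x : N, ρ x = 0 ↔ (x : X) ∈ M) (hbM : ∀ x ∈ M, b x ∈ M)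
    (hlift : ∀ a : X →L[ℂ] X, (∀ x ∈ N, a x ∈ N) → (∀ x ∈ M, a x ∈ M) → ∃ S, IsInduced ρ a S)
    (hT : IsInduced ρ b T) {l : ℂ} (hl : l ≠ 0) (hlT : l ∈ spectrum ℂ T) :
    l ∈ spectrum ℂ b ∧ ∃ p ∈ inducedSubmodule ρ J, p ≠ 0 ∧ p * p = p ∧
      ∃ m : ℕ, (T - algebraMap ℂ _ l) ^ m * p = 0 := by
  obtain ⟨E, S, m, hEE, hEf, hcomm, hTE, hST, hTS, hSE, hES⟩ := hc.exists_riesz_projection hl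
  obtain ⟨hE, hS⟩ := hc.riesz_projection_mem hEE hEf hTE hcomm hST hTS hES
  have hbN : ∀ x ∈ N, b x ∈ N := fun x hx => (hT ⟨x, hx⟩).1
  obtain ⟨p, hp⟩ := hlift E (apply_mem_of_mem_adjoin_closure hN hbN hE)
    (apply_mem_of_mem_adjoin_closure hM hbM hE)
  have hEJ := idempotent_mem_of_jordan hJ hJcl hb hl hE hTE
  obtain ⟨u, hu⟩ := (((hT.isCompactOperator hN hρo hc).hasEigenvalue_iff_mem_spectrum hl).2
    hlT).exists_hasEigenvector
  have hTu : T u = l • u := hu.apply_eq_smul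
  have hu0 : u ≠ 0 := hu.2
  obtain ⟨x, rfl⟩ := hρ u
  have hpu : p (ρ x) = ρ x := by
    obtain ⟨h1, h2⟩ := hp x
    obtain ⟨h3, h4⟩ := hT x
    rw [← h2, ← sub_eq_zero, ← map_sub, hker]
    have h5 : b x - l • (x : X) ∈ M := by
      have : ρ (⟨b x, h3⟩ - l • x) = 0 := by rw [map_sub, h4, map_smul, hTu, sub_self]
      exact (hker _).1 this
    have h6 := apply_mem_of_mem_adjoin_closure hM hbM hS _ h5
    have h7 : S (b x - l • (x : X)) = x - E x := by
      have := congrArg (fun A : X →L[ℂ] X => A x) hST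
      simpa [Algebra.algebraMap_eq_smul_one] using this
    rw [h7] at h6
    have h8 := M.neg_mem h6
    rw [neg_sub] at h8
    exact h8
  have hp0 : p ≠ 0 := by
    rintro rfl
    rw [zero_apply] at hpu
    exact hu0 hpu.symm
  refine ⟨?_, p, ⟨E, hEJ, hp⟩, hp0, ?_, m, ?_⟩
  · by_contra hlb
    have h1 := spectrum.notMem_iff.1 hlb
    rw [IsUnit.sub_iff] at h1
    have h2 : E = 0 := by
      obtain ⟨v, hv⟩ := h1.pow m
      have := congrArg ((v⁻¹ : (X →L[ℂ] X)ˣ) * · : (X →L[ℂ] X) → (X →L[ℂ] X)) hTE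
      rw [← hv] at this
      simpa [← mul_assoc] using this
    rw [h2] at hp
    exact hp0 (hp.unique hρ IsInduced.zero)
  · have h1 := hp.mul hp
    rw [hEE] at h1
    exact h1.unique hρ hp
  · have h1 := ((hT.sub_algebraMap l).pow m).mul hp
    rw [hTE] at h1
    exact h1.unique hρ IsInduced.zero

end Induced

section Chains

open Filter Topology

variable {X : Type*} [NormedAddCommGroup X] [NormedSpace ℂ X]

/-- A family of operators that refines every non-adjacent pair of closed invariant subspaces is
triangularizable. -/
theorem exists_isMaxChain_of_refinement {J : Set (X →L[ℂ] X)}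
    (h : ∀ M Z N : Submodule ℂ X, IsClosed (M : Set X) → IsClosed (Z : Set X) →
      IsClosed (N : Set X) → M < Z → Z < N → (∀ a ∈ J, ∀ x ∈ M, a x ∈ M) →
      (∀ a ∈ J, ∀ x ∈ N, a x ∈ N) →
      ∃ W : Submodule ℂ X, IsClosed (W : Set X) ∧ M < W ∧ W < N ∧ ∀ a ∈ J, ∀ x ∈ W, a x ∈ W) :
    ∃ C : Set {M : Submodule ℂ X // IsClosed (M : Set X)},
      (∀ M ∈ C, ∀ a ∈ J, ∀ x ∈ M.1, a x ∈ M.1) ∧ IsMaxChain (· ≤ ·) C := by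
  let Inv := {M : {M : Submodule ℂ X // IsClosed (M : Set X)} // ∀ a ∈ J, ∀ x ∈ M.1, a x ∈ M.1}
  have hmax : IsMaxChain (· ≤ ·) (maxChain (α := Inv) (· ≤ ·)) := maxChain_spec
  obtain ⟨C₀, hC₀⟩ : ∃ C₀, C₀ = maxChain (α := Inv) (· ≤ ·) := ⟨_, rfl⟩
  rw [← hC₀] at hmax
  have hmem : ∀ W : Inv, (∀ M ∈ C₀, M ≤ W ∨ W ≤ M) → W ∈ C₀ := by
    intro W hW
    have h1 := hmax.2 (hmax.1.insert fun M hM _ => (hW M hM).symm) (Set.subset_insert W C₀)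
    rw [h1]
    exact Set.mem_insert _ _
  refine ⟨Subtype.val '' C₀, ?_, ?_, ?_⟩
  · rintro _ ⟨M, -, rfl⟩
    exact M.2
  · rintro _ ⟨M, hM, rfl⟩ _ ⟨N, hN, rfl⟩ -
    exact hmax.1.total hM hN
  intro t ht hCt
  refine hCt.antisymm fun Z hZt => ?_
  by_contra hZ
  have hcomp : ∀ M ∈ C₀, M.1 ≤ Z ∨ Z ≤ M.1 := fun M hM => ht.total (hCt ⟨M, hM, rfl⟩) hZt
  let N : Inv := ⟨⟨⨅ M ∈ {M | M ∈ C₀ ∧ Z ≤ M.1}, M.1.1, by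
    simp only [Submodule.coe_iInf]
    exact isClosed_biInter fun M _ => M.1.2⟩, fun a ha x hx => by
    simp only [Submodule.mem_iInf] at hx ⊢
    exact fun M hM => M.2 a ha x (hx M hM)⟩
  let P : Submodule ℂ X := ⨆ M ∈ {M | M ∈ C₀ ∧ M.1 ≤ Z}, M.1.1
  have hP : ∀ a ∈ J, P ≤ P.topologicalClosure.comap (a : X →ₗ[ℂ] X) := by
    intro a ha
    refine iSup₂_le fun M hM x hx => ?_
    exact P.le_topologicalClosure ((le_iSup₂ (f := fun (M : Inv) (_ : M ∈ {M | M ∈ C₀ ∧ M.1 ≤ Z}) =>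
      M.1.1) M hM) (M.2 a ha x hx))
  let M : Inv := ⟨⟨P.topologicalClosure, P.isClosed_topologicalClosure⟩, fun a ha x hx =>
    Submodule.topologicalClosure_minimal _ (hP a ha)
      (P.isClosed_topologicalClosure.preimage a.continuous) hx⟩
  have hZN : Z ≤ N.1 := show Z.1 ≤ N.1.1 from le_iInf₂ fun M hM => hM.2
  have hMZ : M.1 ≤ Z := Submodule.topologicalClosure_minimal _ (iSup₂_le fun M hM => hM.2) Z.2
  have hN : ∀ K ∈ C₀, Z ≤ K.1 → N ≤ K := fun K hK hZK =>
    iInf₂_le (f := fun (M : Inv) (_ : M ∈ {M | M ∈ C₀ ∧ Z ≤ M.1}) => M.1.1) K ⟨hK, hZK⟩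
  have hM : ∀ K ∈ C₀, K.1 ≤ Z → K ≤ M := fun K hK hKZ =>
    (le_iSup₂ (f := fun (M : Inv) (_ : M ∈ {M | M ∈ C₀ ∧ M.1 ≤ Z}) => M.1.1) K ⟨hK, hKZ⟩).trans
      P.le_topologicalClosure
  have hbetween : ∀ W : Inv, M ≤ W → W ≤ N → W ∈ C₀ := fun W hMW hWN => hmem W fun K hK =>
    (hcomp K hK).imp (fun hK' => (hM K hK hK').trans hMW) fun hK' => hWN.trans (hN K hK hK')
  have hMN : M ≤ N := hMZ.trans hZN
  have hMC := hbetween M le_rfl hMN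
  have hNC := hbetween N hMN le_rfl
  have hMZ' : M.1 < Z := lt_of_le_of_ne hMZ fun e => hZ ⟨M, hMC, e⟩
  have hZN' : Z < N.1 := lt_of_le_of_ne hZN fun e => hZ ⟨N, hNC, e.symm⟩
  obtain ⟨W, hWcl, hMW, hWN, hWJ⟩ := h M.1.1 Z.1 N.1.1 M.1.2 Z.2 N.1.2 hMZ' hZN' M.2 N.2
  let W' : Inv := ⟨⟨W, hWcl⟩, hWJ⟩
  have hWC : W' ∈ C₀ := hbetween W' hMW.le hWN.le
  rcases hcomp W' hWC with h1 | h1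
  · exact hMW.not_ge (hM W' hWC h1)
  · exact hWN.not_ge (hN W' hWC h1)

variable [CompleteSpace X]

/-- Sublinearity of the spectrum passes to the closure. -/
lemma hasCountablePencils_topologicalClosure {J : Submodule ℂ (X →L[ℂ] X)}
    (hcompact : ∀ A ∈ J.topologicalClosure, IsCompactOperator A)
    (hsublin : ∀ A ∈ J, ∀ B ∈ J, ∀ lam : ℂ, ∀ mu ∈ spectrum ℂ (A + lam • B),
      ∃ α ∈ spectrum ℂ A, ∃ β ∈ spectrum ℂ B, mu = α + lam * β) :
    HasCountablePencils J.topologicalClosure := by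
  intro a ha b hb
  refine ⟨spectrum ℂ b ×ˢ spectrum ℂ a, (hcompact b hb).countable_spectrum.prod
    (hcompact a ha).countable_spectrum, fun lam ν hν _ => ?_⟩
  have hmem : b + lam • a ∈ J.topologicalClosure :=
    Submodule.add_mem _ hb (Submodule.smul_mem _ lam ha)
  have hcl : (b, a) ∈ closure ((J : Set (X →L[ℂ] X)) ×ˢ (J : Set (X →L[ℂ] X))) := by
    rw [closure_prod_eq]; exact ⟨hb, ha⟩
  have hcont : ContinuousAt (fun p : (X →L[ℂ] X) × (X →L[ℂ] X) => p.1 + lam • p.2) (b, a) := by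
    fun_prop
  have happrox : ∀ k : ℕ, ∃ p : ((X →L[ℂ] X) × (X →L[ℂ] X)) × (ℂ × ℂ),
      dist p.1 (b, a) < 1 / ((k : ℝ) + 1) ∧ p.2.1 ∈ spectrum ℂ p.1.1 ∧
        p.2.2 ∈ spectrum ℂ p.1.2 ∧ dist (p.2.1 + lam * p.2.2) ν < 1 / ((k : ℝ) + 1) := by
    intro k
    have hk : (0 : ℝ) < 1 / ((k : ℝ) + 1) := Nat.one_div_pos_of_nat
    have hball : ∀ᶠ p in 𝓝 (b, a), dist p (b, a) < 1 / ((k : ℝ) + 1) := Metric.ball_mem_nhds _ hk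
    obtain ⟨⟨b', a'⟩, ⟨hb', ha'⟩, hdist, ν', hν', hνd⟩ :=
      ((mem_closure_iff_frequently.1 hcl).and_eventually
        (hball.and (hcont.eventually
          (spectrum.eventually_exists_dist_lt (hcompact _ hmem).countable_spectrum hν hk)))).exists
    obtain ⟨α, hα, β, hβ, rfl⟩ := hsublin b' hb' a' ha' lam ν' hν'
    exact ⟨((b', a'), (α, β)), hdist, hα, hβ, hνd⟩
  choose p hp1 hp2 hp3 hp4 using happrox
  have hlim : Tendsto (fun k : ℕ => 1 / ((k : ℝ) + 1)) atTop (𝓝 0) :=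
    tendsto_one_div_add_atTop_nhds_zero_nat
  have hp : Tendsto (fun k => (p k).1) atTop (𝓝 (b, a)) :=
    tendsto_iff_dist_tendsto_zero.2
      (squeeze_zero (fun _ => dist_nonneg) (fun k => (hp1 k).le) hlim)
  have hsum : Tendsto (fun k => (p k).2.1 + lam * (p k).2.2) atTop (𝓝 ν) :=
    tendsto_iff_dist_tendsto_zero.2
      (squeeze_zero (fun _ => dist_nonneg) (fun k => (hp4 k).le) hlim)
  obtain ⟨R, hR⟩ := (Metric.isBounded_range_of_tendsto _ hp).exists_norm_le
  have hbound : ∀ k, (p k).2 ∈ Metric.closedBall (0 : ℂ × ℂ) (R * ‖(1 : X →L[ℂ] X)‖) := by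
    intro k
    have h1 : ‖(p k).1‖ ≤ R := hR _ ⟨k, rfl⟩
    rw [mem_closedBall_zero_iff, Prod.norm_def, max_le_iff]
    exact ⟨(spectrum.norm_le_norm_mul_of_mem (hp2 k)).trans
        (mul_le_mul_of_nonneg_right ((norm_fst_le _).trans h1) (norm_nonneg _)),
      (spectrum.norm_le_norm_mul_of_mem (hp3 k)).trans
        (mul_le_mul_of_nonneg_right ((norm_snd_le _).trans h1) (norm_nonneg _))⟩
  obtain ⟨d, -, φ, hφ, hd⟩ := (isCompact_closedBall (0 : ℂ × ℂ) _).tendsto_subseq hbound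
  have hpφ := hp.comp hφ.tendsto_atTop
  have hspec : ∀ {z : ℂ} {c : X →L[ℂ] X} {w : ℕ → ℂ} {f : ℕ → X →L[ℂ] X},
      Tendsto w atTop (𝓝 z) → Tendsto f atTop (𝓝 c) → (∀ k, w k ∈ spectrum ℂ (f k)) →
      z ∈ spectrum ℂ c := by
    intro z c w f hw hf hwf
    have h1 : Tendsto (fun k => algebraMap ℂ (X →L[ℂ] X) (w k) - f k) atTop
        (𝓝 (algebraMap ℂ (X →L[ℂ] X) z - c)) :=
      (((algebraMapCLM ℂ (X →L[ℂ] X)).continuous.tendsto z).comp hw).sub hf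
    exact nonunits.isClosed.mem_of_tendsto h1 (Eventually.of_forall hwf)
  refine ⟨d, ⟨?_, ?_⟩, tendsto_nhds_unique (hsum.comp hφ.tendsto_atTop) ?_⟩
  · exact hspec ((continuous_fst.tendsto d).comp hd) ((continuous_fst.tendsto _).comp hpφ)
      fun k => hp2 _
  · exact hspec ((continuous_snd.tendsto d).comp hd) ((continuous_snd.tendsto _).comp hpφ)
      fun k => hp3 _
  · have h1 : Continuous fun e : ℂ × ℂ => e.1 + lam * e.2 := by fun_prop
    exact (h1.tendsto d).comp hd

/-- Between two closed invariant subspaces that are not adjacent in the lattice of closed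
subspaces there is a further closed invariant subspace. -/
theorem exists_invariant_between {J : Submodule ℂ (X →L[ℂ] X)}
    (hJ : ∀ a ∈ J, ∀ b ∈ J, a * b + b * a ∈ J) (hJcl : IsClosed (J : Set (X →L[ℂ] X)))
    (hc : ∀ a ∈ J, IsCompactOperator a) (hline : HasCountablePencils J)
    {M Z N : Submodule ℂ X} (hM : IsClosed (M : Set X)) (hZ : IsClosed (Z : Set X))
    (hN : IsClosed (N : Set X)) (hMZ : M < Z) (hZN : Z < N)
    (hJM : ∀ a ∈ J, ∀ x ∈ M, a x ∈ M) (hJN : ∀ a ∈ J, ∀ x ∈ N, a x ∈ N) :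
    ∃ W : Submodule ℂ X, IsClosed (W : Set X) ∧ M < W ∧ W < N ∧ ∀ a ∈ J, ∀ x ∈ W, a x ∈ W := by
  have hcomplN : CompleteSpace N := hN.completeSpace_coe
  have hclM : IsClosed ((M.submoduleOf N : Submodule ℂ N) : Set N) :=
    hM.preimage continuous_subtype_val
  let Y := N ⧸ M.submoduleOf N
  let ρ : N →L[ℂ] Y := (M.submoduleOf N).mkQL
  have hρ : Function.Surjective ρ := Submodule.mkQ_surjective _
  have hρo : IsOpenMap ρ := Submodule.isOpenMap_mkQ _
  have hker : ∀ x : N, ρ x = 0 ↔ (x : X) ∈ M := fun x => Submodule.Quotient.mk_eq_zero _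
  have hMN : M ≤ N := hMZ.le.trans hZN.le
  have hlift : ∀ a : X →L[ℂ] X, (∀ x ∈ N, a x ∈ N) → (∀ x ∈ M, a x ∈ M) →
      ∃ S, IsInduced ρ a S := by
    intro a haN haM
    let r : N →L[ℂ] N := (a.comp N.subtypeL).codRestrict N fun x => haN x x.2
    refine ⟨(M.submoduleOf N).liftQL (ρ.comp r) fun x hx => ?_, fun x => ⟨haN x x.2, rfl⟩⟩
    exact (hker (r x)).2 (haM x hx)
  have hind : ∀ a ∈ J, ∃ S, IsInduced ρ a S := fun a ha => hlift a (hJN a ha) (hJM a ha)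
  have hexists : ∀ b ∈ J, ∀ T : Y →L[ℂ] Y, IsInduced ρ b T → ∀ l : ℂ, l ≠ 0 →
      l ∈ spectrum ℂ T → l ∈ spectrum ℂ b ∧ ∃ p ∈ inducedSubmodule ρ J, p ≠ 0 ∧ p * p = p ∧
        ∃ m : ℕ, (T - algebraMap ℂ _ l) ^ m * p = 0 := fun b hb T hT l hl hlT =>
    hT.exists_idempotent hJ hJcl (hc b hb) hb hN hρo hρ hM hker (hJM b hb) hlift hl hlT
  have hred : IsReducible (inducedSubmodule ρ J : Set (Y →L[ℂ] Y)) := by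
    have hZρ : ∀ x : N, ρ x ∈ (Z.comap N.subtype).map (ρ : N →ₗ[ℂ] Y) ↔ (x : X) ∈ Z := by
      refine fun x => ⟨?_, fun hx => ⟨x, hx, rfl⟩⟩
      rintro ⟨y, hy, hyx⟩
      have h1 : ρ (y - x) = 0 := by rw [map_sub, sub_eq_zero]; exact hyx
      have h2 := Z.sub_mem hy (hMZ.le ((hker _).1 h1))
      simpa using h2
    refine isReducible_of_hasCountablePencils (M := (Z.comap N.subtype).map (ρ : N →ₗ[ℂ] Y))
      ?_ ?_ ?_ ?_ ?_ ?_ ?_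
    · rintro S ⟨a, ha, haS⟩ T ⟨b, hb, hbT⟩
      exact ⟨a * b + b * a, hJ a ha b hb, (haS.mul hbT).add (hbT.mul haS)⟩
    · rintro S ⟨a, ha, haS⟩
      exact haS.isCompactOperator hN hρo (hc a ha)
    · rintro S ⟨a, ha, haS⟩ T ⟨b, hb, hbT⟩
      obtain ⟨D, hD, hD'⟩ := hline a ha b hb
      exact ⟨D, hD, fun lam ν hν hν0 => hD' lam ν (hexists _ (J.add_mem hb (J.smul_mem lam ha)) _
        (hbT.add (haS.smul lam)) ν hν0 hν).1 hν0⟩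
    · rintro T ⟨b, hb, hbT⟩ l hl hl0
      exact (hexists b hb T hbT l hl0 hl).2
    · rw [← (Submodule.isQuotientMap_mkQL (M.submoduleOf N)).isClosed_preimage]
      have h1 : ((M.submoduleOf N).mkQL : N → Y) ⁻¹'
          ((Z.comap N.subtype).map (ρ : N →ₗ[ℂ] Y) : Set Y) = Subtype.val ⁻¹' (Z : Set X) :=
        Set.ext hZρ
      rw [h1]
      exact hZ.preimage continuous_subtype_val
    · intro h
      obtain ⟨z, hz, hzM⟩ := SetLike.exists_of_lt hMZ
      have h1 := (hZρ ⟨z, hZN.le hz⟩).2 hz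
      rw [h] at h1
      exact hzM ((hker _).1 h1)
    · intro h
      obtain ⟨x, hx, hxZ⟩ := SetLike.exists_of_lt hZN
      exact hxZ ((hZρ ⟨x, hx⟩).1 (h ▸ Submodule.mem_top))
  obtain ⟨V, hV, hV0, hV1, hVinv⟩ := hred
  have hW : ∀ x : N, (x : X) ∈ (V.comap (ρ : N →ₗ[ℂ] Y)).map N.subtype ↔ ρ x ∈ V := by
    refine fun x => ⟨?_, fun hx => ⟨x, hx, rfl⟩⟩
    rintro ⟨y, hy, hyx⟩
    rw [← Subtype.ext hyx]
    exact hy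
  have hWN : (V.comap (ρ : N →ₗ[ℂ] Y)).map N.subtype ≤ N := by
    rintro _ ⟨y, -, rfl⟩
    exact y.2
  refine ⟨(V.comap (ρ : N →ₗ[ℂ] Y)).map N.subtype, ?_, ?_, ?_, ?_⟩
  · rw [Submodule.map_coe]
    exact hN.isClosedEmbedding_subtypeVal.isClosedMap _ (hV.preimage ρ.continuous)
  · refine lt_of_le_of_ne (fun x hx => ?_) fun h => ?_
    · refine (hW ⟨x, hMN hx⟩).2 ?_
      rw [(hker ⟨x, hMN hx⟩).2 hx]
      exact V.zero_mem
    · refine hV0 ((Submodule.eq_bot_iff _).2 fun y hy => ?_)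
      obtain ⟨x, rfl⟩ := hρ y
      rw [hker, h]
      exact (hW x).2 hy
  · refine lt_of_le_of_ne hWN fun h => hV1 (eq_top_iff.2 fun y _ => ?_)
    obtain ⟨x, rfl⟩ := hρ y
    rw [← hW, h]
    exact x.2
  · intro a ha x hx
    obtain ⟨S, hS⟩ := hind a ha
    obtain ⟨h1, h2⟩ := hS ⟨x, hWN hx⟩
    refine (hW ⟨a x, h1⟩).2 ?_
    rw [h2]
    exact hVinv S ⟨a, ha, hS⟩ _ ((hW ⟨x, hWN hx⟩).1 hx)

end Chains

/-- A Jordan algebra of compact operators with sublinear spectrum is triangularizable: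
there is a chain of closed invariant subspaces which is a maximal chain in the
lattice of all closed subspaces. -/
theorem jordan_algebra_sublinear_triangularizable
    {X : Type*} [NormedAddCommGroup X] [NormedSpace ℂ X] [CompleteSpace X]
    (J : Submodule ℂ (X →L[ℂ] X))
    (hJordan : ∀ A ∈ J, ∀ B ∈ J, A * B + B * A ∈ J)
    (hcompact : ∀ A ∈ J, IsCompactOperator A)
    (hsublin : ∀ A ∈ J, ∀ B ∈ J, ∀ lam : ℂ,
      ∀ mu ∈ spectrum ℂ (A + lam • B),
        ∃ α ∈ spectrum ℂ A, ∃ β ∈ spectrum ℂ B, mu = α + lam * β) :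
    ∃ C : Set {M : Submodule ℂ X // IsClosed (M : Set X)},
      (∀ M ∈ C, ∀ A ∈ J, ∀ x ∈ M.1, A x ∈ M.1) ∧
      IsMaxChain (· ≤ ·) C := by
  have hc : ∀ A ∈ J.topologicalClosure, IsCompactOperator A := fun A hA =>
    closure_minimal (t := {A : X →L[ℂ] X | IsCompactOperator A}) (fun A hA => hcompact A hA)
      isClosed_setOfPred_isCompactOperator hA
  have hJ : ∀ A ∈ J.topologicalClosure, ∀ B ∈ J.topologicalClosure,
      A * B + B * A ∈ J.topologicalClosure := fun A hA B hB =>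
    map_mem_closure₂ (f := fun A B : X →L[ℂ] X => A * B + B * A) (by fun_prop) hA hB hJordan
  obtain ⟨C, hC, hmax⟩ := exists_isMaxChain_of_refinement
    (J := (J.topologicalClosure : Set (X →L[ℂ] X))) fun M Z N hM hZ hN hMZ hZN hJM hJN =>
      exists_invariant_between hJ J.isClosed_topologicalClosure hc
        (hasCountablePencils_topologicalClosure hc hsublin) hM hZ hN hMZ hZN hJM hJN
  exact ⟨C, fun M hM A hA => hC M hM A (J.le_topologicalClosure hA), hmax⟩
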